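/- Let f be a complex polynomial of degree d ≥ 2 whose Julia set J_f is disconnected. A connected component K of the filled-in Julia set K_f is a single point if and only if there do not exist integers n ≥ 0 and m ≥ 1 such that f^{n+m}(K) = f^n(K) and some component among f^n(K), f^{n+1}(K), …, f^{n+m-1}(K) contains a critical point of f. -/

import Mathlib

section

open MeasureTheory Set Metric Topology Filter
open scoped ENNReal NNReal

namespace BrannerHubbard

/-- `g` bounds the oscillation of `φ` along every differentiable curve. -/
def IsUpperGradient (φ : ℂ → ℝ) (g : ℂ → ℝ≥0∞) : Prop :=
  ∀ γ : ℝ → ℂ, Differentiable ℝ γ → ∀ a b, a ≤ b →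
    ENNReal.ofReal |φ (γ b) - φ (γ a)| ≤ ∫⁻ t in Ioc a b, g (γ t) * ‖deriv γ t‖ₑ

/-- `φ` is an admissible test function, with upper gradient `g`, for the capacity of `A`
relative to `U`. -/
structure Adm (U A : Set ℂ) (φ : ℂ → ℝ) (g : ℂ → ℝ≥0∞) : Prop where
  cont : Continuous φ
  nonneg : ∀ z, 0 ≤ φ z
  le_one : ∀ z, φ z ≤ 1
  eq_one : ∀ z ∈ A, φ z = 1
  supp : ∃ K, IsCompact K ∧ K ⊆ U ∧ ∀ z ∉ K, φ z = 0
  meas : Measurable g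
  grad : IsUpperGradient φ g

/-- The capacity of `A` relative to `U` is at most `c`. -/
def HasCap (U A : Set ℂ) (c : ℝ) : Prop :=
  ∃ φ g, Adm U A φ g ∧ ∫⁻ z, g z ^ 2 ≤ ENNReal.ofReal c

lemma Adm.mono {U A U' A' : Set ℂ} {φ g} (h : Adm U A φ g) (hU : U ⊆ U') (hA : A' ⊆ A) :
    Adm U' A' φ g where
  cont := h.cont
  nonneg := h.nonneg
  le_one := h.le_one
  eq_one z hz := h.eq_one z (hA hz)
  supp := let ⟨K, h1, h2, h3⟩ := h.supp; ⟨K, h1, h2.trans hU, h3⟩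
  meas := h.meas
  grad := h.grad

lemma HasCap.mono {U A U' A' : Set ℂ} {c c' : ℝ} (h : HasCap U A c) (hU : U ⊆ U')
    (hA : A' ⊆ A) (hc : c ≤ c') : HasCap U' A' c' := by
  obtain ⟨φ, g, h1, h2⟩ := h
  exact ⟨φ, g, h1.mono hU hA, h2.trans (ENNReal.ofReal_le_ofReal hc)⟩

lemma Adm.eq_zero {U A : Set ℂ} {φ g} (h : Adm U A φ g) {z : ℂ} (hz : z ∉ U) : φ z = 0 := by
  obtain ⟨K, _, h2, h3⟩ := h.supp
  exact h3 z fun hK => hz (h2 hK)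

/-- If `h` is constant on a closed set `T`, oscillation bounds on the intervals avoiding `T`
imply the bound on the whole interval. -/
lemma ofReal_abs_sub_le_of_gaps {h : ℝ → ℝ} {w : ℝ → ℝ≥0∞} {T : Set ℝ} {a b v : ℝ}
    (hab : a ≤ b) (hc : Continuous h) (hT : IsClosed T) (hv : ∀ t ∈ T, h t = v)
    (H : ∀ s t, a ≤ s → s ≤ t → t ≤ b → Disjoint (Icc s t) T →
      ENNReal.ofReal |h t - h s| ≤ ∫⁻ x in Ioc s t, w x) :
    ENNReal.ofReal |h b - h a| ≤ ∫⁻ x in Ioc a b, w x := by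
  by_cases hne : (Icc a b ∩ T).Nonempty
  swap
  · exact H a b le_rfl hab le_rfl (disjoint_iff_inter_eq_empty.2 (not_nonempty_iff_eq_empty.1 hne))
  have hcomp : IsCompact (Icc a b ∩ T) := isCompact_Icc.inter_right hT
  obtain ⟨t1, ⟨ht1, ht1T⟩, hmin⟩ := hcomp.exists_isLeast hne
  obtain ⟨t2, ⟨ht2, ht2T⟩, hmax⟩ := hcomp.exists_isGreatest hne
  have h12 : t1 ≤ t2 := hmin ⟨ht2, ht2T⟩
  have key2 : ENNReal.ofReal |h b - v| ≤ ∫⁻ x in Ioc t2 b, w x := by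
    rcases eq_or_lt_of_le ht2.2 with h0 | h0
    · rw [← h0, hv t2 ht2T]; simp
    have hlim : Tendsto (fun s => ENNReal.ofReal |h b - h s|) (𝓝[>] t2)
        (𝓝 (ENNReal.ofReal |h b - h t2|)) := by
      have : Continuous fun s => ENNReal.ofReal |h b - h s| :=
        ENNReal.continuous_ofReal.comp (continuous_abs.comp (continuous_const.sub hc))
      exact (this.tendsto t2).mono_left nhdsWithin_le_nhds
    rw [hv t2 ht2T] at hlim
    refine le_of_tendsto hlim ?_
    filter_upwards [Ioo_mem_nhdsGT h0] with s hs
    refine (H s b (ht2.1.trans hs.1.le) hs.2.le le_rfl ?_).trans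
      (lintegral_mono_set (Ioc_subset_Ioc_left hs.1.le))
    refine Set.disjoint_left.2 fun x hx hxT => ?_
    have := hmax ⟨⟨(ht2.1.trans hs.1.le).trans hx.1, hx.2⟩, hxT⟩
    linarith [hs.1, hx.1]
  have key1 : ENNReal.ofReal |v - h a| ≤ ∫⁻ x in Ioc a t1, w x := by
    rcases eq_or_lt_of_le ht1.1 with h0 | h0
    · rw [h0, hv t1 ht1T]; simp
    have hlim : Tendsto (fun s => ENNReal.ofReal |h s - h a|) (𝓝[<] t1)
        (𝓝 (ENNReal.ofReal |h t1 - h a|)) := by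
      have : Continuous fun s => ENNReal.ofReal |h s - h a| :=
        ENNReal.continuous_ofReal.comp (continuous_abs.comp (hc.sub continuous_const))
      exact (this.tendsto t1).mono_left nhdsWithin_le_nhds
    rw [hv t1 ht1T] at hlim
    refine le_of_tendsto hlim ?_
    filter_upwards [Ioo_mem_nhdsLT h0] with s hs
    refine (H a s le_rfl hs.1.le (hs.2.le.trans ht1.2) ?_).trans
      (lintegral_mono_set (Ioc_subset_Ioc_right hs.2.le))
    refine Set.disjoint_left.2 fun x hx hxT => ?_
    have := hmin ⟨⟨hx.1, hx.2.trans (hs.2.le.trans ht1.2)⟩, hxT⟩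
    linarith [hs.2, hx.2]
  calc ENNReal.ofReal |h b - h a| ≤ ENNReal.ofReal (|v - h a| + |h b - v|) := by
        apply ENNReal.ofReal_le_ofReal
        have := abs_add_le (v - h a) (h b - v)
        rwa [show v - h a + (h b - v) = h b - h a by ring] at this
    _ ≤ ENNReal.ofReal |v - h a| + ENNReal.ofReal |h b - v| := ENNReal.ofReal_add_le
    _ ≤ (∫⁻ x in Ioc a t1, w x) + ∫⁻ x in Ioc t2 b, w x := add_le_add key1 key2
    _ = ∫⁻ x in Ioc a t1 ∪ Ioc t2 b, w x := by
        rw [lintegral_union measurableSet_Ioc]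
        refine Set.disjoint_left.2 fun x hx hx' => ?_
        linarith [hx.2, hx'.1]
    _ ≤ ∫⁻ x in Ioc a b, w x := lintegral_mono_set
        (union_subset (Ioc_subset_Ioc_right ht1.2) (Ioc_subset_Ioc_left ht2.1))

lemma IsUpperGradient.cut {φ g} (h : IsUpperGradient φ g) (hc : Continuous φ) (v : ℝ) :
    IsUpperGradient φ ({z | φ z ≠ v}.indicator g) := by
  intro γ hγ a b hab
  refine ofReal_abs_sub_le_of_gaps (h := fun t => φ (γ t)) (T := {t | φ (γ t) = v}) hab
    (hc.comp hγ.continuous) (isClosed_eq (hc.comp hγ.continuous) continuous_const)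
    (fun t ht => ht) fun s t _ hst _ hd => (h γ hγ s t hst).trans_eq ?_
  refine setLIntegral_congr_fun measurableSet_Ioc fun x hx => ?_
  have : φ (γ x) ≠ v := fun hv => Set.disjoint_left.1 hd ⟨hx.1.le, hx.2⟩ hv
  simp [this]

/-- One may assume that the upper gradient vanishes where `φ` takes the values `0` and `1`. -/
lemma Adm.cut {U A : Set ℂ} {φ g} (h : Adm U A φ g) :
    Adm U A φ ({z | φ z ≠ 0 ∧ φ z ≠ 1}.indicator g) where
  cont := h.cont
  nonneg := h.nonneg
  le_one := h.le_one
  eq_one := h.eq_one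
  supp := h.supp
  meas := by
    refine h.meas.indicator (IsOpen.measurableSet ?_)
    exact (isOpen_ne_fun h.cont continuous_const).inter (isOpen_ne_fun h.cont continuous_const)
  grad := by
    have := (h.grad.cut h.cont 1).cut h.cont 0
    rwa [indicator_indicator] at this

lemma lintegral_indicator_sq_le (S : Set ℂ) (g : ℂ → ℝ≥0∞) :
    ∫⁻ z, S.indicator g z ^ 2 ≤ ∫⁻ z, g z ^ 2 := by
  refine lintegral_mono fun z => ?_
  gcongr
  exact indicator_le_self _ _ _

lemma HasCap.exists_cut {U A : Set ℂ} {c : ℝ} (h : HasCap U A c) :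
    ∃ φ g, Adm U A φ g ∧ ∫⁻ z, g z ^ 2 ≤ ENNReal.ofReal c ∧
      ∀ z, φ z = 0 ∨ φ z = 1 → g z = 0 := by
  obtain ⟨φ, g, h1, h2⟩ := h
  refine ⟨φ, _, h1.cut, (lintegral_indicator_sq_le _ _).trans h2, fun z hz => ?_⟩
  refine indicator_of_notMem ?_ _
  rintro ⟨h0, h1⟩
  tauto

lemma hasCap_empty (U : Set ℂ) : HasCap U ∅ 0 :=
  ⟨fun _ => 0, fun _ => 0, ⟨continuous_const, by simp, by simp, by simp,
    ⟨∅, isCompact_empty, empty_subset _, by simp⟩, measurable_const,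
    fun _ _ _ _ _ => by simp⟩, by simp⟩

lemma HasCap.union {U A A' : Set ℂ} {c c' : ℝ} (hc : 0 ≤ c) (hc' : 0 ≤ c') (h : HasCap U A c)
    (h' : HasCap U A' c') : HasCap U (A ∪ A') (c + c') := by
  obtain ⟨φ, g, a, e⟩ := h
  obtain ⟨φ', g', a', e'⟩ := h'
  refine ⟨fun z => max (φ z) (φ' z), fun z => max (g z) (g' z), ⟨a.cont.max a'.cont,
    fun z => le_max_of_le_left (a.nonneg z), fun z => max_le (a.le_one z) (a'.le_one z),
    ?_, ?_, a.meas.max a'.meas, ?_⟩, ?_⟩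
  · rintro z (hz | hz)
    · exact le_antisymm (max_le (a.le_one z) (a'.le_one z)) (le_max_of_le_left (a.eq_one z hz).ge)
    · exact le_antisymm (max_le (a.le_one z) (a'.le_one z)) (le_max_of_le_right (a'.eq_one z hz).ge)
  · obtain ⟨K, h1, h2, h3⟩ := a.supp
    obtain ⟨K', h1', h2', h3'⟩ := a'.supp
    refine ⟨K ∪ K', h1.union h1', union_subset h2 h2', fun z hz => ?_⟩
    simp only [mem_union, not_or] at hz
    simp [h3 z hz.1, h3' z hz.2]
  · intro γ hγ s t hst
    have h1 := (a.grad γ hγ s t hst).trans (lintegral_mono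
      (g := fun x => max (g (γ x)) (g' (γ x)) * ‖deriv γ x‖ₑ) fun x => mul_le_mul_left (le_max_left _ _) _)
    have h2 := (a'.grad γ hγ s t hst).trans (lintegral_mono
      (g := fun x => max (g (γ x)) (g' (γ x)) * ‖deriv γ x‖ₑ) fun x => mul_le_mul_left (le_max_right _ _) _)
    refine le_trans ?_ (max_le h1 h2)
    rw [← (ENNReal.ofReal_mono).map_max]
    exact ENNReal.ofReal_le_ofReal (abs_max_sub_max_le_max _ _ _ _)
  · calc ∫⁻ z, max (g z) (g' z) ^ 2 ≤ ∫⁻ z, (g z ^ 2 + g' z ^ 2) := by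
          refine lintegral_mono fun z => ?_
          rcases le_total (g z) (g' z) with h | h
          · simp only [max_eq_right h]; exact le_add_self
          · simp only [max_eq_left h]; exact le_self_add
      _ = (∫⁻ z, g z ^ 2) + ∫⁻ z, g' z ^ 2 := lintegral_add_left (a.meas.pow_const 2) _
      _ ≤ ENNReal.ofReal (c + c') := by
          rw [ENNReal.ofReal_add hc hc']; exact add_le_add e e'

lemma HasCap.biUnion {ι : Type*} {U : Set ℂ} (s : Finset ι) {A : ι → Set ℂ} {c : ι → ℝ}
    (hc : ∀ i ∈ s, 0 ≤ c i) (h : ∀ i ∈ s, HasCap U (A i) (c i)) :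
    HasCap U (⋃ i ∈ s, A i) (∑ i ∈ s, c i) := by
  classical
  induction s using Finset.induction_on with
  | empty => simpa using hasCap_empty U
  | insert i s hi ih =>
    rw [Finset.sum_insert hi, Finset.set_biUnion_insert]
    exact HasCap.union (hc i (Finset.mem_insert_self i s))
      (Finset.sum_nonneg fun j hj => hc j (Finset.mem_insert_of_mem hj))
      (h i (Finset.mem_insert_self i s))
      (ih (fun j hj => hc j (Finset.mem_insert_of_mem hj))
        fun j hj => h j (Finset.mem_insert_of_mem hj))

/-- Series law: a chain of `M` nested pairs of capacity at most `c` has capacity at most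
`c / M`. -/
lemma HasCap.chain {L : ℕ → Set ℂ} {c : ℝ} (hL : ∀ i, L (i + 1) ⊆ L i)
    (h : ∀ i, HasCap (L i) (L (i + 1)) c) {M : ℕ} (hM : 0 < M) :
    HasCap (L 0) (L M) (c / M) := by
  choose φ g a e hz using fun i => (h i).exists_cut
  have anti : Antitone L := antitone_nat_of_succ_le hL
  have hM' : (0 : ℝ) < M := Nat.cast_pos.2 hM
  have disj : ∀ i j, i < j → ∀ z, g i z = 0 ∨ g j z = 0 := by
    intro i j hij z
    by_cases hzj : z ∈ L j
    · exact Or.inl (hz i z (Or.inr ((a i).eq_one z (anti hij hzj))))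
    · exact Or.inr (hz j z (Or.inl ((a j).eq_zero hzj)))
  have hsq : ∀ (n : ℕ) z, (∑ i ∈ Finset.range n, g i z) ^ 2 = ∑ i ∈ Finset.range n, g i z ^ 2 := by
    intro n z
    induction n with
    | zero => simp
    | succ n ih =>
      rw [Finset.sum_range_succ, Finset.sum_range_succ, ← ih]
      by_cases h0 : g n z = 0
      · simp [h0]
      · have : ∑ i ∈ Finset.range n, g i z = 0 := Finset.sum_eq_zero fun i hi =>
          (disj i n (Finset.mem_range.1 hi) z).resolve_right h0
        simp [this]
  have hMe : ENNReal.ofReal (M : ℝ)⁻¹ = (M : ℝ≥0∞)⁻¹ := by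
    rw [ENNReal.ofReal_inv_of_pos hM', ENNReal.ofReal_natCast]
  refine ⟨fun z => (M : ℝ)⁻¹ * ∑ i ∈ Finset.range M, φ i z,
    fun z => (M : ℝ≥0∞)⁻¹ * ∑ i ∈ Finset.range M, g i z,
    ⟨continuous_const.mul (continuous_finsetSum _ fun i _ => (a i).cont), fun z => ?_, fun z => ?_,
    fun z hz => ?_, ?_, (Finset.measurable_fun_sum _ fun i _ => (a i).meas).const_mul _, ?_⟩, ?_⟩
  · exact mul_nonneg (by positivity) (Finset.sum_nonneg fun i _ => (a i).nonneg z)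
  · rw [inv_mul_le_iff₀ hM']
    exact (Finset.sum_le_card_nsmul _ _ 1 fun i _ => (a i).le_one z).trans (by simp)
  · rw [Finset.sum_congr rfl fun i hi =>
      (a i).eq_one z (anti (Nat.succ_le_of_lt (Finset.mem_range.1 hi)) hz)]
    simp [hM'.ne']
  · obtain ⟨K, h1, h2, h3⟩ := (a 0).supp
    refine ⟨K, h1, h2, fun z hzK => ?_⟩
    rw [Finset.sum_eq_zero, mul_zero]
    intro i _
    rcases Nat.eq_zero_or_pos i with rfl | hi
    · exact h3 z hzK
    · refine (a i).eq_zero fun hzi => ?_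
      have := (a 0).eq_one z (anti hi hzi)
      rw [h3 z hzK] at this
      exact zero_ne_one this
  · intro γ hγ s t hst
    rw [← mul_sub, ← Finset.sum_sub_distrib, abs_mul, abs_of_nonneg (by positivity),
      ENNReal.ofReal_mul (by positivity), hMe]
    simp_rw [mul_assoc, Finset.sum_mul]
    rw [lintegral_const_mul' _ _ (by simp [hM.ne']),
      lintegral_finsetSum (f := fun i x => g i (γ x) * ‖deriv γ x‖ₑ) _ fun i _ =>
        (((a i).meas.comp hγ.continuous.measurable).mul (measurable_deriv γ).enorm)]
    gcongr
    calc ENNReal.ofReal |∑ i ∈ Finset.range M, (φ i (γ t) - φ i (γ s))|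
        ≤ ENNReal.ofReal (∑ i ∈ Finset.range M, |φ i (γ t) - φ i (γ s)|) :=
          ENNReal.ofReal_le_ofReal (Finset.abs_sum_le_sum_abs _ _)
      _ = ∑ i ∈ Finset.range M, ENNReal.ofReal |φ i (γ t) - φ i (γ s)| :=
          ENNReal.ofReal_sum_of_nonneg fun _ _ => abs_nonneg _
      _ ≤ _ := Finset.sum_le_sum fun i _ => (a i).grad γ hγ s t hst
  · simp_rw [mul_pow, hsq]
    rw [lintegral_const_mul' _ _ (by simp [hM.ne']),
      lintegral_finsetSum _ fun i _ => (a i).meas.pow_const 2]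
    calc (M : ℝ≥0∞)⁻¹ ^ 2 * ∑ i ∈ Finset.range M, ∫⁻ z, g i z ^ 2
        ≤ (M : ℝ≥0∞)⁻¹ ^ 2 * (M * ENNReal.ofReal c) := by
          gcongr
          exact (Finset.sum_le_card_nsmul _ _ _ fun i _ => e i).trans (by simp)
      _ = (M : ℝ≥0∞)⁻¹ * ENNReal.ofReal c := by
          rw [sq, mul_assoc, ← mul_assoc (M : ℝ≥0∞)⁻¹ M, ENNReal.inv_mul_cancel, one_mul] <;>
          simp [hM.ne']
      _ = ENNReal.ofReal (c / M) := by
          rw [div_eq_inv_mul, ENNReal.ofReal_mul (by positivity), hMe]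

lemma enorm_sub_le_lintegral_deriv {γ : ℝ → ℂ} (hγ : Differentiable ℝ γ) {a b : ℝ} (hab : a ≤ b) :
    ‖γ b - γ a‖ₑ ≤ ∫⁻ t in Ioc a b, ‖deriv γ t‖ₑ := by
  by_cases hfin : ∫⁻ t in Ioc a b, ‖deriv γ t‖ₑ = ∞
  · rw [hfin]; exact le_top
  have hinteg : IntervalIntegrable (deriv γ) volume a b := by
    rw [intervalIntegrable_iff_integrableOn_Ioc_of_le hab]
    exact ⟨(measurable_deriv γ).aestronglyMeasurable, lt_top_iff_ne_top.2 hfin⟩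
  rw [← intervalIntegral.integral_eq_sub_of_hasDerivAt (fun t _ => (hγ t).hasDerivAt) hinteg,
    intervalIntegral.integral_of_le hab]
  exact enorm_integral_le_lintegral_enorm _

lemma hasCap_ball (y : ℂ) {r : ℝ} (hr : 0 < r) : HasCap (ball y (2 * r)) (ball y r) (16 * Real.pi) := by
  set φ : ℂ → ℝ := fun z => max 0 (min 1 (3 - 2 / r * dist z y)) with hφ
  have hcont : Continuous φ := by fun_prop
  have hlip : ∀ z w, |φ z - φ w| ≤ 2 / r * dist z w := by
    intro z w
    calc |φ z - φ w| ≤ |(3 - 2 / r * dist z y) - (3 - 2 / r * dist w y)| := by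
          refine (abs_max_sub_max_le_max _ _ _ _).trans ?_
          rw [sub_self, abs_zero, max_eq_right (abs_nonneg _)]
          refine (abs_min_sub_min_le_max _ _ _ _).trans ?_
          rw [sub_self, abs_zero, max_eq_right (abs_nonneg _)]
      _ = 2 / r * |dist z y - dist w y| := by
          rw [← abs_of_pos (show 0 < 2 / r by positivity), ← abs_mul, ← abs_neg,
            abs_of_pos (show 0 < 2 / r by positivity)]
          ring_nf
      _ ≤ 2 / r * dist z w := by gcongr; exact abs_dist_sub_le z w y
  have hzero : ∀ z, z ∉ closedBall y (3 / 2 * r) → φ z = 0 := by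
    intro z hz
    rw [mem_closedBall, not_le] at hz
    refine max_eq_left ((min_le_right _ _).trans ?_)
    have : 2 / r * (3 / 2 * r) ≤ 2 / r * dist z y := by gcongr
    have h3 : 2 / r * (3 / 2 * r) = 3 := by field_simp
    linarith
  have hadm : Adm (ball y (2 * r)) (ball y r) φ fun _ => ENNReal.ofReal (2 / r) := by
    refine ⟨hcont, fun z => le_max_left _ _, fun z => max_le zero_le_one (min_le_left _ _),
      fun z hz => ?_, ⟨closedBall y (3 / 2 * r), isCompact_closedBall _ _,
      closedBall_subset_ball (by linarith), hzero⟩, measurable_const, ?_⟩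
    · have : 2 / r * dist z y ≤ 2 / r * r := by
        gcongr; exact (mem_ball.1 hz).le
      have h2 : 2 / r * r = 2 := by field_simp
      rw [hφ]
      simp only
      rw [min_eq_left (by linarith), max_eq_right zero_le_one]
    · intro γ hγ a b hab
      rw [lintegral_const_mul' _ _ ENNReal.ofReal_ne_top]
      refine (ENNReal.ofReal_le_ofReal (hlip _ _)).trans ?_
      rw [ENNReal.ofReal_mul (by positivity)]
      gcongr
      rw [dist_eq_norm, ofReal_norm]
      exact enorm_sub_le_lintegral_deriv hγ hab
  refine ⟨φ, _, hadm.cut, ?_⟩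
  calc ∫⁻ z, ({z | φ z ≠ 0 ∧ φ z ≠ 1}.indicator (fun _ => ENNReal.ofReal (2 / r)) z) ^ 2
      ≤ ∫⁻ z, (ball y (2 * r)).indicator (fun _ => ENNReal.ofReal (2 / r) ^ 2) z := by
        refine lintegral_mono fun z => ?_
        by_cases hz : z ∈ ball y (2 * r)
        · rw [indicator_of_mem hz]
          gcongr
          exact indicator_le_self _ _ _
        · rw [indicator_of_notMem, zero_pow two_ne_zero]
          · exact zero_le
          · exact fun h => h.1 (hadm.eq_zero hz)
    _ = ENNReal.ofReal (16 * Real.pi) := by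
        rw [lintegral_indicator measurableSet_ball, setLIntegral_const, Complex.volume_ball,
          ← ENNReal.ofReal_pow (by positivity), ← ENNReal.ofReal_pow (by positivity),
          ← ENNReal.ofReal_coe_nnreal, ← ENNReal.ofReal_mul (by positivity),
          ← ENNReal.ofReal_mul (by positivity), NNReal.coe_real_pi]
        congr 1
        field_simp
        ring
    _ ≤ _ := le_rfl

/-- Every point has at most `M` preimages under `F` in `O`. -/
def MultLE (F : Polynomial ℂ) (O : Set ℂ) (M : ℝ) : Prop :=
  ∀ w, ∀ S : Finset ℂ, (∀ z ∈ S, z ∈ O ∧ F.eval z = w) → (S.card : ℝ) ≤ M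

lemma MultLE.mono {F : Polynomial ℂ} {O O' : Set ℂ} {M M' : ℝ} (h : MultLE F O M) (hO : O' ⊆ O)
    (hM : M ≤ M') : MultLE F O' M' :=
  fun w S hS => (h w S fun z hz => ⟨hO (hS z hz).1, (hS z hz).2⟩).trans hM

lemma exists_isOpen_injOn (F : Polynomial ℂ) {z : ℂ} (hz : F.derivative.eval z ≠ 0) :
    ∃ u, IsOpen u ∧ z ∈ u ∧ InjOn (fun w => F.eval w) u := by
  have h := (F.hasStrictDerivAt z).hasStrictFDerivAt_equiv hz
  exact ⟨_, (h.toOpenPartialHomeomorph _).open_source, h.mem_toOpenPartialHomeomorph_source,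
    (h.toOpenPartialHomeomorph _).injOn⟩

lemma abs_det_mul (a : ℂ) :
    |((ContinuousLinearMap.toSpanSingleton ℂ a).restrictScalars ℝ).det| = ‖a‖ ^ 2 := by
  have h : (((ContinuousLinearMap.toSpanSingleton ℂ a).restrictScalars ℝ : ℂ →L[ℝ] ℂ) :
      ℂ →ₗ[ℝ] ℂ) = Algebra.lmul ℝ ℂ a := by
    ext; simp [mul_comm]
  rw [ContinuousLinearMap.det, h, ← Algebra.norm_apply, Algebra.norm_complex_apply,
    Complex.normSq_eq_norm_sq, abs_of_nonneg (by positivity)]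

lemma setLIntegral_comp_mul_le (F : Polynomial ℂ) {O : Set ℂ} (hO : IsOpen O) {M : ℝ}
    (hM : MultLE F O M) {h : ℂ → ℝ≥0∞} (hh : Measurable h) :
    ∫⁻ z in O, h (F.eval z) * ‖F.derivative.eval z‖ₑ ^ 2 ≤ ENNReal.ofReal M * ∫⁻ w, h w := by
  set O1 : Set ℂ := {z ∈ O | F.derivative.eval z ≠ 0} with hO1
  have hO1o : IsOpen O1 := hO.inter (isOpen_ne_fun F.derivative.continuous continuous_const)
  have hex : ∀ z : ℂ, ∃ u, IsOpen u ∧ (z ∈ O1 → z ∈ u) ∧ InjOn (fun w => F.eval w) u := by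
    intro z
    by_cases hz : z ∈ O1
    · obtain ⟨u, h1, h2, h3⟩ := exists_isOpen_injOn F hz.2
      exact ⟨u, h1, fun _ => h2, h3⟩
    · exact ⟨∅, isOpen_empty, fun h => absurd h hz, by simp⟩
  choose v hvo hvm hvi using hex
  obtain ⟨t, -, htc, hcov⟩ := TopologicalSpace.countable_cover_nhdsWithin (s := O1) (f := v)
    fun z hz => mem_nhdsWithin_of_mem_nhds ((hvo z).mem_nhds (hvm z hz))
  obtain ⟨u, huo, hui, huc⟩ : ∃ u : ℕ → Set ℂ, (∀ n, IsOpen (u n)) ∧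
      (∀ n, InjOn (fun w => F.eval w) (u n)) ∧ O1 ⊆ ⋃ n, u n := by
    rcases t.eq_empty_or_nonempty with rfl | hne
    · exact ⟨fun _ => ∅, fun _ => isOpen_empty, by simp, by simpa using hcov⟩
    · obtain ⟨e, rfl⟩ := htc.exists_eq_range hne
      exact ⟨fun n => v (e n), fun n => hvo _, fun n => hvi _, by simpa using hcov⟩
  set B : ℕ → Set ℂ := fun n => O1 ∩ disjointed u n with hB
  have hBm : ∀ n, MeasurableSet (B n) := fun n =>
    hO1o.measurableSet.inter (MeasurableSet.disjointed (fun i => (huo i).measurableSet) n)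
  have hBi : ∀ n, InjOn (fun w => F.eval w) (B n) := fun n =>
    (hui n).mono (inter_subset_right.trans (disjointed_subset u n))
  have hBd : Pairwise (Function.onFun Disjoint B) := fun i j hij =>
    (disjoint_disjointed u hij).mono inter_subset_right inter_subset_right
  have hBu : ⋃ n, B n = O1 := by
    rw [hB, ← inter_iUnion, iUnion_disjointed]
    exact inter_eq_left.2 huc
  have hder : ∀ n, ∀ z ∈ B n, HasFDerivWithinAt (fun w => F.eval w)
      ((ContinuousLinearMap.toSpanSingleton ℂ (F.derivative.eval z)).restrictScalars ℝ) (B n) z :=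
    fun n z _ => ((F.hasDerivAt z).hasFDerivAt.restrictScalars ℝ).hasFDerivWithinAt
  have him : ∀ n, MeasurableSet ((fun w => F.eval w) '' B n) := fun n =>
    measurable_image_of_fderivWithin (hBm n) (hder n) (hBi n)
  have hcount : ∀ w, ∑' n, ((fun w => F.eval w) '' B n).indicator h w ≤ ENNReal.ofReal M * h w := by
    classical
    intro w
    rw [ENNReal.tsum_eq_iSup_nat]
    refine iSup_le fun n => ?_
    set I := (Finset.range n).filter fun i => w ∈ (fun w => F.eval w) '' B i with hI
    have hsum : ∑ i ∈ Finset.range n, ((fun w => F.eval w) '' B i).indicator h w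
        = (I.card : ℝ≥0∞) * h w := by
      rw [← nsmul_eq_mul, ← Finset.sum_const, hI, Finset.sum_filter]
      exact Finset.sum_congr rfl fun i _ => by rw [indicator_apply]
    rw [hsum]
    gcongr
    have hp : ∀ i : ℕ, ∃ z, i ∈ I → z ∈ B i ∧ F.eval z = w := by
      intro i
      by_cases hi : i ∈ I
      · obtain ⟨z, h1, h2⟩ := (Finset.mem_filter.1 hi).2
        exact ⟨z, fun _ => ⟨h1, h2⟩⟩
      · exact ⟨0, fun h => absurd h hi⟩
    choose p hp using hp
    have hinj : Set.InjOn p I := by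
      intro i hi j hj hij
      by_contra hne
      exact Set.disjoint_left.1 (hBd hne) (hp i hi).1 (hij ▸ (hp j hj).1)
    have := hM w (I.image p) fun z hz => by
      obtain ⟨i, hi, rfl⟩ := Finset.mem_image.1 hz
      exact ⟨(hp i hi).1.1.1, (hp i hi).2⟩
    rw [Finset.card_image_of_injOn hinj] at this
    rw [← ENNReal.ofReal_natCast]
    exact ENNReal.ofReal_le_ofReal this
  calc ∫⁻ z in O, h (F.eval z) * ‖F.derivative.eval z‖ₑ ^ 2
      = ∫⁻ z in O1, h (F.eval z) * ‖F.derivative.eval z‖ₑ ^ 2 := by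
        rw [← lintegral_indicator hO.measurableSet, ← lintegral_indicator hO1o.measurableSet]
        congr 1
        ext z
        by_cases h1 : z ∈ O1
        · rw [indicator_of_mem h1, indicator_of_mem h1.1]
        · rw [indicator_of_notMem h1]
          by_cases h2 : z ∈ O
          · have : F.derivative.eval z = 0 := by
              by_contra h3; exact h1 ⟨h2, h3⟩
            rw [indicator_of_mem h2, this]; simp
          · rw [indicator_of_notMem h2]
    _ = ∑' n, ∫⁻ z in B n, h (F.eval z) * ‖F.derivative.eval z‖ₑ ^ 2 := by
        rw [← hBu, lintegral_iUnion hBm hBd]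
    _ = ∑' n, ∫⁻ w in (fun w => F.eval w) '' B n, h w := by
        congr 1
        ext n
        rw [lintegral_image_eq_lintegral_abs_det_fderiv_mul volume (hBm n) (hder n) (hBi n)]
        refine lintegral_congr fun z => ?_
        rw [abs_det_mul, mul_comm, ENNReal.ofReal_pow (norm_nonneg _), ofReal_norm]
    _ = ∫⁻ w, ∑' n, ((fun w => F.eval w) '' B n).indicator h w := by
        rw [lintegral_tsum fun n => (hh.indicator (him n)).aemeasurable]
        congr 1
        ext n
        rw [lintegral_indicator (him n)]
    _ ≤ ∫⁻ w, ENNReal.ofReal M * h w := lintegral_mono hcount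
    _ = _ := lintegral_const_mul _ hh

lemma isCompact_preimage_eval {F : Polynomial ℂ} (hF : 0 < F.natDegree) {K : Set ℂ}
    (hK : IsCompact K) : IsCompact ((fun z => F.eval z) ⁻¹' K) := by
  have h : Tendsto (fun z : ℂ => F.eval z) (cocompact ℂ) (cocompact ℂ) := by
    rw [← Metric.cobounded_eq_cocompact, ← tendsto_norm_atTop_iff_cobounded]
    exact F.tendsto_norm_atTop (Polynomial.natDegree_pos_iff_degree_pos.1 hF)
      tendsto_norm_cobounded_atTop
  have h2 : ((fun z => F.eval z) ⁻¹' K)ᶜ ∈ cocompact ℂ := h hK.compl_mem_cocompact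
  obtain ⟨K', hK', hsub⟩ := mem_cocompact.1 h2
  exact hK'.of_isClosed_subset (hK.isClosed.preimage F.continuous) (compl_subset_compl.1 hsub)

/-- Pullback of test functions by a polynomial, on a relatively clopen part `O` of `F⁻¹ V`. -/
lemma HasCap.pullback {F : Polynomial ℂ} (hF : 0 < F.natDegree) {V A O : Set ℂ} {c M : ℝ}
    (hM0 : 0 ≤ M) (h : HasCap V A c) (hO : IsOpen O) (hO' : IsOpen {z | F.eval z ∈ V ∧ z ∉ O}) (hM : MultLE F O M) :
    HasCap O {z ∈ O | F.eval z ∈ A} (M * c) := by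
  obtain ⟨φ, g, a, e⟩ := h
  obtain ⟨K, hK, hKV, hφK⟩ := a.supp
  set φ' : ℂ → ℝ := O.indicator fun z => φ (F.eval z) with hφ'
  set g' : ℂ → ℝ≥0∞ := O.indicator fun z => g (F.eval z) * ‖F.derivative.eval z‖ₑ with hg'
  set K' : Set ℂ := {z | F.eval z ∈ K} \ {z | F.eval z ∈ V ∧ z ∉ O} with hK'
  have hK'c : IsCompact K' := (isCompact_preimage_eval hF hK).diff hO'
  have hK'O : K' ⊆ O := fun z hz => by
    by_contra h0; exact hz.2 ⟨hKV hz.1, h0⟩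
  have hzero : ∀ z ∉ K', φ' z = 0 := by
    intro z hz
    by_cases hzO : z ∈ O
    · rw [hφ', indicator_of_mem hzO]
      exact hφK _ fun h0 => hz ⟨h0, fun h1 => h1.2 hzO⟩
    · rw [hφ', indicator_of_notMem hzO]
  have hcont : Continuous φ' := by
    rw [continuous_iff_continuousAt]
    intro z
    by_cases hzO : z ∈ O
    · refine ((a.cont.comp F.continuous).continuousAt (x := z)).congr ?_
      filter_upwards [hO.mem_nhds hzO] with x hx
      rw [hφ', indicator_of_mem hx]; rfl
    · refine (continuousAt_const (y := (0 : ℝ))).congr ?_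
      filter_upwards [hK'c.isClosed.isOpen_compl.mem_nhds fun h0 => hzO (hK'O h0)] with x hx
      exact (hzero x hx).symm
  refine ⟨φ', g', ⟨hcont, fun z => indicator_nonneg (fun x _ => a.nonneg _) z, fun z => ?_,
    fun z hz => ?_, ⟨K', hK'c, hK'O, hzero⟩, ?_, ?_⟩, ?_⟩
  · exact indicator_apply_le' (fun _ => a.le_one _) fun _ => zero_le_one
  · rw [hφ', indicator_of_mem hz.1]; exact a.eq_one _ hz.2
  · exact ((a.meas.comp F.continuous.measurable).mul
      F.derivative.continuous.measurable.enorm).indicator hO.measurableSet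
  · intro γ hγ s t hst
    refine ofReal_abs_sub_le_of_gaps (h := fun x => φ' (γ x)) (T := γ ⁻¹' Oᶜ) (v := 0) hst
      (hcont.comp hγ.continuous) (hO.isClosed_compl.preimage hγ.continuous)
      (fun x hx => indicator_of_notMem hx _) fun s t _ hst _ hd => ?_
    have hin : ∀ x ∈ Icc s t, γ x ∈ O := fun x hx => by
      by_contra h0; exact Set.disjoint_left.1 hd hx h0
    have hd : ∀ x, HasDerivAt (fun x => F.eval (γ x)) (F.derivative.eval (γ x) * deriv γ x) x :=
      fun x => HasDerivAt.scomp_of_eq x ((F.hasDerivAt (γ x))) (hγ x).hasDerivAt rfl |>.congr_deriv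
        (by simp [mul_comm])
    have := a.grad (fun x => F.eval (γ x)) (fun x => (hd x).differentiableAt) s t hst
    rw [hφ', indicator_of_mem (hin t (right_mem_Icc.2 hst)),
      indicator_of_mem (hin s (left_mem_Icc.2 hst))]
    refine this.trans_eq (setLIntegral_congr_fun measurableSet_Ioc fun x hx => ?_)
    simp only [hg']
    rw [indicator_of_mem (hin x ⟨hx.1.le, hx.2⟩), (hd x).deriv, enorm_mul, mul_assoc]
  · calc ∫⁻ z, g' z ^ 2 = ∫⁻ z in O, g (F.eval z) ^ 2 * ‖F.derivative.eval z‖ₑ ^ 2 := by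
          rw [← lintegral_indicator hO.measurableSet]
          congr 1
          ext z
          by_cases hz : z ∈ O
          · rw [hg', indicator_of_mem hz, indicator_of_mem hz, mul_pow]
          · rw [hg', indicator_of_notMem hz, indicator_of_notMem hz, zero_pow two_ne_zero]
      _ ≤ ENNReal.ofReal M * ∫⁻ w, g w ^ 2 :=
          setLIntegral_comp_mul_le F hO hM (a.meas.pow_const 2)
      _ ≤ ENNReal.ofReal (M * c) := by
          rw [ENNReal.ofReal_mul hM0]; gcongr

/-- The integral of `g` over the circle of centre `y` and radius `s`. -/
noncomputable def circleLen (g : ℂ → ℝ≥0∞) (y : ℂ) (s : ℝ) : ℝ≥0∞ :=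
  ∫⁻ θ in Ioc (-Real.pi) Real.pi, g (circleMap y s θ) * ENNReal.ofReal s

lemma measurable_circleMap_prod (y : ℂ) : Measurable fun p : ℝ × ℝ => circleMap y p.1 p.2 := by
  unfold circleMap
  fun_prop

lemma measurable_circleLen {g : ℂ → ℝ≥0∞} (hg : Measurable g) (y : ℂ) :
    Measurable (circleLen g y) := by
  have : Measurable fun p : ℝ × ℝ => g (circleMap y p.1 p.2) * ENNReal.ofReal p.1 :=
    (hg.comp (measurable_circleMap_prod y)).mul (ENNReal.measurable_ofReal.comp measurable_fst)
  exact this.lintegral_prod_right'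

lemma lintegral_eq_lintegral_circleLen {k : ℂ → ℝ≥0∞} (hk : Measurable k) (y : ℂ) :
    ∫⁻ z, k z = ∫⁻ s in Ioi (0 : ℝ), circleLen k y s := by
  have hm : Measurable fun p : ℝ × ℝ => ENNReal.ofReal p.1 * k (circleMap y p.1 p.2) :=
    (ENNReal.measurable_ofReal.comp measurable_fst).mul (hk.comp (measurable_circleMap_prod y))
  rw [← lintegral_add_left_eq_self k y, ← Complex.lintegral_comp_polarCoord_symm,
    polarCoord_target, Measure.volume_eq_prod]
  have h1 : ∀ p : ℝ × ℝ, ENNReal.ofReal p.1 • k (y + Complex.polarCoord.symm p)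
      = ENNReal.ofReal p.1 * k (circleMap y p.1 p.2) := by
    intro p
    rw [smul_eq_mul, Complex.polarCoord_symm_apply, circleMap, Complex.exp_mul_I,
      Complex.ofReal_cos, Complex.ofReal_sin]
  simp_rw [h1]
  rw [setLIntegral_prod _ hm.aemeasurable]
  refine lintegral_congr fun s => ?_
  rw [circleLen, restrict_Ioo_eq_restrict_Ioc]
  exact lintegral_congr fun θ => mul_comm _ _

lemma dist_circleMap {y : ℂ} {s : ℝ} (hs : 0 ≤ s) (θ : ℝ) : dist (circleMap y s θ) y = s := by
  rw [dist_eq_norm, circleMap_sub_center, norm_circleMap_zero, abs_of_nonneg hs]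

lemma lintegral_circleLen_le {g : ℂ → ℝ≥0∞} (hg : Measurable g) (y : ℂ) {r1 r2 : ℝ}
    (h1 : 0 ≤ r1) : ∫⁻ s in Ioo r1 r2, circleLen g y s ≤ ∫⁻ z in ball y r2, g z := by
  rw [← lintegral_indicator measurableSet_ball,
    lintegral_eq_lintegral_circleLen (hg.indicator measurableSet_ball) y]
  refine le_trans ?_ (lintegral_mono_set (s := Ioo r1 r2) fun s hs => h1.trans_lt hs.1)
  refine (setLIntegral_congr_fun measurableSet_Ioo fun s hs => ?_).le
  refine lintegral_congr fun θ => ?_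
  rw [indicator_of_mem]
  rw [mem_ball, dist_circleMap (h1.trans hs.1.le)]
  exact hs.2

lemma lintegral_annulus_circleLen_le {g : ℂ → ℝ≥0∞} (hg : Measurable g) (y : ℂ) {r1 r2 : ℝ}
    (h1 : 0 ≤ r1) : ∫⁻ z in {z | dist z y ∈ Ioo r1 r2}, circleLen g y (dist z y) ≤
      ENNReal.ofReal (2 * Real.pi * r2) * ∫⁻ z in ball y r2, g z := by
  have hS : MeasurableSet {z | dist z y ∈ Ioo r1 r2} :=
    (isOpen_Ioo.preimage (continuous_id.dist continuous_const)).measurableSet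
  have hm : Measurable fun z => circleLen g y (dist z y) :=
    (measurable_circleLen hg y).comp (measurable_id.dist measurable_const)
  rw [← lintegral_indicator hS, lintegral_eq_lintegral_circleLen (hm.indicator hS) y]
  calc _ ≤ ∫⁻ s in Ioi (0 : ℝ), (Ioo r1 r2).indicator
        (fun s => ENNReal.ofReal (2 * Real.pi * r2) * circleLen g y s) s := by
        refine setLIntegral_mono' measurableSet_Ioi fun s hs => ?_
        have hs0 : (0 : ℝ) ≤ s := (mem_Ioi.1 hs).le
        by_cases h : s ∈ Ioo r1 r2
        · rw [indicator_of_mem h]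
          calc circleLen _ y s = ∫⁻ θ in Ioc (-Real.pi) Real.pi,
                circleLen g y s * ENNReal.ofReal s := by
                refine lintegral_congr fun θ => ?_
                rw [indicator_of_mem, dist_circleMap hs0]
                simpa [dist_circleMap hs0] using h
            _ = circleLen g y s * ENNReal.ofReal s * ENNReal.ofReal (2 * Real.pi) := by
                rw [setLIntegral_const, Real.volume_Ioc]; ring_nf
            _ ≤ _ := by
                rw [mul_comm (2 * Real.pi), ENNReal.ofReal_mul (hs0.trans h.2.le), mul_assoc,
                  mul_comm]
                gcongr
                exact h.2.le
        · rw [indicator_of_notMem h]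
          refine (lintegral_eq_zero_iff' ?_).2 ?_ |>.le
          · refine AEMeasurable.mul_const ?_ _
            exact ((hm.indicator hS).comp
              (continuous_circleMap y s).measurable).aemeasurable
          · refine Eventually.of_forall fun θ => ?_
            simp only [Pi.zero_apply]
            rw [indicator_of_notMem, zero_mul]
            simpa [dist_circleMap hs0] using h
    _ ≤ ∫⁻ s in Ioo r1 r2, ENNReal.ofReal (2 * Real.pi * r2) * circleLen g y s := by
        rw [← lintegral_indicator measurableSet_Ioo]
        exact setLIntegral_le_lintegral _ _
    _ ≤ _ := by
        rw [lintegral_const_mul _ (measurable_circleLen hg y)]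
        gcongr
        exact lintegral_circleLen_le hg y h1

lemma IsUpperGradient.le_arc {φ g} (h : IsUpperGradient φ g) (y : ℂ) {s : ℝ} (hs : 0 ≤ s)
    {a b : ℝ} (hab : a ≤ b) : ENNReal.ofReal |φ (circleMap y s b) - φ (circleMap y s a)| ≤
      ∫⁻ θ in Ioc a b, g (circleMap y s θ) * ENNReal.ofReal s := by
  refine (h _ (differentiable_circleMap y s) a b hab).trans_eq (lintegral_congr fun θ => ?_)
  congr 1
  rw [← ofReal_norm, deriv_circleMap, norm_mul, norm_circleMap_zero, Complex.norm_I, mul_one,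
    abs_of_nonneg hs]

lemma exists_circleMap_eq (y z : ℂ) :
    ∃ θ ∈ Ioc (-Real.pi) Real.pi, circleMap y (dist z y) θ = z := by
  refine ⟨Complex.arg (z - y), Complex.arg_mem_Ioc _, ?_⟩
  rw [circleMap, dist_eq_norm, Complex.norm_mul_exp_arg_mul_I]
  ring

lemma IsUpperGradient.le_circleLen {φ g} (h : IsUpperGradient φ g) (y : ℂ) {z w : ℂ}
    (hzw : dist z y = dist w y) :
    ENNReal.ofReal |φ z - φ w| ≤ circleLen g y (dist z y) := by
  obtain ⟨a, ha, haz⟩ := exists_circleMap_eq y z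
  obtain ⟨b, hb, hbw⟩ := exists_circleMap_eq y w
  rw [← hzw] at hbw
  rcases le_total a b with hab | hab
  · have := h.le_arc y (s := dist z y) dist_nonneg hab
    rw [haz, hbw, abs_sub_comm] at this
    exact this.trans (lintegral_mono_set (Ioc_subset_Ioc ha.1.le hb.2))
  · have := h.le_arc y (s := dist z y) dist_nonneg hab
    rw [haz, hbw] at this
    exact this.trans (lintegral_mono_set (Ioc_subset_Ioc hb.1.le ha.2))

lemma card_le_one_add_lintegral {h : ℝ → ℝ} {w : ℝ → ℝ≥0∞} {a : ℝ}
    (H : ∀ s t, s ≤ t → ENNReal.ofReal |h t - h s| ≤ ∫⁻ x in Ioc s t, w x) (I : Finset ℝ) :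
    (∀ t ∈ I, a ≤ t ∧ h t = 1) → (∀ s ∈ I, ∀ t ∈ I, s < t → ∃ x ∈ Icc s t, h x = 0) →
    ∀ b, (∀ t ∈ I, t ≤ b) → (I.card : ℝ≥0∞) ≤ 1 + ∫⁻ x in Ioc a b, w x := by
  induction I using Finset.induction_on_max with
  | empty => intro _ _ b _; simp
  | insert m J hJ ih =>
    intro h1 h2 b hb
    have hmJ : m ∉ J := fun h => (hJ m h).false
    rw [Finset.card_insert_of_notMem hmJ]
    rcases J.eq_empty_or_nonempty with rfl | hne
    · simp
    have hlast := Finset.max'_mem J hne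
    set l := J.max' hne
    obtain ⟨x, hx, hx0⟩ := h2 l (Finset.mem_insert_of_mem hlast) m (Finset.mem_insert_self _ _)
      (hJ l hlast)
    have hJc := ih (fun t ht => h1 t (Finset.mem_insert_of_mem ht))
      (fun s hs t ht => h2 s (Finset.mem_insert_of_mem hs) t (Finset.mem_insert_of_mem ht)) l
      (fun t ht => Finset.le_max' J t ht)
    have hm := H x m hx.2
    rw [(h1 m (Finset.mem_insert_self _ _)).2, hx0] at hm
    simp only [sub_zero, abs_one, ENNReal.ofReal_one] at hm
    push_cast
    calc (J.card : ℝ≥0∞) + 1 ≤ (1 + ∫⁻ x in Ioc a l, w x) + ∫⁻ x in Ioc x m, w x :=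
          add_le_add hJc hm
      _ = 1 + ∫⁻ x in Ioc a l ∪ Ioc x m, w x := by
          rw [add_assoc, lintegral_union measurableSet_Ioc]
          refine Set.disjoint_left.2 fun t ht ht' => ?_
          linarith [ht.2, ht'.1, hx.1]
      _ ≤ _ := by
          gcongr
          refine union_subset (Ioc_subset_Ioc_right (hb l (Finset.mem_insert_of_mem hlast)))
            (Ioc_subset_Ioc ?_ (hb m (Finset.mem_insert_self _ _)))
          exact (h1 l (Finset.mem_insert_of_mem hlast)).1.trans hx.1

/-- If `φ = 1` at the points of `P` on a circle and every arc joining two of them meets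
`φ = 0`, then the number of points is controlled by the integral of the upper gradient. -/
lemma IsUpperGradient.card_le {φ g} (h : IsUpperGradient φ g) (y : ℂ) {s : ℝ} (hs : 0 ≤ s)
    (P : Finset ℂ) (hP : ∀ z ∈ P, dist z y = s ∧ φ z = 1)
    (harc : ∀ z ∈ P, ∀ w ∈ P, z ≠ w → ∀ A : Set ℂ, IsPreconnected A → A ⊆ sphere y s →
      z ∈ A → w ∈ A → ∃ x ∈ A, φ x = 0) :
    (P.card : ℝ≥0∞) ≤ 1 + circleLen g y s := by
  classical
  have harg : ∀ z ∈ P, circleMap y s (Complex.arg (z - y)) = z := by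
    intro z hz
    rw [circleMap, ← (hP z hz).1, dist_eq_norm, Complex.norm_mul_exp_arg_mul_I]
    ring
  have hinj : Set.InjOn (fun z => Complex.arg (z - y)) P := by
    intro z hz w hw hzw
    rw [← harg z hz, ← harg w hw]
    simp only at hzw
    rw [hzw]
  rw [← Finset.card_image_of_injOn hinj]
  refine card_le_one_add_lintegral (h := fun θ => φ (circleMap y s θ))
    (fun a b hab => h.le_arc y hs hab) _ ?_ ?_ Real.pi ?_
  · intro t ht
    obtain ⟨z, hz, rfl⟩ := Finset.mem_image.1 ht
    exact ⟨(Complex.neg_pi_lt_arg _).le, by rw [harg z hz, (hP z hz).2]⟩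
  · intro a ha b hb hab
    obtain ⟨z, hz, rfl⟩ := Finset.mem_image.1 ha
    obtain ⟨w, hw, rfl⟩ := Finset.mem_image.1 hb
    have hne : z ≠ w := by rintro rfl; exact hab.false
    obtain ⟨x, ⟨t, ht, rfl⟩, hx⟩ := harc z hz w hw hne
      (circleMap y s '' Icc (Complex.arg (z - y)) (Complex.arg (w - y)))
      (isPreconnected_Icc.image _ (continuous_circleMap y s).continuousOn)
      (by rintro _ ⟨t, _, rfl⟩; exact circleMap_mem_sphere y hs t)
      ⟨_, left_mem_Icc.2 hab.le, harg z hz⟩ ⟨_, right_mem_Icc.2 hab.le, harg w hw⟩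
    exact ⟨t, ht, hx⟩
  · intro t ht
    obtain ⟨z, hz, rfl⟩ := Finset.mem_image.1 ht
    exact Complex.arg_le_pi _

lemma sq_setLIntegral_le {g : ℂ → ℝ≥0∞} (hg : Measurable g) (S : Set ℂ) :
    (∫⁻ z in S, g z) ^ 2 ≤ volume S * ∫⁻ z in S, g z ^ 2 := by
  have h := ENNReal.lintegral_mul_le_Lp_mul_Lq (volume.restrict S) Real.HolderConjugate.two_two
    (f := fun _ => 1) (g := g) aemeasurable_const hg.aemeasurable
  simp only [Pi.mul_apply, one_mul, ENNReal.one_rpow, lintegral_const, Measure.restrict_apply,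
    MeasurableSet.univ, univ_inter] at h
  calc (∫⁻ z in S, g z) ^ 2 ≤ (volume S ^ (1 / 2 : ℝ) *
        (∫⁻ z in S, g z ^ (2 : ℝ)) ^ (1 / 2 : ℝ)) ^ 2 := by gcongr
    _ = _ := by
      rw [mul_pow, ← ENNReal.rpow_natCast, ← ENNReal.rpow_natCast, ← ENNReal.rpow_mul,
        ← ENNReal.rpow_mul]
      norm_num

/-- A connected bounded set of arbitrarily small capacity is a point. -/
lemma subsingleton_of_hasCap {K : Set ℂ} {R : ℝ} (hK : IsPreconnected K)
    (h : ∀ ε > 0, HasCap (ball 0 R) K ε) : K.Subsingleton := by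
  intro p hp q hq
  by_contra hpq
  have hKR : ∀ z ∈ K, ‖z‖ < R := by
    intro z hz
    obtain ⟨φ, g, a, -⟩ := h 1 one_pos
    by_contra h0
    have := a.eq_zero (z := z) (by simpa using h0)
    rw [a.eq_one z hz] at this
    exact one_ne_zero this
  have hR : 0 < R := (norm_nonneg p).trans_lt (hKR p hp)
  have hδ : 0 < ‖q - p‖ := norm_pos_iff.2 (sub_ne_zero.2 (Ne.symm hpq))
  set t : ℝ := (‖q‖ ^ 2 + 1) / ‖q - p‖ ^ 2 + R / ‖q - p‖ with ht
  have ht0 : 0 < t := by positivity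
  set c : ℂ := t * (q - p) with hc
  have hcn : R ≤ ‖c‖ := by
    rw [hc, norm_mul, Complex.norm_real, Real.norm_of_nonneg ht0.le, ht, add_mul,
      div_mul_cancel₀ _ hδ.ne']
    have : 0 ≤ (‖q‖ ^ 2 + 1) / ‖q - p‖ ^ 2 * ‖q - p‖ := by positivity
    linarith
  have hlt : dist q c < dist p c := by
    rw [dist_eq_norm, dist_eq_norm]
    refine lt_of_pow_lt_pow_left₀ 2 (norm_nonneg _) ?_
    have h1 : t * ‖q - p‖ ^ 2 ≥ ‖q‖ ^ 2 + 1 := by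
      rw [ht, add_mul, div_mul_cancel₀ _ (by positivity)]
      have : 0 ≤ R / ‖q - p‖ * ‖q - p‖ ^ 2 := by positivity
      linarith
    have h2 : 0 ≤ ‖p‖ ^ 2 := by positivity
    clear_value t
    simp only [← Complex.normSq_eq_norm_sq] at *
    simp only [Complex.normSq_apply, hc, Complex.sub_re, Complex.sub_im, Complex.mul_re,
      Complex.mul_im, Complex.ofReal_re, Complex.ofReal_im] at *
    nlinarith [mul_self_nonneg q.re, mul_self_nonneg q.im]
  set a := dist q c
  set b := dist p c
  have key : ∀ ε > 0, ENNReal.ofReal ((b - a) ^ 2) ≤ ENNReal.ofReal (b ^ 2 * Real.pi * ε) := by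
    intro ε hε
    obtain ⟨φ, g, ad, e⟩ := h ε hε
    have h1 : ∀ s ∈ Ioo a b, 1 ≤ circleLen g c s := by
      intro s hs
      have hs0 : 0 ≤ s := dist_nonneg.trans hs.1.le
      obtain ⟨z, hz, hzs⟩ := hK.intermediate_value hq hp
        (f := fun z => dist z c) (by fun_prop) ⟨hs.1.le, hs.2.le⟩
      simp only at hzs
      set w : ℂ := c + (s / ‖c‖ : ℝ) * c with hw
      have hc0 : 0 < ‖c‖ := hR.trans_le hcn
      have hws : dist w c = s := by
        rw [hw, dist_eq_norm, add_sub_cancel_left, norm_mul, Complex.norm_real,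
          Real.norm_of_nonneg (by positivity), div_mul_cancel₀ _ hc0.ne']
      have hwR : w ∉ ball (0 : ℂ) R := by
        have : w = ((1 + s / ‖c‖ : ℝ) : ℂ) * c := by rw [hw]; push_cast; ring
        rw [mem_ball_zero_iff, not_lt, this, norm_mul, Complex.norm_real,
          Real.norm_of_nonneg (by positivity), add_mul, div_mul_cancel₀ _ hc0.ne']
        linarith
      have := ad.grad.le_circleLen c (z := z) (w := w) (by rw [hws]; exact hzs)
      rw [ad.eq_one z hz, ad.eq_zero hwR, hzs] at this
      simpa using this
    have h2 : ENNReal.ofReal (b - a) ≤ ∫⁻ z in ball c b, g z := by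
      calc ENNReal.ofReal (b - a) = ∫⁻ _ in Ioo a b, 1 := by
            rw [setLIntegral_const, Real.volume_Ioo, one_mul]
        _ ≤ ∫⁻ s in Ioo a b, circleLen g c s := setLIntegral_mono' measurableSet_Ioo h1
        _ ≤ _ := lintegral_circleLen_le ad.meas c dist_nonneg
    calc ENNReal.ofReal ((b - a) ^ 2) = ENNReal.ofReal (b - a) ^ 2 :=
          ENNReal.ofReal_pow (by linarith) 2
      _ ≤ (∫⁻ z in ball c b, g z) ^ 2 := by gcongr
      _ ≤ volume (ball c b) * ∫⁻ z in ball c b, g z ^ 2 := sq_setLIntegral_le ad.meas _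
      _ ≤ ENNReal.ofReal (b ^ 2 * Real.pi) * ENNReal.ofReal ε := by
          gcongr
          · rw [Complex.volume_ball, ENNReal.ofReal_mul (by positivity),
              ENNReal.ofReal_pow dist_nonneg, ← NNReal.coe_real_pi, ENNReal.ofReal_coe_nnreal]
          · exact (setLIntegral_le_lintegral _ _).trans e
      _ = _ := (ENNReal.ofReal_mul (by positivity)).symm
  have hb : 0 < b := dist_nonneg.trans_lt hlt
  have := key ((b - a) ^ 2 / (2 * (b ^ 2 * Real.pi)))
    (div_pos (by nlinarith) (by positivity))
  rw [ENNReal.ofReal_le_ofReal_iff (by positivity)] at this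
  have h3 : b ^ 2 * Real.pi * ((b - a) ^ 2 / (2 * (b ^ 2 * Real.pi))) = (b - a) ^ 2 / 2 := by
    field_simp
  rw [h3] at this
  nlinarith

lemma isOpen_diff_connectedComponentIn {S : Set ℂ} (hS : IsOpen S) (z : ℂ) :
    IsOpen {w | w ∈ S ∧ w ∉ connectedComponentIn S z} := by
  rw [isOpen_iff_mem_nhds]
  rintro w ⟨hw, hwz⟩
  filter_upwards [hS.connectedComponentIn.mem_nhds (mem_connectedComponentIn hw)] with x hx
  refine ⟨connectedComponentIn_subset _ _ hx, fun hxz => hwz ?_⟩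
  rw [connectedComponentIn_eq hxz, ← connectedComponentIn_eq hx]
  exact mem_connectedComponentIn hw

lemma tendsto_eval_cocompact {F : Polynomial ℂ} (hF : 0 < F.natDegree) :
    Tendsto (fun z : ℂ => F.eval z) (cocompact ℂ) (cocompact ℂ) := by
  rw [← Metric.cobounded_eq_cocompact, ← tendsto_norm_atTop_iff_cobounded]
  exact F.tendsto_norm_atTop (Polynomial.natDegree_pos_iff_degree_pos.1 hF)
    tendsto_norm_cobounded_atTop

lemma isClosedMap_eval {F : Polynomial ℂ} (hF : 0 < F.natDegree) :
    IsClosedMap fun z : ℂ => F.eval z :=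
  (isProperMap_iff_tendsto_cocompact.2 ⟨F.continuous, tendsto_eval_cocompact hF⟩).isClosedMap

lemma isOpenMap_eval {F : Polynomial ℂ} (hF : 0 < F.natDegree) :
    IsOpenMap fun z : ℂ => F.eval z := by
  have hA : AnalyticOnNhd ℂ (fun z : ℂ => F.eval z) univ := fun z _ =>
    (F.differentiable.analyticAt z)
  rcases hA.is_constant_or_isOpen isPreconnected_univ with ⟨w, hw⟩ | h
  · exfalso
    have h1 : F = Polynomial.C w := Polynomial.funext fun z => by simp [hw z (mem_univ z)]
    rw [h1, Polynomial.natDegree_C] at hF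
    exact hF.false
  · exact fun s hs => h s (subset_univ _) hs

/-- A component of the preimage of a connected open set is mapped onto that set. -/
lemma image_connectedComponentIn {F : Polynomial ℂ} (hF : 0 < F.natDegree) {V : Set ℂ}
    (hV : IsOpen V) (hVc : IsPreconnected V) {z : ℂ} (hz : F.eval z ∈ V) :
    (fun w => F.eval w) '' connectedComponentIn ((fun w => F.eval w) ⁻¹' V) z = V := by
  set S := (fun w => F.eval w) ⁻¹' V with hS
  set U := connectedComponentIn S z
  have hSo : IsOpen S := hV.preimage F.continuous
  have hzU : z ∈ U := mem_connectedComponentIn hz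
  have hsub : (fun w => F.eval w) '' U ⊆ V := by
    rintro _ ⟨w, hw, rfl⟩
    exact (connectedComponentIn_subset S z hw : w ∈ S)
  refine hsub.antisymm (hVc.subset_of_closure_inter_subset
    (isOpenMap_eval hF _ hSo.connectedComponentIn) ⟨_, hz, mem_image_of_mem _ hzU⟩ ?_)
  rintro v ⟨hv, hvV⟩
  have h1 : closure ((fun w => F.eval w) '' U) ⊆ (fun w => F.eval w) '' closure U :=
    (isClosedMap_eval hF).closure_image_subset U
  obtain ⟨w, hw, rfl⟩ := h1 hv
  refine ⟨w, ?_, rfl⟩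
  by_contra hwU
  obtain ⟨x, hx, hxU⟩ := mem_closure_iff.1 hw _ (isOpen_diff_connectedComponentIn hSo z) ⟨hvV, hwU⟩
  exact hx.2 hxU

/-- Every circle centred outside `V` leaves `V`. -/
def HoleFree (V : Set ℂ) : Prop := ∀ p ∉ V, ∀ s > 0, ∃ z, dist z p = s ∧ z ∉ V

lemma volume_ball_eq (a : ℂ) {r : ℝ} (hr : 0 ≤ r) :
    volume (ball a r) = ENNReal.ofReal (Real.pi * r ^ 2) := by
  rw [Complex.volume_ball, mul_comm, ENNReal.ofReal_mul Real.pi_pos.le,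
    ENNReal.ofReal_pow hr, ← NNReal.coe_real_pi, ENNReal.ofReal_coe_nnreal]

lemma exists_mem_dist_eq {B : Set ℂ} (hB : IsPreconnected B) {y : ℂ} (hy : y ∈ B) {r s : ℝ}
    (hBr : ¬ B ⊆ ball y r) (hs : 0 ≤ s) (hsr : s ≤ r) : ∃ z ∈ B, dist z y = s := by
  obtain ⟨q, hq, hqr⟩ := not_subset.1 hBr
  obtain ⟨z, hz, hzs⟩ := hB.intermediate_value hy hq
    (f := fun z => dist z y) (by fun_prop) (show s ∈ Icc _ _ from
      ⟨by simpa using hs, hsr.trans (not_lt.1 hqr)⟩)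
  exact ⟨z, hz, hzs⟩

lemma Adm.le_lintegral_ball {V B : Set ℂ} {φ g} (ad : Adm V B φ g) (hV : HoleFree V)
    (hB : IsPreconnected B) {y p : ℂ} {δ : ℝ} (hy : y ∈ B) (hp : p ∉ V) (hδ : 0 < δ)
    (hyp : dist y p = δ) (hBy : ¬ B ⊆ ball y (δ / 10)) :
    ENNReal.ofReal (δ / 320) ≤ ∫⁻ z in ball y (3 * δ), g z := by
  set S : Set ℂ := {z | dist z y ∈ Ioo (δ / 20) (δ / 10)} with hS
  set I := ∫⁻ z in ball y (3 * δ), g z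
  have hdist : Measurable fun z : ℂ => dist z y := measurable_id.dist measurable_const
  have hSm : MeasurableSet S := hdist measurableSet_Ioo
  have h1 : ∀ z ∈ S, 1 ≤ circleLen g y (dist z y) + circleLen g p (dist z p) := by
    intro z hz
    obtain ⟨a, ha, haz⟩ := exists_mem_dist_eq hB hy hBy (s := dist z y) dist_nonneg hz.2.le
    have hzp : 0 < dist z p := by
      have := dist_triangle y z p
      rw [dist_comm y z] at this
      linarith [hz.2]
    obtain ⟨b, hb, hbV⟩ := hV p hp _ hzp
    have e1 := ad.grad.le_circleLen y haz.symm
    have e2 := ad.grad.le_circleLen p hb.symm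
    rw [ad.eq_one a ha] at e1
    rw [ad.eq_zero hbV] at e2
    calc (1 : ℝ≥0∞) = ENNReal.ofReal (|φ z - 1| + |φ z - 0|) := by
          rw [abs_of_nonpos (by linarith [ad.le_one z]), abs_of_nonneg (by linarith [ad.nonneg z])]
          simp
      _ ≤ _ := by
          rw [ENNReal.ofReal_add (abs_nonneg _) (abs_nonneg _)]
          exact add_le_add e1 e2
  have h2 : ENNReal.ofReal (3 * Real.pi * δ ^ 2 / 400) ≤ volume S := by
    have : ball y (δ / 10) ⊆ S ∪ closedBall y (δ / 20) := by
      intro z hz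
      rcases le_or_gt (dist z y) (δ / 20) with h | h
      · exact Or.inr h
      · exact Or.inl ⟨h, hz⟩
    have h3 : volume (ball y (δ / 10)) ≤ volume S + volume (ball y (δ / 20)) := by
      refine (measure_mono this).trans ((measure_union_le _ _).trans_eq ?_)
      rw [Complex.volume_closedBall, Complex.volume_ball]
    rw [volume_ball_eq y (by positivity), volume_ball_eq y (by positivity)] at h3
    refine (ENNReal.ofReal_le_ofReal ?_).trans
      ((ENNReal.ofReal_sub _ (by positivity)).trans_le (tsub_le_iff_right.2 h3))
    apply le_of_eq
    ring
  have h4 : (∫⁻ z in S, circleLen g y (dist z y)) ≤ ENNReal.ofReal (Real.pi * δ / 5) * I := by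
    refine (lintegral_annulus_circleLen_le ad.meas y (by positivity)).trans ?_
    refine mul_le_mul' (ENNReal.ofReal_le_ofReal (by linarith))
      (lintegral_mono_set (ball_subset_ball (by linarith)))
  have h5 : (∫⁻ z in S, circleLen g p (dist z p)) ≤
      ENNReal.ofReal (2 * Real.pi * (δ * 11 / 10)) * I := by
    refine (lintegral_mono_set ?_).trans
      ((lintegral_annulus_circleLen_le ad.meas p (r1 := 0) (r2 := δ * 11 / 10) le_rfl).trans ?_)
    · intro z hz
      have e1 := dist_triangle y z p
      have e2 := dist_triangle z y p
      rw [dist_comm y z] at e1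
      have := hz.2
      exact ⟨by linarith, by linarith⟩
    · refine mul_le_mul' le_rfl (lintegral_mono_set ?_)
      refine ball_subset_ball' ?_
      rw [dist_comm p y, hyp]
      linarith
  have h6 : ENNReal.ofReal (3 * Real.pi * δ ^ 2 / 400) ≤
      ENNReal.ofReal (12 / 5 * Real.pi * δ) * I := by
    calc _ ≤ volume S := h2
      _ = ∫⁻ _ in S, 1 := by simp
      _ ≤ ∫⁻ z in S, (circleLen g y (dist z y) + circleLen g p (dist z p)) :=
        setLIntegral_mono' hSm h1
      _ = (∫⁻ z in S, circleLen g y (dist z y)) + ∫⁻ z in S, circleLen g p (dist z p) :=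
        lintegral_add_left ((measurable_circleLen ad.meas y).comp hdist) _
      _ ≤ _ := by
        refine (add_le_add h4 h5).trans_eq ?_
        rw [← add_mul, ← ENNReal.ofReal_add (by positivity) (by positivity)]
        congr 2
        ring
  have h7 : (3 * Real.pi * δ ^ 2 / 400) = (12 / 5 * Real.pi * δ) * (δ / 320) := by ring
  rw [h7, ENNReal.ofReal_mul (by positivity)] at h6
  exact (ENNReal.mul_le_mul_iff_right (by simp; positivity) ENNReal.ofReal_ne_top).1 h6

lemma lintegral_inv_cube_le (x : ℂ) {t : ℝ} (ht : 0 < t) :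
    ∫⁻ z, ENNReal.ofReal (((t + dist z x) ^ 3)⁻¹) ≤ ENNReal.ofReal (2 * Real.pi / t) := by
  have hm : Measurable fun z : ℂ => ENNReal.ofReal (((t + dist z x) ^ 3)⁻¹) := by fun_prop
  rw [lintegral_eq_lintegral_circleLen hm x]
  have hd : ∀ s ∈ Ici (0 : ℝ), HasDerivAt (fun s => -(2 * Real.pi) * (t + s)⁻¹)
      (2 * Real.pi * ((t + s) ^ 2)⁻¹) s := by
    intro s hs
    have h0 : t + s ≠ 0 := by have := mem_Ici.1 hs; positivity
    have := (((hasDerivAt_id s).const_add t).inv h0).const_mul (-(2 * Real.pi))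
    refine this.congr_deriv ?_
    simp [div_eq_mul_inv]
  have hlim : Tendsto (fun s => -(2 * Real.pi) * (t + s)⁻¹) atTop (𝓝 0) := by
    have : Tendsto (fun s : ℝ => (t + s)⁻¹) atTop (𝓝 0) :=
      tendsto_inv_atTop_zero.comp (tendsto_atTop_add_const_left _ _ tendsto_id)
    simpa using this.const_mul (-(2 * Real.pi))
  have hpos : ∀ s ∈ Ioi (0 : ℝ), 0 ≤ 2 * Real.pi * ((t + s) ^ 2)⁻¹ := fun s hs => by positivity
  have hinteg := integrableOn_Ioi_deriv_of_nonneg' hd hpos hlim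
  have hval := integral_Ioi_of_hasDerivAt_of_nonneg' hd hpos hlim
  calc _ ≤ ∫⁻ s in Ioi (0 : ℝ), ENNReal.ofReal (2 * Real.pi * ((t + s) ^ 2)⁻¹) := by
        refine setLIntegral_mono' measurableSet_Ioi fun s hs => ?_
        have hs0 : 0 < s := hs
        simp only [circleLen, dist_circleMap hs0.le]
        rw [setLIntegral_const, Real.volume_Ioc, ← ENNReal.ofReal_mul (by positivity),
          ← ENNReal.ofReal_mul (by positivity)]
        apply ENNReal.ofReal_le_ofReal
        have h3 : ((t + s) ^ 3)⁻¹ * s ≤ ((t + s) ^ 2)⁻¹ := by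
          rw [inv_mul_le_iff₀ (by positivity), pow_succ (t + s) 2, mul_comm (_ ^ 2) (t + s), mul_assoc,
            mul_inv_cancel₀ (by positivity)]
          linarith
        have := Real.pi_pos
        nlinarith
    _ = ENNReal.ofReal (2 * Real.pi / t) := by
        rw [← ofReal_integral_eq_lintegral_ofReal hinteg, hval]
        · congr 1
          simp [div_eq_mul_inv]
        · exact (ae_restrict_iff' measurableSet_Ioi).2 (Eventually.of_forall hpos)

lemma sum_inv_le {u : Finset ℂ} {δ : ℂ → ℝ} (hδ : ∀ b ∈ u, 0 < δ b)
    (hd : (u : Set ℂ).PairwiseDisjoint fun b => ball b (δ b / 100)) (x : ℂ) {t : ℝ} (ht : 0 < t) :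
    ∑ b ∈ u with dist x b < 3 * δ b ∧ t < δ b, ENNReal.ofReal (1 / δ b) ≤
      ENNReal.ofReal (1300000 / t) := by
  classical
  set v := u.filter fun b => dist x b < 3 * δ b ∧ t < δ b with hv
  have hvu : v ⊆ u := Finset.filter_subset _ _
  have h1 : ∀ b ∈ v, ENNReal.ofReal (Real.pi / 650000) * ENNReal.ofReal (1 / δ b) ≤
      ∫⁻ z in ball b (δ b / 100), ENNReal.ofReal (((t + dist z x) ^ 3)⁻¹) := by
    intro b hb
    obtain ⟨hbu, hxb, htb⟩ := Finset.mem_filter.1 hb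
    have hb0 := hδ b hbu
    calc _ = ENNReal.ofReal (1 / (65 * δ b ^ 3)) * volume (ball b (δ b / 100)) := by
          rw [volume_ball_eq b (by positivity), ← ENNReal.ofReal_mul (by positivity),
            ← ENNReal.ofReal_mul (by positivity)]
          congr 1
          field_simp
          norm_num
      _ = ∫⁻ _ in ball b (δ b / 100), ENNReal.ofReal (1 / (65 * δ b ^ 3)) := by
          rw [setLIntegral_const]
      _ ≤ _ := by
          refine setLIntegral_mono' measurableSet_ball fun z hz => ENNReal.ofReal_le_ofReal ?_
          rw [one_div]
          have h2 : t + dist z x ≤ 401 / 100 * δ b := by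
            have := dist_triangle z b x
            rw [dist_comm b x] at this
            have := mem_ball.1 hz
            linarith
          refine inv_anti₀ (by positivity) ?_
          calc (t + dist z x) ^ 3 ≤ (401 / 100 * δ b) ^ 3 := by gcongr
            _ ≤ _ := by
              rw [mul_pow]
              gcongr
              norm_num
  have h2 : ENNReal.ofReal (Real.pi / 650000) * ∑ b ∈ v, ENNReal.ofReal (1 / δ b) ≤
      ENNReal.ofReal (Real.pi / 650000) * ENNReal.ofReal (1300000 / t) := by
    calc _ ≤ ∑ b ∈ v, ∫⁻ z in ball b (δ b / 100), ENNReal.ofReal (((t + dist z x) ^ 3)⁻¹) := by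
          rw [Finset.mul_sum]
          exact Finset.sum_le_sum h1
      _ = ∫⁻ z in ⋃ b ∈ v, ball b (δ b / 100), ENNReal.ofReal (((t + dist z x) ^ 3)⁻¹) :=
          (lintegral_biUnion_finset (hd.subset (by exact_mod_cast hvu))
            (fun _ _ => measurableSet_ball) _).symm
      _ ≤ ∫⁻ z, ENNReal.ofReal (((t + dist z x) ^ 3)⁻¹) := setLIntegral_le_lintegral _ _
      _ ≤ _ := (lintegral_inv_cube_le x ht).trans_eq (by
          rw [← ENNReal.ofReal_mul (by positivity)]
          congr 1
          field_simp
          norm_num)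
  exact (ENNReal.mul_le_mul_iff_right (by simp; positivity) ENNReal.ofReal_ne_top).1 h2

lemma card_le_of_le_lintegral {u : Finset ℂ} {δ : ℂ → ℝ} (hδ : ∀ b ∈ u, 0 < δ b)
    (hd : (u : Set ℂ).PairwiseDisjoint fun b => ball b (δ b / 100)) {g : ℂ → ℝ≥0∞}
    (hg : Measurable g) (h : ∀ b ∈ u, ENNReal.ofReal (δ b / 320) ≤ ∫⁻ z in ball b (3 * δ b), g z) :
    (u.card : ℝ≥0∞) ≤ ENNReal.ofReal (640 * 1300000 * (5760 * Real.pi)) * ∫⁻ z, g z ^ 2 := by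
  classical
  set κ : ℝ := 1 / (5760 * Real.pi) with hκ
  have hκ0 : 0 < κ := by positivity
  set G : ℂ → ℂ → ℝ≥0∞ := fun b z => {z | ENNReal.ofReal (κ / δ b) < g z}.indicator g z with hG
  have hGm : ∀ b, Measurable (G b) := fun b => hg.indicator (measurableSet_lt measurable_const hg)
  have h1 : ∀ b ∈ u, (1 : ℝ≥0∞) ≤
      ∫⁻ z, ENNReal.ofReal (640 / δ b) * (ball b (3 * δ b)).indicator (G b) z := by
    intro b hb
    have hb0 := hδ b hb
    have h2 : ∫⁻ z in ball b (3 * δ b), g z ≤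
        ENNReal.ofReal (δ b / 640) + ∫⁻ z in ball b (3 * δ b), G b z := by
      calc _ ≤ ∫⁻ z in ball b (3 * δ b), (ENNReal.ofReal (κ / δ b) + G b z) := by
            refine lintegral_mono fun z => ?_
            by_cases hz : ENNReal.ofReal (κ / δ b) < g z
            · simp [hG, indicator, hz]
            · exact (not_lt.1 hz).trans le_self_add
        _ = _ := by
            rw [lintegral_add_left measurable_const, setLIntegral_const,
              volume_ball_eq b (by positivity), ← ENNReal.ofReal_mul (by positivity)]
            congr 2
            rw [hκ]
            field_simp
            norm_num
    have h3 : ENNReal.ofReal (δ b / 640) ≤ ∫⁻ z in ball b (3 * δ b), G b z := by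
      have h4 := (h b hb).trans h2
      rw [show δ b / 320 = δ b / 640 + δ b / 640 by ring,
        ENNReal.ofReal_add (by positivity) (by positivity)] at h4
      exact (ENNReal.add_le_add_iff_left ENNReal.ofReal_ne_top).1 h4
    rw [lintegral_const_mul _ ((hGm b).indicator measurableSet_ball),
      lintegral_indicator measurableSet_ball]
    calc (1 : ℝ≥0∞) = ENNReal.ofReal (640 / δ b) * ENNReal.ofReal (δ b / 640) := by
          rw [← ENNReal.ofReal_mul (by positivity), ← ENNReal.ofReal_one]
          congr 1
          field_simp
      _ ≤ _ := by gcongr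
  have h5 : ∀ z, ∑ b ∈ u, ENNReal.ofReal (640 / δ b) * (ball b (3 * δ b)).indicator (G b) z ≤
      ENNReal.ofReal (640 * 1300000 * (5760 * Real.pi)) * g z ^ 2 := by
    intro z
    rcases eq_or_ne (g z) 0 with h0 | h0
    · have : ∀ b, (ball b (3 * δ b)).indicator (G b) z = 0 := by
        intro b
        simp [hG, indicator, h0]
      simp [this]
    rcases eq_or_ne (g z) ⊤ with ht | ht
    · rw [ht, ENNReal.top_pow two_ne_zero, ENNReal.mul_top (by simp; positivity)]
      exact le_top
    set a := (g z).toReal with ha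
    have ha0 : 0 < a := ENNReal.toReal_pos h0 ht
    have hga : g z = ENNReal.ofReal a := (ENNReal.ofReal_toReal ht).symm
    calc _ ≤ ∑ b ∈ u with dist z b < 3 * δ b ∧ κ / a < δ b,
          ENNReal.ofReal (1 / δ b) * (ENNReal.ofReal 640 * ENNReal.ofReal a) := by
          rw [Finset.sum_filter]
          refine Finset.sum_le_sum fun b hb => ?_
          have hb0 := hδ b hb
          by_cases hz : z ∈ ball b (3 * δ b)
          swap
          · simp [indicator_of_notMem hz]
          rw [indicator_of_mem hz]
          by_cases hz2 : ENNReal.ofReal (κ / δ b) < g z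
          swap
          · simp [hG, indicator, hz2]
          have hz3 : κ / a < δ b := by
            rw [hga, ENNReal.ofReal_lt_ofReal_iff ha0, div_lt_comm₀ hb0 ha0] at hz2
            exact hz2
          have hGz : G b z = g z := indicator_of_mem (s := {z | ENNReal.ofReal (κ / δ b) < g z}) hz2 g
          rw [if_pos ⟨hz, hz3⟩, hGz, hga, ← mul_assoc, ← ENNReal.ofReal_mul (by positivity)]
          apply le_of_eq
          rw [← ENNReal.ofReal_mul (by positivity), ← ENNReal.ofReal_mul (by positivity)]
          congr 1
          ring
      _ = (∑ b ∈ u with dist z b < 3 * δ b ∧ κ / a < δ b,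
          ENNReal.ofReal (1 / δ b)) * (ENNReal.ofReal 640 * ENNReal.ofReal a) := by
          rw [Finset.sum_mul]
      _ ≤ ENNReal.ofReal (1300000 / (κ / a)) * (ENNReal.ofReal 640 * ENNReal.ofReal a) := by
          gcongr
          exact sum_inv_le hδ hd z (by positivity)
      _ = _ := by
          rw [hga, ← ENNReal.ofReal_pow ha0.le, ← ENNReal.ofReal_mul (by positivity),
            ← ENNReal.ofReal_mul (by positivity), ← ENNReal.ofReal_mul (by positivity)]
          congr 1
          rw [hκ]
          field_simp
  calc (u.card : ℝ≥0∞) = ∑ b ∈ u, 1 := by simp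
    _ ≤ ∑ b ∈ u, ∫⁻ z, ENNReal.ofReal (640 / δ b) * (ball b (3 * δ b)).indicator (G b) z :=
        Finset.sum_le_sum h1
    _ = ∫⁻ z, ∑ b ∈ u, ENNReal.ofReal (640 / δ b) * (ball b (3 * δ b)).indicator (G b) z :=
        (lintegral_finsetSum _ fun b _ =>
          ((hGm b).indicator measurableSet_ball).const_mul _).symm
    _ ≤ ∫⁻ z, ENNReal.ofReal (640 * 1300000 * (5760 * Real.pi)) * g z ^ 2 := lintegral_mono h5
    _ = _ := lintegral_const_mul _ (hg.pow_const 2)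

lemma card_filter_mem_ball_le {u : Finset ℂ} {T : Set ℂ} (hδ : ∀ b ∈ u, 0 < infDist b T)
    (hd : (u : Set ℂ).PairwiseDisjoint fun b => ball b (infDist b T / 100)) (x : ℂ) :
    (u.filter fun b => dist x b < infDist b T / 10).card ≤ 190 := by
  classical
  set v := u.filter fun b => dist x b < infDist b T / 10 with hv
  have hvu : v ⊆ u := Finset.filter_subset _ _
  set δ := infDist x T
  rcases v.eq_empty_or_nonempty with h | ⟨b0, hb0⟩
  · simp [h]
  have key : ∀ b ∈ v, infDist b T ≤ 10 / 9 * δ ∧ δ ≤ 11 / 10 * infDist b T := by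
    intro b hb
    have h1 := (Finset.mem_filter.1 hb).2
    have h2 := infDist_le_infDist_add_dist (s := T) (x := b) (y := x)
    have h3 := infDist_le_infDist_add_dist (s := T) (x := x) (y := b)
    rw [dist_comm b x] at h2
    constructor <;> simp only [δ] <;> linarith
  have hδ0 : 0 < δ := by
    have := (key b0 hb0).1
    have := hδ b0 (hvu hb0)
    linarith
  have h1 : (v.card : ℝ≥0∞) * ENNReal.ofReal (Real.pi * (δ / 110) ^ 2) ≤
      ENNReal.ofReal (Real.pi * (11 / 90 * δ) ^ 2) := by
    calc _ = ∑ b ∈ v, ENNReal.ofReal (Real.pi * (δ / 110) ^ 2) := by simp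
      _ ≤ ∑ b ∈ v, volume (ball b (infDist b T / 100)) := by
          refine Finset.sum_le_sum fun b hb => ?_
          rw [volume_ball_eq b (by have := infDist_nonneg (x := b) (s := T); positivity)]
          have : δ / 110 ≤ infDist b T / 100 := by linarith [(key b hb).2]
          gcongr
      _ = volume (⋃ b ∈ v, ball b (infDist b T / 100)) :=
          (measure_biUnion_finset (hd.subset (by exact_mod_cast hvu))
            (fun _ _ => measurableSet_ball)).symm
      _ ≤ volume (ball x (11 / 90 * δ)) := by
          refine measure_mono (iUnion₂_subset fun b hb => ball_subset_ball' ?_)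
          have h1 := (Finset.mem_filter.1 hb).2
          rw [dist_comm] at h1
          have := (key b hb).1
          linarith
      _ = _ := volume_ball_eq x (by positivity)
  rw [← ENNReal.ofReal_natCast, ← ENNReal.ofReal_mul (by positivity),
    ENNReal.ofReal_le_ofReal_iff (by positivity)] at h1
  have h2 : (v.card : ℝ) ≤ 190 := by
    have h3 : (v.card : ℝ) * (Real.pi * δ ^ 2) * (1 / 12100) ≤ (121 / 8100) * (Real.pi * δ ^ 2) := by
      linarith [h1]
    have h4 : 0 < Real.pi * δ ^ 2 := by positivity
    by_contra! h5
    nlinarith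
  exact_mod_cast h2

/-- Adapted balls covering a compactly contained set. -/
lemma exists_ball_covering {V B K : Set ℂ} (hV : IsOpen V) (hVb : Bornology.IsBounded V)
    (hK : IsCompact K) (hBK : B ⊆ K) (hKV : K ⊆ V) :
    ∃ u : Finset ℂ, (∀ b ∈ u, b ∈ B) ∧ (∀ b ∈ u, 0 < infDist b Vᶜ) ∧
      ((u : Set ℂ).PairwiseDisjoint fun b => ball b (infDist b Vᶜ / 100)) ∧
      ∀ x ∈ B, ∃ b ∈ u, x ∈ ball b (infDist b Vᶜ / 20) := by
  have hne : (Vᶜ).Nonempty := by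
    rw [nonempty_compl]
    rintro rfl
    exact NoncompactSpace.noncompact_univ (X := ℂ) |>.elim
      (isCompact_of_isClosed_isBounded isClosed_univ hVb)
  have hpos : ∀ x ∈ V, 0 < infDist x Vᶜ := fun x hx =>
    (hV.isClosed_compl.notMem_iff_infDist_pos hne).1 (by simpa using hx)
  obtain ⟨R, hR⟩ := (hK.image (continuous_infDist_pt Vᶜ)).bddAbove
  obtain ⟨u, huB, hdisj, hcov⟩ := Vitali.exists_disjoint_subfamily_covering_enlargement_closedBall
    B (fun x : ℂ => x) (fun x => infDist x Vᶜ / 100) (R / 100)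
    (fun a ha => by
      have := hR (mem_image_of_mem _ (hBK ha))
      linarith) 4 (by norm_num)
  have hdisj' : u.PairwiseDisjoint fun b => ball b (infDist b Vᶜ / 100) := fun a ha b hb hab =>
    (hdisj ha hb hab).mono ball_subset_closedBall ball_subset_closedBall
  have hfin : u.Finite := by
    rcases u.eq_empty_or_nonempty with rfl | ⟨b0, hb0⟩
    · exact finite_empty
    obtain ⟨m, hmK, hm⟩ := hK.exists_isMinOn ⟨b0, hBK (huB hb0)⟩
      (continuous_infDist_pt Vᶜ).continuousOn
    have hm0 : 0 < infDist m Vᶜ := hpos m (hKV hmK)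
    have := Measure.finite_const_le_meas_of_disjoint_iUnion (volume : Measure ℂ)
      (ε := ENNReal.ofReal (Real.pi * (infDist m Vᶜ / 100) ^ 2)) (by simp; positivity)
      (As := fun b : u => ball (b : ℂ) (infDist (b : ℂ) Vᶜ / 100)) (fun _ => measurableSet_ball)
      (fun a b hab => hdisj' a.2 b.2 (fun h => hab (Subtype.ext h)))
      (ne_top_of_le_ne_top (hVb.measure_lt_top (μ := volume)).ne (measure_mono (iUnion_subset fun b => by
        refine fun z hz => by_contra fun hzV => ?_
        have h1 : infDist (b : ℂ) Vᶜ ≤ dist (b : ℂ) z := infDist_le_dist_of_mem hzV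
        have h2 := mem_ball.1 hz
        rw [dist_comm] at h2
        have h3 := hpos b (hKV (hBK (huB b.2)))
        linarith)))
    have h2 : {i : u | ENNReal.ofReal (Real.pi * (infDist m Vᶜ / 100) ^ 2) ≤
        volume (ball (i : ℂ) (infDist (i : ℂ) Vᶜ / 100))} = univ := by
      refine eq_univ_of_forall fun b => ?_
      rw [mem_ofPred_eq, volume_ball_eq _ (by have := infDist_nonneg (x := (b : ℂ)) (s := Vᶜ); positivity)]
      have : infDist m Vᶜ ≤ infDist (b : ℂ) Vᶜ := hm (hBK (huB b.2))
      gcongr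
    rw [h2] at this
    exact Set.finite_coe_iff.1 (Set.finite_univ_iff.1 this)
  refine ⟨hfin.toFinset, fun b hb => huB (hfin.mem_toFinset.1 hb),
    fun b hb => hpos b (hKV (hBK (huB (hfin.mem_toFinset.1 hb)))), by simpa using hdisj',
    fun x hx => ?_⟩
  obtain ⟨b, hb, hxb⟩ := hcov x hx
  refine ⟨b, hfin.mem_toFinset.2 hb, ?_⟩
  have h1 := hpos x (hKV (hBK hx))
  have h2 := hpos b (hKV (hBK (huB hb)))
  have h3 := mem_closedBall.1 (hxb (mem_closedBall_self (by positivity)))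
  rw [mem_ball]
  linarith

/-- The components of `B' ∩ ball b (2 * r)` which meet `B ∩ ball b r` are controlled by the
energy of a test function separating `B` from the complement of `B'`. -/
lemma Adm.card_sq_le {B B' : Set ℂ} {ψ h} (ad : Adm B' B ψ h) (hB : IsPreconnected B)
    (hB' : IsOpen B') (hBB' : B ⊆ B') {b : ℂ} {r : ℝ} (hr : 0 < r) (hBb : ¬ B ⊆ ball b (2 * r))
    (Q : Finset ℂ) (hQB : ∀ x ∈ Q, x ∈ B) (hQr : ∀ x ∈ Q, x ∈ ball b r)
    (hQ : ∀ x ∈ Q, ∀ y ∈ Q, x ≠ y → y ∉ connectedComponentIn (B' ∩ ball b (2 * r)) x) :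
    (Q.card : ℝ≥0∞) ^ 2 ≤ 1 + ENNReal.ofReal (16 * Real.pi) * ∫⁻ z in ball b (2 * r), h z ^ 2 := by
  classical
  set T := B' ∩ ball b (2 * r) with hT
  have hTo : IsOpen T := hB'.inter isOpen_ball
  rcases le_or_gt Q.card 1 with h1 | h1
  · refine le_self_add.trans' ?_
    have : (Q.card : ℝ≥0∞) ≤ 1 := by exact_mod_cast h1
    calc (Q.card : ℝ≥0∞) ^ 2 ≤ 1 ^ 2 := by gcongr
      _ = 1 := one_pow 2
  have hxT : ∀ x ∈ Q, x ∈ T := fun x hx =>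
    ⟨hBB' (hQB x hx), ball_subset_ball (by linarith) (hQr x hx)⟩
  have hs : ∀ s ∈ Ioo r (2 * r), (Q.card : ℝ≥0∞) ≤ 2 * circleLen h b s := by
    intro s hs
    have hs0 : 0 ≤ s := hr.le.trans hs.1.le
    have hex : ∀ x ∈ Q, ∃ p ∈ connectedComponentIn T x, p ∈ B ∧ dist p b = s := by
      intro x hx
      by_contra! hcon
      obtain ⟨q, hqB, hq⟩ := not_subset.1 hBb
      obtain ⟨z, -, hz1, hz2⟩ := hB (connectedComponentIn T x ∩ ball b s)
        ({w | w ∈ T ∧ w ∉ connectedComponentIn T x} ∪ (closedBall b s)ᶜ)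
        (hTo.connectedComponentIn.inter isOpen_ball)
        ((isOpen_diff_connectedComponentIn hTo x).union isClosed_closedBall.isOpen_compl)
        (by
          intro w hw
          by_cases hwc : w ∈ connectedComponentIn T x
          · rcases lt_or_gt_of_ne (hcon w hwc hw) with h2 | h2
            · exact Or.inl ⟨hwc, h2⟩
            · exact Or.inr (Or.inr (by simpa using h2))
          · by_cases hwb : w ∈ ball b (2 * r)
            · exact Or.inr (Or.inl ⟨⟨hBB' hw, hwb⟩, hwc⟩)
            · refine Or.inr (Or.inr ?_)
              rw [mem_ball, not_lt] at hwb
              simpa using hs.2.trans_le hwb)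
        ⟨x, hQB x hx, mem_connectedComponentIn (hxT x hx), (mem_ball.1 (hQr x hx)).trans hs.1⟩
        ⟨q, hqB, Or.inr (by
          rw [mem_ball, not_lt] at hq
          simpa using hs.2.trans_le hq)⟩
      rcases hz2 with hz2 | hz2
      · exact hz2.2 hz1.1
      · exact hz2 (ball_subset_closedBall hz1.2)
    choose! p hp hpB hps using hex
    have hne : ∀ x ∈ Q, ∀ y ∈ Q, x ≠ y → p y ∉ connectedComponentIn T (p x) := by
      intro x hx y hy hxy hmem
      rw [← connectedComponentIn_eq (hp x hx)] at hmem
      have e1 := connectedComponentIn_eq hmem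
      rw [← connectedComponentIn_eq (hp y hy)] at e1
      exact hQ x hx y hy hxy (e1 ▸ mem_connectedComponentIn (hxT y hy))
    have hinj : Set.InjOn p Q := by
      intro x hx y hy hxy
      by_contra hne'
      refine hne x hx y hy hne' ?_
      rw [← hxy]
      exact mem_connectedComponentIn (connectedComponentIn_subset _ _ (hp x hx))
    have hcard := ad.grad.card_le b hs0 (Q.image p) (by
      intro z hz
      obtain ⟨x, hx, rfl⟩ := Finset.mem_image.1 hz
      exact ⟨hps x hx, ad.eq_one _ (hpB x hx)⟩) (by
      intro z hz w hw hzw A hA hAs hzA hwA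
      obtain ⟨x, hx, rfl⟩ := Finset.mem_image.1 hz
      obtain ⟨y, hy, rfl⟩ := Finset.mem_image.1 hw
      by_contra! hcon
      refine hne x hx y hy (fun h2 => hzw (by rw [h2])) ?_
      have hAT : A ⊆ T := by
        refine fun a ha => ⟨?_, ?_⟩
        swap
        · have := mem_sphere.1 (hAs ha)
          rw [mem_ball, this]
          exact hs.2
        by_contra haB
        exact hcon a ha (ad.eq_zero haB)
      exact hA.subset_connectedComponentIn hzA hAT hwA)
    rw [Finset.card_image_of_injOn hinj] at hcard
    have h2 : (2 : ℝ≥0∞) ≤ Q.card := by exact_mod_cast h1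
    have h3 : (Q.card : ℝ≥0∞) + Q.card ≤ Q.card + 2 * circleLen h b s := by
      calc (Q.card : ℝ≥0∞) + Q.card ≤ (1 + circleLen h b s) + (1 + circleLen h b s) := by gcongr
        _ = 2 + 2 * circleLen h b s := by ring
        _ ≤ _ := by gcongr
    exact (ENNReal.add_le_add_iff_left (ENNReal.natCast_ne_top _)).1 h3
  set I := ∫⁻ z in ball b (2 * r), h z
  have h4 : (Q.card : ℝ≥0∞) * ENNReal.ofReal r ≤ 2 * I := by
    calc (Q.card : ℝ≥0∞) * ENNReal.ofReal r = ∫⁻ _ in Ioo r (2 * r), (Q.card : ℝ≥0∞) := by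
          rw [setLIntegral_const, Real.volume_Ioo]
          congr 2
          ring
      _ ≤ ∫⁻ s in Ioo r (2 * r), 2 * circleLen h b s := setLIntegral_mono' measurableSet_Ioo hs
      _ = 2 * ∫⁻ s in Ioo r (2 * r), circleLen h b s :=
          lintegral_const_mul _ (measurable_circleLen ad.meas b)
      _ ≤ 2 * I := by
          gcongr
          exact lintegral_circleLen_le ad.meas b hr.le
  have h5 : (Q.card : ℝ≥0∞) ^ 2 * ENNReal.ofReal (r ^ 2) ≤
      (ENNReal.ofReal (16 * Real.pi) * ∫⁻ z in ball b (2 * r), h z ^ 2) * ENNReal.ofReal (r ^ 2) := by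
    calc _ = ((Q.card : ℝ≥0∞) * ENNReal.ofReal r) ^ 2 := by
          rw [mul_pow, ENNReal.ofReal_pow hr.le]
      _ ≤ (2 * I) ^ 2 := by gcongr
      _ = 4 * I ^ 2 := by rw [mul_pow]; norm_num
      _ ≤ 4 * (volume (ball b (2 * r)) * ∫⁻ z in ball b (2 * r), h z ^ 2) := by
          gcongr
          exact sq_setLIntegral_le ad.meas _
      _ = _ := by
          rw [volume_ball_eq b (by positivity), ← mul_assoc,
            mul_right_comm (ENNReal.ofReal (16 * Real.pi))]
          congr 1
          rw [← ENNReal.ofReal_mul (by positivity), show (4 : ℝ≥0∞) = ENNReal.ofReal 4 by simp,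
            ← ENNReal.ofReal_mul (by positivity)]
          congr 1
          ring
  exact ((ENNReal.mul_le_mul_iff_left (by simp; positivity) ENNReal.ofReal_ne_top).1 h5).trans
    le_add_self

lemma MultLE.image_injOn {F : Polynomial ℂ} {O : Set ℂ} {M : ℝ} (h : MultLE F O M) {w : ℂ}
    {S : Finset ℂ} {p : ℂ → ℂ} (hp : ∀ z ∈ S, p z ∈ O ∧ F.eval (p z) = w) (hi : Set.InjOn p S) :
    (S.card : ℝ) ≤ M := by
  classical
  rw [← Finset.card_image_of_injOn hi]
  refine h w _ fun x hx => ?_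
  obtain ⟨z, hz, rfl⟩ := Finset.mem_image.1 hx
  exact hp z hz

/-- The union of the components of `F⁻¹ (ball b (2 * r))` which meet `Λ ∩ F⁻¹ (ball b r)`. -/
def liftedBall (F : Polynomial ℂ) (Λ : Set ℂ) (b : ℂ) (r : ℝ) : Set ℂ :=
  {z | F.eval z ∈ ball b (2 * r) ∧
    ∃ a ∈ connectedComponentIn ((fun w => F.eval w) ⁻¹' ball b (2 * r)) z,
      a ∈ Λ ∧ F.eval a ∈ ball b r}

lemma isOpen_preimage_ball (F : Polynomial ℂ) (b : ℂ) (r : ℝ) :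
    IsOpen ((fun w => F.eval w) ⁻¹' ball b r) := isOpen_ball.preimage F.continuous

lemma isOpen_liftedBall (F : Polynomial ℂ) (Λ : Set ℂ) (b : ℂ) (r : ℝ) :
    IsOpen (liftedBall F Λ b r) ∧
      IsOpen {z | F.eval z ∈ ball b (2 * r) ∧ z ∉ liftedBall F Λ b r} := by
  set W := (fun w => F.eval w) ⁻¹' ball b (2 * r) with hW
  have hWo : IsOpen W := isOpen_preimage_ball F b (2 * r)
  have key : ∀ z ∈ W, ∀ x ∈ connectedComponentIn W z,
      (x ∈ liftedBall F Λ b r ↔ z ∈ liftedBall F Λ b r) := by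
    intro z hz x hx
    have hxW : x ∈ W := connectedComponentIn_subset _ _ hx
    have e := connectedComponentIn_eq hx
    constructor
    · rintro ⟨-, a, ha, h⟩
      exact ⟨hz, a, by rw [← hW] at ha ⊢; rwa [e], h⟩
    · rintro ⟨-, a, ha, h⟩
      exact ⟨hxW, a, by rw [← hW] at ha ⊢; rwa [← e], h⟩
  constructor
  · rw [isOpen_iff_mem_nhds]
    intro z hz
    have hzW : z ∈ W := hz.1
    filter_upwards [hWo.connectedComponentIn.mem_nhds (mem_connectedComponentIn hzW)] with x hx
    exact (key z hzW x hx).2 hz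
  · rw [isOpen_iff_mem_nhds]
    rintro z ⟨hzW, hz⟩
    filter_upwards [hWo.connectedComponentIn.mem_nhds (mem_connectedComponentIn hzW)] with x hx
    exact ⟨connectedComponentIn_subset W z hx, fun h => hz ((key z hzW x hx).1 h)⟩

lemma liftedBall_subset {F : Polynomial ℂ} {V Λ : Set ℂ} {b w0 : ℂ} {r : ℝ}
    (hbV : ball b (2 * r) ⊆ V)
    (hΛU : Λ ⊆ connectedComponentIn ((fun w => F.eval w) ⁻¹' V) w0) :
    liftedBall F Λ b r ⊆ connectedComponentIn ((fun w => F.eval w) ⁻¹' V) w0 := by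
  rintro z ⟨hz, a, ha, haΛ, -⟩
  have h1 := connectedComponentIn_mono z
    (preimage_mono hbV : (fun w => F.eval w) ⁻¹' ball b (2 * r) ⊆ (fun w => F.eval w) ⁻¹' V)
  rw [connectedComponentIn_eq (hΛU haΛ), ← connectedComponentIn_eq (h1 ha)]
  exact mem_connectedComponentIn (hbV hz)

lemma multLE_liftedBall {F : Polynomial ℂ} (hF : 0 < F.natDegree) {B B' : Set ℂ} {w0 : ℂ}
    {ψ h} (ad : Adm B' B ψ h) (hB : IsPreconnected B) (hB' : IsOpen B') (hBB' : B ⊆ B')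
    {b : ℂ} {r d' : ℝ} (hr : 0 < r) (hd' : 0 ≤ d') (hBb : ¬ B ⊆ ball b (2 * r))
    (hM : MultLE F (connectedComponentIn ((fun w => F.eval w) ⁻¹' B') w0) d')
    (hinj : ∀ z ∈ liftedBall F (connectedComponentIn ((fun w => F.eval w) ⁻¹' B) w0) b r,
      Set.InjOn (fun w => F.eval w)
        (connectedComponentIn ((fun w => F.eval w) ⁻¹' ball b (2 * r)) z))
    (hfin : ∫⁻ z in ball b (2 * r), h z ^ 2 ≠ ⊤) :
    MultLE F (liftedBall F (connectedComponentIn ((fun w => F.eval w) ⁻¹' B) w0) b r)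
      (d' * √(1 + 16 * Real.pi * (∫⁻ z in ball b (2 * r), h z ^ 2).toReal)) := by
  classical
  intro w S hS
  set W := (fun w => F.eval w) ⁻¹' ball b (2 * r) with hW
  set T := B' ∩ ball b (2 * r) with hT
  have hTo : IsOpen T := hB'.inter isOpen_ball
  choose! a ha haΛ har using fun z hz => (hS z hz).1.2
  have haB : ∀ z ∈ S, F.eval (a z) ∈ B := fun z hz =>
    (connectedComponentIn_subset _ _ (haΛ z hz) : a z ∈ (fun w => F.eval w) ⁻¹' B)
  have haT : ∀ z ∈ S, F.eval (a z) ∈ T := fun z hz =>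
    ⟨hBB' (haB z hz), ball_subset_ball (by linarith) (har z hz)⟩
  set G : ℂ → Set ℂ := fun z => connectedComponentIn T (F.eval (a z)) with hG
  have hGo : ∀ z, IsOpen (G z) := fun z => hTo.connectedComponentIn
  have hcount : ∀ g ∈ S.image G, (S.filter fun z => G z = g).card ≤ ⌊d'⌋₊ := by
    intro g hg
    obtain ⟨z0, hz0, rfl⟩ := Finset.mem_image.1 hg
    refine Nat.le_floor ?_
    have hx : ∀ z ∈ S.filter fun z => G z = G z0,
        ∃ x ∈ connectedComponentIn ((fun w => F.eval w) ⁻¹' G z0) (a z),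
          F.eval x = F.eval (a z0) := by
      intro z hz
      obtain ⟨hzS, hzG⟩ := Finset.mem_filter.1 hz
      have h1 : F.eval (a z) ∈ G z0 := hzG ▸ mem_connectedComponentIn (haT z hzS)
      have h2 := image_connectedComponentIn hF (hGo z0) isPreconnected_connectedComponentIn h1
      have h3 : F.eval (a z0) ∈ G z0 := mem_connectedComponentIn (haT z0 hz0)
      rw [← h2] at h3
      exact h3
    choose! x hx hxe using hx
    have hGT : G z0 ⊆ T := connectedComponentIn_subset _ _
    have hxW : ∀ z ∈ S.filter fun z => G z = G z0, x z ∈ connectedComponentIn W z := by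
      intro z hz
      rw [connectedComponentIn_eq (ha z (Finset.mem_filter.1 hz).1)]
      exact connectedComponentIn_mono (a z)
        (preimage_mono (hGT.trans inter_subset_right)) (hx z hz)
    refine hM.image_injOn (w := F.eval (a z0)) (p := x) (fun z hz => ⟨?_, hxe z hz⟩) ?_
    · have h1 : a z ∈ connectedComponentIn ((fun w => F.eval w) ⁻¹' B') w0 :=
        connectedComponentIn_mono w0 (preimage_mono hBB') (haΛ z (Finset.mem_filter.1 hz).1)
      rw [connectedComponentIn_eq h1]
      exact connectedComponentIn_mono (a z)
        (preimage_mono (hGT.trans inter_subset_left)) (hx z hz)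
    · intro z hz z' hz' hzz'
      have h1 := hxW z hz
      have h2 := hxW z' hz'
      rw [← hzz'] at h2
      have hzS := hS z (Finset.mem_filter.1 hz).1
      have hzS' := hS z' (Finset.mem_filter.1 hz').1
      refine hinj z hzS.1 (mem_connectedComponentIn hzS.1.1) ?_ (hzS.2.trans hzS'.2.symm)
      rw [connectedComponentIn_eq h1, ← connectedComponentIn_eq h2]
      exact mem_connectedComponentIn hzS'.1.1
  have hcard := Finset.card_le_mul_card_image S ⌊d'⌋₊ hcount
  have hrep : ∀ g ∈ S.image G, ∃ z ∈ S, G z = g := fun g hg => by simpa using hg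
  choose! ρ hρS hρ using hrep
  set q := (S.image G).card with hq
  set Q := (S.image G).image fun g => F.eval (a (ρ g)) with hQ
  have hρinj : Set.InjOn (fun g => F.eval (a (ρ g))) (S.image G) := by
    intro g hg g' hg' hgg'
    rw [← hρ g hg, ← hρ g' hg']
    simp only [hG]
    rw [show F.eval (a (ρ g)) = F.eval (a (ρ g')) from hgg']
  have hQq : Q.card = q := Finset.card_image_of_injOn hρinj
  have hqe := ad.card_sq_le hB hB' hBB' hr hBb Q
    (by
      intro x hx
      obtain ⟨g, hg, rfl⟩ := Finset.mem_image.1 hx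
      exact haB _ (hρS g hg))
    (by
      intro x hx
      obtain ⟨g, hg, rfl⟩ := Finset.mem_image.1 hx
      exact har _ (hρS g hg))
    (by
      intro x hx y hy hxy hmem
      obtain ⟨g, hg, rfl⟩ := Finset.mem_image.1 hx
      obtain ⟨g', hg', rfl⟩ := Finset.mem_image.1 hy
      have h1 : G (ρ g) = G (ρ g') := connectedComponentIn_eq hmem
      rw [hρ g hg, hρ g' hg'] at h1
      exact hxy (by rw [h1]))
  rw [hQq] at hqe
  have hq2 : (q : ℝ) ≤ √(1 + 16 * Real.pi * (∫⁻ z in ball b (2 * r), h z ^ 2).toReal) := by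
    apply Real.le_sqrt_of_sq_le
    rw [← ENNReal.ofReal_toReal hfin, ← ENNReal.ofReal_one, ← ENNReal.ofReal_mul (by positivity),
      ← ENNReal.ofReal_add (by positivity) (by positivity), ← ENNReal.ofReal_natCast,
      ← ENNReal.ofReal_pow (by positivity), ENNReal.ofReal_le_ofReal_iff (by positivity)] at hqe
    exact hqe
  calc (S.card : ℝ) ≤ (⌊d'⌋₊ : ℝ) * q := by exact_mod_cast hcard
    _ ≤ _ := by
      gcongr
      exact Nat.floor_le hd'

lemma hasCap_of_liftedBall {F : Polynomial ℂ} (hF : 0 < F.natDegree) {U Λ : Set ℂ} {b : ℂ}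
    {r M : ℝ} (hr : 0 < r) (hM0 : 0 ≤ M) (hM : MultLE F (liftedBall F Λ b r) M)
    (hU : liftedBall F Λ b r ⊆ U) :
    HasCap U {z ∈ Λ | F.eval z ∈ ball b r} (M * (16 * Real.pi)) := by
  obtain ⟨h1, h2⟩ := isOpen_liftedBall F Λ b r
  refine ((hasCap_ball b hr).pullback hF hM0 h1 h2 hM).mono hU ?_ le_rfl
  rintro z ⟨hz, hzb⟩
  have hz2 : F.eval z ∈ ball b (2 * r) := ball_subset_ball (by linarith) hzb
  exact ⟨⟨hz2, z, mem_connectedComponentIn hz2, hz, hzb⟩, hzb⟩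

/-- **Covering lemma.** -/
theorem covering_lemma : ∃ C : ℝ, 0 < C ∧ ∀ (F : Polynomial ℂ) (V B' B : Set ℂ) (w0 : ℂ)
    (CV : Finset ℂ) (D d' Eφ Eψ : ℝ), 0 < F.natDegree → IsOpen V → Bornology.IsBounded V →
    HoleFree V → IsPreconnected B → IsOpen B' → B ⊆ B' → B' ⊆ V → F.eval w0 ∈ B →
    0 ≤ D → 0 ≤ d' → 0 ≤ Eφ → 0 ≤ Eψ →
    MultLE F (connectedComponentIn ((fun w => F.eval w) ⁻¹' V) w0) D →
    MultLE F (connectedComponentIn ((fun w => F.eval w) ⁻¹' B') w0) d' →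
    (∀ y r, ball y r ⊆ V → (∀ c ∈ CV, c ∉ ball y r) →
      ∀ z ∈ connectedComponentIn ((fun w => F.eval w) ⁻¹' V) w0, F.eval z ∈ ball y r →
        Set.InjOn (fun w => F.eval w)
          (connectedComponentIn ((fun w => F.eval w) ⁻¹' ball y r) z)) →
    HasCap V B Eφ → HasCap B' B Eψ →
    HasCap (connectedComponentIn ((fun w => F.eval w) ⁻¹' V) w0)
      (connectedComponentIn ((fun w => F.eval w) ⁻¹' B) w0)
      (C * ((CV.card + 1) * D + d' * √(Eφ * (Eφ + Eψ)))) := by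
  classical
  set C1 : ℝ := 640 * 1300000 * (5760 * Real.pi) with hC1
  have hC1pos : 0 < C1 := by positivity
  refine ⟨16 * Real.pi * C1, by positivity, ?_⟩
  intro F V B' B w0 CV D d' Eφ Eψ hF hV hVb hVh hB hB' hBB' hB'V hw0 hD hd' hEφ hEψ hMD hMd hinj
    hφ hψ
  have hpi := Real.pi_gt_three
  set U := connectedComponentIn ((fun w => F.eval w) ⁻¹' V) w0 with hU
  set Λ := connectedComponentIn ((fun w => F.eval w) ⁻¹' B) w0 with hΛ
  have hΛU : Λ ⊆ U := connectedComponentIn_mono w0 (preimage_mono (hBB'.trans hB'V))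
  have hΛB : ∀ z ∈ Λ, F.eval z ∈ B := fun z hz =>
    (connectedComponentIn_subset _ _ hz : z ∈ (fun w => F.eval w) ⁻¹' B)
  have hVne : (Vᶜ).Nonempty := by
    rw [nonempty_compl]
    rintro rfl
    exact NoncompactSpace.noncompact_univ (X := ℂ) |>.elim
      (isCompact_of_isClosed_isBounded isClosed_univ hVb)
  have hballV : ∀ y s, s ≤ infDist y Vᶜ → ball y s ⊆ V := by
    intro y s hs z hz
    by_contra hzV
    have h1 : infDist y Vᶜ ≤ dist y z := infDist_le_dist_of_mem hzV
    rw [dist_comm] at h1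
    linarith [mem_ball.1 hz]
  have hpos : ∀ x ∈ V, 0 < infDist x Vᶜ := fun x hx =>
    (hV.isClosed_compl.notMem_iff_infDist_pos hVne).1 (by simpa using hx)
  by_cases hsmall : ∃ y ∈ B, B ⊆ ball y (infDist y Vᶜ / 10)
  · obtain ⟨y, hy, hyB⟩ := hsmall
    have hδ := hpos y (hB'V (hBB' hy))
    have hsub := liftedBall_subset (F := F) (r := infDist y Vᶜ / 10)
      (hballV y (2 * (infDist y Vᶜ / 10)) (by linarith)) hΛU
    refine (hasCap_of_liftedBall hF (by positivity) hD (hMD.mono hsub le_rfl) hsub).mono le_rfl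
      (fun z hz => ⟨hz, hyB (hΛB z hz)⟩) ?_
    have h1 : D ≤ C1 * D := le_mul_of_one_le_left hD (by rw [hC1]; nlinarith)
    have h2 : (0 : ℝ) ≤ CV.card * D := by positivity
    have h3 : 0 ≤ d' * √(Eφ * (Eφ + Eψ)) := by positivity
    have h4 : C1 * D ≤ C1 * ((CV.card + 1) * D + d' * √(Eφ * (Eφ + Eψ))) := by
      gcongr
      linarith
    calc D * (16 * Real.pi) = 16 * Real.pi * D := by ring
      _ ≤ 16 * Real.pi * (C1 * ((CV.card + 1) * D + d' * √(Eφ * (Eφ + Eψ)))) := by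
        gcongr
        exact h1.trans h4
      _ = _ := by ring
  push Not at hsmall
  obtain ⟨φ, g, adφ, eφ⟩ := hφ
  obtain ⟨ψ, h, adψ, eψ⟩ := hψ
  obtain ⟨K, hK, hKV, hφK⟩ := adφ.supp
  have hBK : B ⊆ K := by
    intro x hx
    by_contra hxK
    have := adφ.eq_one x hx
    rw [hφK x hxK] at this
    norm_num at this
  obtain ⟨u, huB, hupos, hud, hucov⟩ := exists_ball_covering hV hVb hK hBK hKV
  set δ : ℂ → ℝ := fun b => infDist b Vᶜ with hδ
  have hub : ∀ b ∈ u, ¬ B ⊆ ball b (2 * (δ b / 20)) := by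
    intro b hb
    rw [show 2 * (δ b / 20) = δ b / 10 by ring]
    exact hsmall b (huB b hb)
  have hN : (u.card : ℝ) ≤ C1 * Eφ := by
    have h1 := card_le_of_le_lintegral hupos hud adφ.meas (fun b hb => by
      obtain ⟨p, hp, hbp⟩ := hV.isClosed_compl.exists_infDist_eq_dist hVne b
      exact adφ.le_lintegral_ball hVh hB (huB b hb) hp (hupos b hb) hbp.symm
        (hsmall b (huB b hb)))
    rw [← hC1] at h1
    have h2 := h1.trans (mul_le_mul' le_rfl eφ)
    rw [← ENNReal.ofReal_mul hC1pos.le, ← ENNReal.ofReal_natCast,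
      ENNReal.ofReal_le_ofReal_iff (by positivity)] at h2
    exact h2
  have hpack : ∀ x, (u.filter fun b => dist x b < δ b / 10).card ≤ 190 :=
    card_filter_mem_ball_le hupos hud
  set e : ℂ → ℝ := fun b => (∫⁻ z in ball b (2 * (δ b / 20)), h z ^ 2).toReal with he
  have hfinall : ∫⁻ z, h z ^ 2 ≠ ⊤ := ne_top_of_le_ne_top ENNReal.ofReal_ne_top eψ
  have hfin : ∀ b, ∫⁻ z in ball b (2 * (δ b / 20)), h z ^ 2 ≠ ⊤ := fun b =>
    ne_top_of_le_ne_top hfinall (setLIntegral_le_lintegral _ _)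
  have hesum : ∑ b ∈ u, e b ≤ 190 * Eψ := by
    have h1 : ∑ b ∈ u, ∫⁻ z in ball b (2 * (δ b / 20)), h z ^ 2 ≤ ENNReal.ofReal (190 * Eψ) := by
      calc _ = ∑ b ∈ u, ∫⁻ z, (ball b (2 * (δ b / 20))).indicator (fun z => h z ^ 2) z := by
            refine Finset.sum_congr rfl fun b _ => ?_
            rw [lintegral_indicator measurableSet_ball]
        _ = ∫⁻ z, ∑ b ∈ u, (ball b (2 * (δ b / 20))).indicator (fun z => h z ^ 2) z :=
            (lintegral_finsetSum _ fun b _ =>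
              (adψ.meas.pow_const 2).indicator measurableSet_ball).symm
        _ ≤ ∫⁻ z, 190 * h z ^ 2 := by
            refine lintegral_mono fun z => ?_
            calc _ = ∑ b ∈ u.filter fun b => dist z b < δ b / 10, h z ^ 2 := by
                  rw [Finset.sum_filter]
                  refine Finset.sum_congr rfl fun b _ => ?_
                  rw [show 2 * (δ b / 20) = δ b / 10 by ring]
                  simp only [indicator, mem_ball]
              _ = ((u.filter fun b => dist z b < δ b / 10).card : ℝ≥0∞) * h z ^ 2 := by
                  rw [Finset.sum_const, nsmul_eq_mul]
              _ ≤ _ := by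
                  gcongr
                  exact_mod_cast hpack z
        _ = 190 * ∫⁻ z, h z ^ 2 := lintegral_const_mul _ (adψ.meas.pow_const 2)
        _ ≤ 190 * ENNReal.ofReal Eψ := by gcongr
        _ = _ := by rw [ENNReal.ofReal_mul (by norm_num)]; norm_num
    rw [← ENNReal.toReal_sum fun b _ => hfin b]
    exact ENNReal.toReal_le_of_le_ofReal (by positivity) h1
  have he0 : ∀ b, 0 ≤ e b := fun b => ENNReal.toReal_nonneg
  set P : ℂ → Prop := fun b => ∃ c ∈ CV, c ∈ ball b (2 * (δ b / 20)) with hP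
  set M : ℂ → ℝ := fun b => if P b then D else d' * √(1 + 16 * Real.pi * e b) with hM
  have hM0 : ∀ b, 0 ≤ M b := by
    intro b
    simp only [hM]
    split_ifs <;> positivity
  have hcap : ∀ b ∈ u, HasCap U {z ∈ Λ | F.eval z ∈ ball b (δ b / 20)}
      (M b * (16 * Real.pi)) := by
    intro b hb
    have hδb := hupos b hb
    have hr : 0 < δ b / 20 := by positivity
    have hbV : ball b (2 * (δ b / 20)) ⊆ V := hballV b _ (by simp only [hδ]; linarith)
    have hsub := liftedBall_subset (F := F) (r := δ b / 20) hbV hΛU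
    refine hasCap_of_liftedBall hF hr (hM0 b) ?_ hsub
    by_cases hPb : P b
    · simp only [hM, if_pos hPb]
      exact hMD.mono hsub le_rfl
    · simp only [hM, if_neg hPb]
      refine multLE_liftedBall hF adψ hB hB' hBB' hr hd' (hub b hb) hMd (fun z hz => ?_) (hfin b)
      exact hinj b _ hbV (fun c hc hcb => hPb ⟨c, hc, hcb⟩) z (hsub hz) hz.1
  have hcrit : ((u.filter P).card : ℝ) ≤ 190 * CV.card := by
    have h1 : u.filter P ⊆ CV.biUnion fun c => u.filter fun b => dist c b < δ b / 10 := by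
      intro b hb
      obtain ⟨hbu, c, hc, hcb⟩ := Finset.mem_filter.1 hb
      refine Finset.mem_biUnion.2 ⟨c, hc, Finset.mem_filter.2 ⟨hbu, ?_⟩⟩
      rw [mem_ball] at hcb
      linarith
    have h2 := (Finset.card_le_card h1).trans (Finset.card_biUnion_le_card_mul _ _ 190
      fun c _ => hpack c)
    calc ((u.filter P).card : ℝ) ≤ ((CV.card * 190 : ℕ) : ℝ) := by exact_mod_cast h2
      _ = _ := by push_cast; ring
  have hsum : ∑ b ∈ u, M b ≤ 190 * CV.card * D + d' * (C1 * √(Eφ * (Eφ + Eψ))) := by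
    calc ∑ b ∈ u, M b ≤ ∑ b ∈ u, ((if P b then D else 0) + d' * √(1 + 16 * Real.pi * e b)) := by
          refine Finset.sum_le_sum fun b _ => ?_
          simp only [hM]
          split_ifs
          · have : 0 ≤ d' * √(1 + 16 * Real.pi * e b) := by positivity
            linarith
          · linarith
      _ = (u.filter P).card * D + d' * ∑ b ∈ u, √(1 + 16 * Real.pi * e b) := by
          rw [Finset.sum_add_distrib, ← Finset.sum_filter, Finset.sum_const, nsmul_eq_mul,
            Finset.mul_sum]
      _ ≤ _ := by
          have h1 : ∑ b ∈ u, √(1 + 16 * Real.pi * e b) ≤ C1 * √(Eφ * (Eφ + Eψ)) := by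
            have h2 : (∑ b ∈ u, √(1 + 16 * Real.pi * e b)) ^ 2 ≤
                u.card * ∑ b ∈ u, √(1 + 16 * Real.pi * e b) ^ 2 := sq_sum_le_card_mul_sum_sq
            have h3 : ∑ b ∈ u, √(1 + 16 * Real.pi * e b) ^ 2 =
                u.card + 16 * Real.pi * ∑ b ∈ u, e b := by
              rw [Finset.card_eq_sum_ones, Nat.cast_sum, Finset.mul_sum, ← Finset.sum_add_distrib]
              refine Finset.sum_congr rfl fun b _ => ?_
              rw [Real.sq_sqrt (by have := he0 b; positivity), Nat.cast_one]
            have h4 : (∑ b ∈ u, √(1 + 16 * Real.pi * e b)) ^ 2 ≤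
                C1 ^ 2 * (Eφ * (Eφ + Eψ)) := by
              rw [h3] at h2
              have h5 : (u.card : ℝ) + 16 * Real.pi * ∑ b ∈ u, e b ≤ C1 * (Eφ + Eψ) := by
                have h6 : 16 * Real.pi * ∑ b ∈ u, e b ≤ 16 * Real.pi * (190 * Eψ) := by gcongr
                have h7 : 16 * Real.pi * 190 ≤ C1 := by rw [hC1]; linarith
                nlinarith
              calc _ ≤ _ := h2
                _ ≤ (C1 * Eφ) * (C1 * (Eφ + Eψ)) := by
                  gcongr
                _ = _ := by ring
            have h8 := Real.le_sqrt_of_sq_le h4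
            rwa [Real.sqrt_mul (by positivity), Real.sqrt_sq hC1pos.le] at h8
          gcongr
  refine (HasCap.biUnion u (fun b _ => mul_nonneg (hM0 b) (by positivity)) hcap).mono le_rfl
    (fun z hz => ?_) ?_
  · obtain ⟨b, hb, hzb⟩ := hucov _ (hΛB z hz)
    exact mem_biUnion hb ⟨hz, hzb⟩
  · rw [← Finset.sum_mul]
    have h1 : 190 * CV.card * D ≤ C1 * ((CV.card + 1) * D) := by
      have h2 : (190 : ℝ) ≤ C1 := by rw [hC1]; nlinarith
      have h3 : (0 : ℝ) ≤ CV.card * D := by positivity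
      nlinarith
    calc (∑ b ∈ u, M b) * (16 * Real.pi) ≤
          (C1 * ((CV.card + 1) * D) + d' * (C1 * √(Eφ * (Eφ + Eψ)))) * (16 * Real.pi) := by
          gcongr
          linarith
      _ = _ := by ring

open Classical in
/-- The number of roots of `P` in `O`, counted with multiplicity. -/
noncomputable def rootCount (P : Polynomial ℂ) (O : Set ℂ) : ℕ := P.roots.countP (· ∈ O)

lemma rootCount_congr {P : Polynomial ℂ} {O O' : Set ℂ} (h : ∀ x ∈ P.roots, x ∈ O ↔ x ∈ O') :
    rootCount P O = rootCount P O' := by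
  classical
  exact Multiset.countP_congr rfl fun x hx => propext (h x hx)

lemma rootCount_add_compl (P : Polynomial ℂ) (O : Set ℂ) :
    rootCount P O + rootCount P Oᶜ = P.natDegree := by
  classical
  have h := Multiset.card_eq_countP_add_countP (· ∈ O) P.roots
  rw [IsAlgClosed.card_roots_eq_natDegree] at h
  rw [h]
  unfold rootCount
  congr

lemma exists_roots_fun {P : Polynomial ℂ} {n : ℕ} (hn : P.natDegree = n) :
    ∃ a : Fin n → ℂ, P.roots = Finset.univ.val.map a := by
  have hl : P.roots.toList.length = n := by
    rw [Multiset.length_toList, IsAlgClosed.card_roots_eq_natDegree, hn]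
  refine ⟨fun i => P.roots.toList.get (Fin.cast hl.symm i), ?_⟩
  subst hl
  rw [Fin.univ_val_map]
  have : (List.ofFn fun i => P.roots.toList.get (Fin.cast rfl i)) = P.roots.toList := by
    simpa using List.ofFn_getElem (xs := P.roots.toList)
  exact (this.symm ▸ (Multiset.coe_toList P.roots).symm :)

lemma natDegree_sub_C' {F : Polynomial ℂ} (c : ℂ) : (F - Polynomial.C c).natDegree = F.natDegree :=
  Polynomial.natDegree_sub_C

lemma sub_C_ne_zero {F : Polynomial ℂ} (hF : 0 < F.natDegree) (c : ℂ) :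
    F - Polynomial.C c ≠ 0 := by
  intro h
  have := Polynomial.natDegree_sub_C (p := F) (a := c)
  rw [h, Polynomial.natDegree_zero] at this
  omega

lemma leadingCoeff_sub_C' {F : Polynomial ℂ} (hF : 0 < F.natDegree) (c : ℂ) :
    (F - Polynomial.C c).leadingCoeff = F.leadingCoeff := by
  rw [Polynomial.leadingCoeff, Polynomial.natDegree_sub_C, Polynomial.coeff_sub,
    Polynomial.coeff_C_of_ne_zero hF.ne', sub_zero]
  rfl

/-- The number of roots in an open set is lower semicontinuous. -/
lemma eventually_rootCount_le {F : Polynomial ℂ} (hF : 0 < F.natDegree) {O : Set ℂ}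
    (hO : IsOpen O) (y : ℂ) : ∀ᶠ c in 𝓝 y,
      rootCount (F - Polynomial.C y) O ≤ rootCount (F - Polynomial.C c) O := by
  classical
  by_contra hcon
  obtain ⟨c, hc, hcO⟩ := exists_seq_forall_of_frequently (not_eventually.1 hcon)
  simp only [not_le] at hcO
  choose a ha using fun k => exists_roots_fun (natDegree_sub_C' (F := F) (c k))
  have hroot : ∀ k i, F.eval (a k i) = c k := by
    intro k i
    have h1 : a k i ∈ (F - Polynomial.C (c k)).roots := by
      rw [ha k]
      exact Multiset.mem_map_of_mem _ (Finset.mem_univ i)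
    have := (Polynomial.mem_roots'.1 h1).2
    simpa [Polynomial.IsRoot, sub_eq_zero] using this
  have hK : IsCompact (insert y (range c)) := hc.isCompact_insert_range
  have hK' := isCompact_preimage_eval hF hK
  have hmem : ∀ k, a k ∈ Set.pi univ fun _ : Fin F.natDegree =>
      {z : ℂ | F.eval z ∈ insert y (range c)} := by
    intro k i _
    rw [mem_ofPred_eq, hroot k i]
    exact mem_insert_of_mem _ (mem_range_self k)
  obtain ⟨r, -, s, hs, hr⟩ := (isCompact_univ_pi fun _ => hK').tendsto_subseq hmem
  have hprod : ∀ k z, F.eval z - c k = F.leadingCoeff * ∏ i, (z - a k i) := by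
    intro k z
    have h1 := (IsAlgClosed.splits (F - Polynomial.C (c k))).eq_prod_roots
    rw [ha k, leadingCoeff_sub_C' hF] at h1
    have h2 := congrArg (Polynomial.eval z) h1
    rw [Polynomial.eval_sub, Polynomial.eval_C] at h2
    rw [h2, Polynomial.eval_mul, Polynomial.eval_C, Multiset.map_map,
      Polynomial.eval_multiset_prod, Multiset.map_map]
    simp [Finset.prod]
  have hlim : F - Polynomial.C y =
      Polynomial.C F.leadingCoeff * ∏ i, (Polynomial.X - Polynomial.C (r i)) := by
    refine Polynomial.funext fun z => ?_
    have h1 : Tendsto (fun k => F.eval z - c (s k)) atTop (𝓝 (F.eval z - y)) :=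
      tendsto_const_nhds.sub (hc.comp hs.tendsto_atTop)
    have h2 : Tendsto (fun k => F.leadingCoeff * ∏ i, (z - a (s k) i)) atTop
        (𝓝 (F.leadingCoeff * ∏ i, (z - r i))) := by
      refine tendsto_const_nhds.mul (tendsto_finsetProd _ fun i _ => ?_)
      exact tendsto_const_nhds.sub ((tendsto_pi_nhds.1 hr) i)
    have h3 := tendsto_nhds_unique (h1.congr fun k => hprod (s k) z) h2
    simp only [Polynomial.eval_sub, Polynomial.eval_C, Polynomial.eval_mul,
      Polynomial.eval_prod, Polynomial.eval_X]
    exact h3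
  have hroots : (F - Polynomial.C y).roots = Finset.univ.val.map r := by
    rw [hlim, Polynomial.roots_C_mul _ (by
      rw [Ne, Polynomial.leadingCoeff_eq_zero]
      rintro rfl
      simp at hF)]
    have h := Polynomial.roots_multiset_prod_X_sub_C (Finset.univ.val.map r)
    rw [Multiset.map_map] at h
    exact h
  have hev : ∀ᶠ k in atTop, ∀ i, r i ∈ O → a (s k) i ∈ O := by
    rw [eventually_all]
    intro i
    by_cases hi : r i ∈ O
    · filter_upwards [((tendsto_pi_nhds.1 hr) i).eventually (hO.mem_nhds hi)] with k hk _
      exact hk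
    · exact Eventually.of_forall fun k h => absurd h hi
  obtain ⟨k, hk⟩ := hev.exists
  refine (hcO (s k)).not_ge ?_
  unfold rootCount
  rw [hroots, ha, Multiset.countP_map, Multiset.countP_map]
  refine Multiset.card_le_card (Multiset.monotone_filter_right _ fun i hi => hk i hi)

/-- The number of preimages in a component of `F⁻¹ V` is constant. -/
lemma rootCount_const {F : Polynomial ℂ} (hF : 0 < F.natDegree) {V : Set ℂ} (hV : IsOpen V)
    (hVc : IsPreconnected V) (z : ℂ) {y y' : ℂ} (hy : y ∈ V) (hy' : y' ∈ V) :
    rootCount (F - Polynomial.C y) (connectedComponentIn ((fun w => F.eval w) ⁻¹' V) z) =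
      rootCount (F - Polynomial.C y') (connectedComponentIn ((fun w => F.eval w) ⁻¹' V) z) := by
  classical
  set S := (fun w => F.eval w) ⁻¹' V with hS
  set U := connectedComponentIn S z
  set U' := {w | w ∈ S ∧ w ∉ U} with hU'
  have hSo : IsOpen S := hV.preimage F.continuous
  have hU'o : IsOpen U' := isOpen_diff_connectedComponentIn hSo z
  have hsum : ∀ c ∈ V, rootCount (F - Polynomial.C c) U + rootCount (F - Polynomial.C c) U' =
      F.natDegree := by
    intro c hc
    rw [← natDegree_sub_C' (F := F) c, ← rootCount_add_compl _ U]
    congr 1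
    refine rootCount_congr fun x hx => ?_
    have : F.eval x = c := by
      have := (Polynomial.mem_roots'.1 hx).2
      simpa [Polynomial.IsRoot, sub_eq_zero] using this
    have hxS : x ∈ S := by rw [hS, mem_preimage, this]; exact hc
    simp [hU', hxS]
  refine hVc.constant (f := fun c => rootCount (F - Polynomial.C c) U) ?_ hy hy'
  intro c hc
  refine ContinuousAt.continuousWithinAt ?_
  refine (tendsto_pure.2 ?_).mono_right (pure_le_nhds _)
  filter_upwards [eventually_rootCount_le hF hSo.connectedComponentIn c,
    eventually_rootCount_le hF hU'o c, hV.mem_nhds hc] with x h1 h2 hxV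
  have h3 := hsum c hc
  have h4 := hsum x hxV
  have h1' : rootCount (F - Polynomial.C c) U ≤ rootCount (F - Polynomial.C x) U := h1
  omega

/-- The span of the differences of the basis vectors indexed by a finite set. -/
noncomputable def diffSpan (S : Finset ℂ) : Submodule ℚ (ℂ →₀ ℚ) :=
  Submodule.span ℚ {v | ∃ a ∈ S, ∃ b ∈ S, v = Finsupp.single a 1 - Finsupp.single b 1}

lemma sub_mem_diffSpan {S : Finset ℂ} {a b : ℂ} (ha : a ∈ S) (hb : b ∈ S) :
    Finsupp.single a (1 : ℚ) - Finsupp.single b 1 ∈ diffSpan S :=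
  Submodule.subset_span ⟨a, ha, b, hb, rfl⟩

lemma diffSpan_le_span {S : Finset ℂ} {a : ℂ} (ha : a ∈ S) :
    diffSpan S ≤ Submodule.span ℚ
      (((S.erase a).image fun b => Finsupp.single b (1 : ℚ) - Finsupp.single a 1 :
        Finset (ℂ →₀ ℚ)) : Set (ℂ →₀ ℚ)) := by
  have key : ∀ b ∈ S, Finsupp.single b (1 : ℚ) - Finsupp.single a 1 ∈ Submodule.span ℚ
      (((S.erase a).image fun b => Finsupp.single b (1 : ℚ) - Finsupp.single a 1 :
        Finset (ℂ →₀ ℚ)) : Set (ℂ →₀ ℚ)) := by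
    intro b hb
    by_cases hba : b = a
    · subst hba
      rw [sub_self]
      exact Submodule.zero_mem _
    · exact Submodule.subset_span (Finset.mem_coe.2
        (Finset.mem_image_of_mem _ (Finset.mem_erase.2 ⟨hba, hb⟩)))
  refine Submodule.span_le.2 ?_
  rintro v ⟨b, hb, c, hc, rfl⟩
  have := Submodule.sub_mem _ (key b hb) (key c hc)
  simpa using this

instance (S : Finset ℂ) : FiniteDimensional ℚ (diffSpan S) := by
  rcases S.eq_empty_or_nonempty with rfl | ⟨a, ha⟩
  · have : diffSpan ∅ = ⊥ := by
      rw [eq_bot_iff]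
      refine Submodule.span_le.2 ?_
      rintro v ⟨b, hb, -⟩
      simp at hb
    rw [this]
    infer_instance
  · exact Submodule.finiteDimensional_of_le (diffSpan_le_span ha)

lemma finrank_diffSpan_le (S : Finset ℂ) : Module.finrank ℚ (diffSpan S) ≤ S.card - 1 := by
  rcases S.eq_empty_or_nonempty with rfl | ⟨a, ha⟩
  · have : diffSpan ∅ = ⊥ := by
      rw [eq_bot_iff]
      refine Submodule.span_le.2 ?_
      rintro v ⟨b, hb, -⟩
      simp at hb
    rw [this]
    simp
  · refine (Submodule.finrank_mono (diffSpan_le_span ha)).trans ?_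
    refine (finrank_span_finset_le_card _).trans ?_
    refine Finset.card_image_le.trans ?_
    rw [Finset.card_erase_of_mem ha]

lemma card_le_finrank_diffSpan (S : Finset ℂ) :
    S.card ≤ Module.finrank ℚ (diffSpan S) + 1 := by
  rcases S.eq_empty_or_nonempty with rfl | ⟨a, ha⟩
  · simp
  have hli : LinearIndependent ℚ (fun z : ℂ => Finsupp.single z (1 : ℚ)) := 
    Finsupp.linearIndependent_single_one ℚ ℂ
  have hli' := hli.comp (fun z : S => (z : ℂ)) Subtype.val_injective
  have h1 := finrank_span_eq_card hli'
  rw [Fintype.card_coe] at h1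
  rw [← h1]
  have hle : Submodule.span ℚ (range ((fun z : ℂ => Finsupp.single z (1 : ℚ)) ∘
      fun z : S => (z : ℂ))) ≤ diffSpan S ⊔ Submodule.span ℚ {Finsupp.single a (1 : ℚ)} := by
    refine Submodule.span_le.2 ?_
    rintro _ ⟨z, rfl⟩
    refine Submodule.mem_sup.2 ⟨_, sub_mem_diffSpan z.2 ha, _,
      Submodule.mem_span_singleton_self _, ?_⟩
    simp
  refine (Submodule.finrank_mono hle).trans ?_
  refine (Submodule.finrank_add_le_finrank_add_finrank _ _).trans ?_
  rw [finrank_span_singleton (by simp)]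

lemma finrank_iSup_diffSpan_le (T : Finset ℂ) (R : ℂ → Finset ℂ) :
    Module.finrank ℚ (⨆ p ∈ T, diffSpan (R p) : Submodule ℚ (ℂ →₀ ℚ)) ≤
      ∑ p ∈ T, ((R p).card - 1) := by
  classical
  induction T using Finset.induction_on with
  | empty =>
    have : (⨆ p ∈ (∅ : Finset ℂ), diffSpan (R p)) = ⊥ := by simp
    rw [this]
    simp
  | insert p T hp ih =>
    rw [Finset.iSup_insert, Finset.sum_insert hp]
    have : FiniteDimensional ℚ (⨆ p ∈ T, diffSpan (R p) : Submodule ℚ (ℂ →₀ ℚ)) := by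
      rw [← Finset.sup_eq_iSup]
      infer_instance
    refine (Submodule.finrank_add_le_finrank_add_finrank _ _).trans ?_
    exact Nat.add_le_add (finrank_diffSpan_le _) ih

/-- The component of `z` in the open sublevel set `{|H| < s}`. -/
def lowComp (H : Polynomial ℂ) (s : ℝ) (z : ℂ) : Set ℂ :=
  connectedComponentIn ((fun w => H.eval w) ⁻¹' ball 0 s) z

lemma mem_sublevel {H : Polynomial ℂ} {s : ℝ} {z : ℂ} :
    z ∈ (fun w => H.eval w) ⁻¹' ball 0 s ↔ ‖H.eval z‖ < s := by
  simp

lemma isOpen_sublevel (H : Polynomial ℂ) (s : ℝ) :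
    IsOpen ((fun w => H.eval w) ⁻¹' ball (0 : ℂ) s) :=
  isOpen_ball.preimage H.continuous

lemma isOpen_lowComp (H : Polynomial ℂ) (s : ℝ) (z : ℂ) : IsOpen (lowComp H s z) :=
  (isOpen_sublevel H s).connectedComponentIn

lemma mem_lowComp {H : Polynomial ℂ} {s : ℝ} {z : ℂ} (h : ‖H.eval z‖ < s) : z ∈ lowComp H s z :=
  mem_connectedComponentIn (mem_sublevel.2 h)

lemma lt_of_mem_lowComp {H : Polynomial ℂ} {s : ℝ} {z w : ℂ} (h : w ∈ lowComp H s z) :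
    ‖H.eval w‖ < s :=
  mem_sublevel.1 (connectedComponentIn_subset _ _ h)

lemma lowComp_eq {H : Polynomial ℂ} {s : ℝ} {z w : ℂ} (h : w ∈ lowComp H s z) :
    lowComp H s z = lowComp H s w :=
  connectedComponentIn_eq h

lemma isPreconnected_lowComp (H : Polynomial ℂ) (s : ℝ) (z : ℂ) :
    IsPreconnected (lowComp H s z) :=
  isPreconnected_connectedComponentIn

lemma mem_zeros {H : Polynomial ℂ} (hH : 0 < H.natDegree) {z : ℂ} :
    z ∈ H.roots.toFinset ↔ H.eval z = 0 := by
  have : H ≠ 0 := by rintro rfl; simp at hH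
  simp [this]

lemma exists_zero_mem_lowComp {H : Polynomial ℂ} (hH : 0 < H.natDegree) {s : ℝ} {z : ℂ}
    (h : ‖H.eval z‖ < s) : ∃ a ∈ H.roots.toFinset, a ∈ lowComp H s z := by
  have h1 := image_connectedComponentIn hH isOpen_ball
    (convex_ball (0 : ℂ) s).isPreconnected (mem_sublevel.2 h)
  have h2 : (0 : ℂ) ∈ ball (0 : ℂ) s := mem_ball_self ((norm_nonneg _).trans_lt h)
  rw [← h1] at h2
  obtain ⟨a, ha, ha0⟩ := h2
  exact ⟨a, (mem_zeros hH).2 ha0, ha⟩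

open Classical in
/-- A distinguished zero of `H` in a set containing one. -/
noncomputable def repZero (H : Polynomial ℂ) (Ω : Set ℂ) : ℂ :=
  if h : ∃ a ∈ H.roots.toFinset, a ∈ Ω then h.choose else 0

lemma repZero_spec {H : Polynomial ℂ} {Ω : Set ℂ} (h : ∃ a ∈ H.roots.toFinset, a ∈ Ω) :
    repZero H Ω ∈ H.roots.toFinset ∧ repZero H Ω ∈ Ω := by
  unfold repZero
  rw [dif_pos h]
  exact h.choose_spec

open Classical in
/-- Distinguished zeros in the components of `{|H| < |H p|}` having `p` on their boundary. -/
noncomputable def adjZeros (H : Polynomial ℂ) (p : ℂ) : Finset ℂ :=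
  H.roots.toFinset.filter fun z =>
    p ∈ closure (lowComp H ‖H.eval p‖ z) ∧ z = repZero H (lowComp H ‖H.eval p‖ z)

lemma exists_small_component {H : Polynomial ℂ} (hH : 0 < H.natDegree) (p : ℂ) :
    ∃ η > 0, ∀ z ∈ connectedComponentIn ((fun w => H.eval w) ⁻¹' ball (H.eval p) η) p,
      H.eval z = H.eval p → z = p := by
  have hP0 := sub_C_ne_zero hH (H.eval p)
  set T : Finset ℂ := (H - Polynomial.C (H.eval p)).roots.toFinset.erase p with hT
  have hTc : IsClosed (T : Set ℂ) := T.finite_toSet.isClosed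
  have hpT : p ∈ (T : Set ℂ)ᶜ := by simp [hT]
  obtain ⟨ε, hε, hεT⟩ := Metric.isOpen_iff.1 hTc.isOpen_compl p hpT
  have hiso : ∀ z ∈ ball p ε, H.eval z = H.eval p → z = p := by
    intro z hz hzp
    by_contra hne
    refine hεT hz ?_
    rw [Finset.mem_coe, hT, Finset.mem_erase, Multiset.mem_toFinset, Polynomial.mem_roots hP0]
    exact ⟨hne, by simp [hzp]⟩
  have hS : IsCompact (sphere p (ε / 2)) := isCompact_sphere _ _
  have hSne : (sphere p (ε / 2)).Nonempty := NormedSpace.sphere_nonempty.2 (by positivity)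
  obtain ⟨q, hq, hmin⟩ := hS.exists_isMinOn hSne
    (f := fun z => dist (H.eval z) (H.eval p)) (by fun_prop)
  have hqpos : 0 < dist (H.eval q) (H.eval p) := by
    rw [dist_pos]
    intro h
    have := hiso q (by rw [mem_ball, mem_sphere.1 hq]; linarith) h
    rw [this, mem_sphere, dist_self] at hq
    linarith
  refine ⟨_, hqpos, fun z hz hzp => hiso z ?_ hzp⟩
  have hpc := isPreconnected_connectedComponentIn
    (F := (fun w => H.eval w) ⁻¹' ball (H.eval p) (dist (H.eval q) (H.eval p))) (x := p)
  by_contra hzε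
  have hp : p ∈ connectedComponentIn
      ((fun w => H.eval w) ⁻¹' ball (H.eval p) (dist (H.eval q) (H.eval p))) p :=
    mem_connectedComponentIn (mem_ball_self hqpos)
  obtain ⟨w, hw, hws⟩ := hpc.intermediate_value hp hz
    (f := fun z => dist z p) (by fun_prop)
    (show ε / 2 ∈ Icc _ _ from ⟨by rw [dist_self]; positivity, by
      rw [mem_ball, not_lt] at hzε; linarith⟩)
  have h1 : dist (H.eval w) (H.eval p) < dist (H.eval q) (H.eval p) :=
    (connectedComponentIn_subset _ _ hw :
      w ∈ (fun w => H.eval w) ⁻¹' ball (H.eval p) (dist (H.eval q) (H.eval p)))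
  exact (hmin (mem_sphere.2 hws)).not_gt h1

lemma rootMultiplicity_sub_C {H : Polynomial ℂ} (hH : 0 < H.natDegree) (p : ℂ) :
    (H - Polynomial.C (H.eval p)).rootMultiplicity p = H.derivative.rootMultiplicity p + 1 := by
  have hr : (H - Polynomial.C (H.eval p)).IsRoot p := by simp
  have h1 := Polynomial.derivative_rootMultiplicity_of_root hr
  have h2 := (Polynomial.rootMultiplicity_pos (sub_C_ne_zero hH (H.eval p))).2 hr
  rw [Polynomial.derivative_sub, Polynomial.derivative_C, sub_zero] at h1
  omega

lemma card_adjZeros_le {H : Polynomial ℂ} (hH : 0 < H.natDegree) {p : ℂ} (hp : H.eval p ≠ 0) :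
    (adjZeros H p).card ≤ H.derivative.rootMultiplicity p + 1 := by
  classical
  rw [← rootMultiplicity_sub_C hH]
  obtain ⟨η, hη, hiso⟩ := exists_small_component hH p
  set s := ‖H.eval p‖ with hs
  have hs0 : 0 < s := norm_pos_iff.2 hp
  set O := connectedComponentIn ((fun w => H.eval w) ⁻¹' ball (H.eval p) η) p with hO
  have hpO : p ∈ O := mem_connectedComponentIn (mem_ball_self hη)
  have hOo : IsOpen O := (isOpen_ball.preimage H.continuous).connectedComponentIn
  have hcl : H.eval p ∈ closure (ball (0 : ℂ) s) := by
    rw [closure_ball _ hs0.ne']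
    simp [hs]
  obtain ⟨c, hcη, hcs⟩ := mem_closure_iff.1 hcl _ isOpen_ball (mem_ball_self hη)
  have hcount : rootCount (H - Polynomial.C c) O =
      (H - Polynomial.C (H.eval p)).rootMultiplicity p := by
    rw [rootCount_const hH isOpen_ball (convex_ball (H.eval p) η).isPreconnected p hcη
      (mem_ball_self hη), ← Polynomial.count_roots, rootCount, Multiset.count]
    refine Multiset.countP_congr rfl fun x hx => propext ⟨fun h => ?_, fun h => ?_⟩
    · refine (hiso x h ?_).symm
      have := (Polynomial.mem_roots'.1 hx).2
      simpa [Polynomial.IsRoot, sub_eq_zero] using this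
    · exact h ▸ hpO
  rw [← hcount]
  have hex : ∀ z ∈ adjZeros H p, ∃ x ∈ O, x ∈ lowComp H s z ∧ H.eval x = c := by
    intro z hz
    obtain ⟨-, hcz, -⟩ := Finset.mem_filter.1 hz
    obtain ⟨a, haO, haz⟩ := mem_closure_iff.1 hcz O hOo hpO
    have haη : H.eval a ∈ ball (H.eval p) η :=
      (connectedComponentIn_subset _ _ haO : a ∈ (fun w => H.eval w) ⁻¹' ball (H.eval p) η)
    have has : H.eval a ∈ ball (0 : ℂ) s := mem_sublevel.2 (lt_of_mem_lowComp haz)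
    have him := image_connectedComponentIn hH (isOpen_ball.inter isOpen_ball)
      ((convex_ball (H.eval p) η).inter (convex_ball 0 s)).isPreconnected (z := a) ⟨haη, has⟩
    have hcm : c ∈ ball (H.eval p) η ∩ ball 0 s := ⟨hcη, hcs⟩
    rw [← him] at hcm
    obtain ⟨x, hx, hxc⟩ := hcm
    refine ⟨x, ?_, ?_, hxc⟩
    · rw [hO, connectedComponentIn_eq haO]
      exact connectedComponentIn_mono _ (preimage_mono inter_subset_left) hx
    · rw [lowComp_eq haz]
      exact connectedComponentIn_mono _ (preimage_mono inter_subset_right) hx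
  choose! g hgO hgz hgc using hex
  have hinj : Set.InjOn g (adjZeros H p) := by
    intro z hz z' hz' h
    have h1 := hgz z hz
    rw [h] at h1
    have h2 := (lowComp_eq h1).trans (lowComp_eq (hgz z' hz')).symm
    rw [(Finset.mem_filter.1 hz).2.2, (Finset.mem_filter.1 hz').2.2, ← hs, h2]
  rw [← Finset.card_image_of_injOn hinj, rootCount, Multiset.countP_eq_card_filter]
  refine (Finset.card_le_card (t := (Multiset.filter (· ∈ O)
    (H - Polynomial.C c).roots).toFinset) ?_).trans (Multiset.toFinset_card_le _)
  intro x hx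
  obtain ⟨z, hz, rfl⟩ := Finset.mem_image.1 hx
  rw [Multiset.mem_toFinset, Multiset.mem_filter, Polynomial.mem_roots (sub_C_ne_zero hH c)]
  exact ⟨by simp [hgc z hz], hgO z hz⟩

lemma isPreconnected_iInter_of_antitone {Q : ℕ → Set ℂ} (hQ : Antitone Q)
    (hc : ∀ n, IsCompact (Q n)) (hp : ∀ n, IsPreconnected (Q n)) :
    IsPreconnected (⋂ n, Q n) := by
  have hI : IsCompact (⋂ n, Q n) :=
    (hc 0).of_isClosed_subset (isClosed_iInter fun n => (hc n).isClosed) (iInter_subset _ 0)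
  rw [isPreconnected_iff_subset_of_disjoint_closed]
  intro u v hu hv huv hd
  have hsep : SeparatedNhds ((⋂ n, Q n) ∩ u) ((⋂ n, Q n) ∩ v) := by
    refine SeparatedNhds.of_isCompact_isCompact (hI.inter_right hu) (hI.inter_right hv) ?_
    rw [Set.disjoint_iff_inter_eq_empty, ← hd]
    ext x
    simp only [mem_inter_iff]
    tauto
  obtain ⟨U, V, hU, hV, hUu, hVv, hUV⟩ := hsep
  have hsub : (⋂ n, Q n) ⊆ U ∪ V := fun x hx => by
    rcases huv hx with h | h
    · exact Or.inl (hUu ⟨hx, h⟩)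
    · exact Or.inr (hVv ⟨hx, h⟩)
  obtain ⟨n, hn⟩ := exists_subset_nhds_of_isCompact (hQ.directed_ge) hc
    (fun x hx => (hU.union hV).mem_nhds (hsub hx))
  rcases (hp n).subset_or_subset hU hV hUV hn with h | h
  · left
    intro x hx
    rcases huv hx with h' | h'
    · exact h'
    · exact absurd (hVv ⟨hx, h'⟩) (Set.disjoint_left.1 hUV (h (mem_iInter.1 hx n)))
  · right
    intro x hx
    rcases huv hx with h' | h'
    · exact absurd (h (mem_iInter.1 hx n)) (Set.disjoint_left.1 hUV (hUu ⟨hx, h'⟩))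
    · exact h'

lemma lowComp_mono {H : Polynomial ℂ} {s t : ℝ} (h : s ≤ t) (z : ℂ) :
    lowComp H s z ⊆ lowComp H t z :=
  connectedComponentIn_mono _ (preimage_mono (ball_subset_ball h))

lemma exists_lt_mem_lowComp {H : Polynomial ℂ} {s : ℝ} {z z' : ℂ} (h : z' ∈ lowComp H s z) :
    ∃ t < s, z' ∈ lowComp H t z := by
  have hz : z ∈ lowComp H s z := by
    refine mem_connectedComponentIn ?_
    by_contra hcon
    rw [lowComp, connectedComponentIn_eq_empty hcon] at h
    exact h
  have hconn : IsConnected (lowComp H s z) := ⟨⟨z, hz⟩, isPreconnected_lowComp H s z⟩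
  have hpc := (isOpen_lowComp H s z).isConnected_iff_isPathConnected.1 hconn
  obtain ⟨γ, hγ⟩ := hpc.joinedIn z hz z' h
  obtain ⟨τ, -, hτ⟩ := isCompact_univ.exists_isMaxOn univ_nonempty
    (f := fun τ => ‖H.eval (γ τ)‖) (by
      have := H.continuous
      fun_prop)
  obtain ⟨t, ht1, ht2⟩ := exists_between (lt_of_mem_lowComp (hγ τ))
  refine ⟨t, ht2, ?_⟩
  have hr : IsPreconnected (range γ) := isPreconnected_range γ.continuous
  refine hr.subset_connectedComponentIn ⟨0, γ.source⟩ ?_ ⟨1, γ.target⟩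
  rintro _ ⟨σ, rfl⟩
  exact mem_sublevel.2 ((hτ (mem_univ σ)).trans_lt ht1)

lemma isCompact_sublevel {H : Polynomial ℂ} (hH : 0 < H.natDegree) (s : ℝ) :
    IsCompact {z | ‖H.eval z‖ ≤ s} := by
  have := isCompact_preimage_eval hH (isCompact_closedBall (0 : ℂ) s)
  refine this.of_isClosed_subset (isClosed_le H.continuous.norm continuous_const) fun z hz => ?_
  simpa using hz

lemma closure_lowComp_subset {H : Polynomial ℂ} (s : ℝ) (z : ℂ) :
    closure (lowComp H s z) ⊆ {w | ‖H.eval w‖ ≤ s} := by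
  refine closure_minimal (fun w hw => (lt_of_mem_lowComp hw).le) ?_
  exact isClosed_le (H.continuous.norm) continuous_const

lemma mem_closed_component {H : Polynomial ℂ} (hH : 0 < H.natDegree) {s : ℝ} {z z' : ℂ}
    (hz : ‖H.eval z‖ ≤ s) (h : ∀ t > s, z' ∈ lowComp H t z) :
    z' ∈ connectedComponentIn {w | ‖H.eval w‖ ≤ s} z := by
  set Q : ℕ → Set ℂ := fun n => closure (lowComp H (s + 1 / (n + 1)) z) with hQ
  have hpos : ∀ n : ℕ, (0 : ℝ) < 1 / (n + 1) := fun n => by positivity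
  have hanti : Antitone Q := by
    intro m n hmn
    refine closure_mono (lowComp_mono ?_ z)
    have : (1 : ℝ) / (n + 1) ≤ 1 / (m + 1) := by
      have : (m : ℝ) ≤ n := by exact_mod_cast hmn
      gcongr
    linarith
  have hpre := isPreconnected_iInter_of_antitone hanti
    (fun n => (isCompact_sublevel hH _).of_isClosed_subset isClosed_closure
      (closure_lowComp_subset _ z))
    (fun n => (isPreconnected_lowComp H _ z).closure)
  refine hpre.subset_connectedComponentIn ?_ ?_ ?_
  · exact mem_iInter.2 fun n => subset_closure (mem_lowComp (by linarith [hpos n]))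
  · intro w hw
    have h1 : ∀ n : ℕ, ‖H.eval w‖ ≤ s + 1 / (n + 1) := fun n =>
      closure_lowComp_subset _ z (mem_iInter.1 hw n)
    have h2 : Tendsto (fun n : ℕ => s + 1 / ((n : ℝ) + 1)) atTop (𝓝 (s + 0)) :=
      tendsto_const_nhds.add tendsto_one_div_add_atTop_nhds_zero_nat
    rw [add_zero] at h2
    exact ge_of_tendsto' h2 h1
  · exact mem_iInter.2 fun n => subset_closure (h _ (by linarith [hpos n]))

lemma mem_closure_lowComp_of_le {H : Polynomial ℂ} (hH : 0 < H.natDegree) {s : ℝ} (hs : 0 < s)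
    {w : ℂ} (hw : ‖H.eval w‖ ≤ s) :
    ∃ a ∈ H.roots.toFinset, w ∈ closure (lowComp H s a) := by
  have h1 : w ∈ closure (⋃ a ∈ H.roots.toFinset, lowComp H s a) := by
    rw [_root_.mem_closure_iff]
    intro o ho hwo
    have ho' := isOpenMap_eval hH o ho
    have hcl : H.eval w ∈ closure (ball (0 : ℂ) s) := by
      rw [closure_ball _ hs.ne']
      simpa using hw
    obtain ⟨_, ⟨v, hv, rfl⟩, hvs⟩ := mem_closure_iff.1 hcl _ ho' ⟨w, hwo, rfl⟩
    have hvs' : ‖H.eval v‖ < s := mem_sublevel.1 hvs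
    obtain ⟨a, ha, hav⟩ := exists_zero_mem_lowComp hH hvs'
    refine ⟨v, hv, mem_iUnion₂.2 ⟨a, ha, ?_⟩⟩
    rw [← lowComp_eq hav]
    exact mem_lowComp hvs'
  rw [Finset.closure_biUnion] at h1
  simpa using h1

open Classical in
/-- The critical points of `H` in `W` which are not zeros of `H`. -/
noncomputable def critIn (H : Polynomial ℂ) (W : Set ℂ) : Finset ℂ :=
  H.derivative.roots.toFinset.filter fun p => H.eval p ≠ 0 ∧ p ∈ W

open Classical in
/-- The zeros of `H` in `W`. -/
noncomputable def zerosIn (H : Polynomial ℂ) (W : Set ℂ) : Finset ℂ :=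
  H.roots.toFinset.filter fun p => p ∈ W

/-- The differences of zeros of `H` generated by the critical points in `W`. -/
noncomputable def critSpan (H : Polynomial ℂ) (W : Set ℂ) : Submodule ℚ (ℂ →₀ ℚ) :=
  ⨆ p ∈ critIn H W, diffSpan (adjZeros H p)

lemma critSpan_mono {H : Polynomial ℂ} {W W' : Set ℂ} (h : W ⊆ W') :
    critSpan H W ≤ critSpan H W' := by
  classical
  refine biSup_mono fun p hp => ?_
  simp only [critIn, Finset.mem_filter] at hp ⊢
  exact ⟨hp.1, hp.2.1, h hp.2.2⟩

lemma single_sub_mem_critSpan {H : Polynomial ℂ} (hH : 0 < H.natDegree) {W : Set ℂ} {p a b : ℂ}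
    (hp0 : H.eval p ≠ 0) (hpW : p ∈ W) (ha : a ∈ adjZeros H p) (hb : b ∈ adjZeros H p) :
    Finsupp.single a (1 : ℚ) - Finsupp.single b 1 ∈ critSpan H W := by
  classical
  by_cases hab : a = b
  · rw [hab, sub_self]
    exact Submodule.zero_mem _
  have h1 : 1 < (adjZeros H p).card := Finset.one_lt_card.2 ⟨a, ha, b, hb, hab⟩
  have h2 := card_adjZeros_le hH hp0
  have h3 : 0 < H.derivative.rootMultiplicity p := by omega
  have h4 : p ∈ critIn H W := by
    rw [critIn, Finset.mem_filter, Multiset.mem_toFinset]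
    refine ⟨?_, hp0, hpW⟩
    rw [← Multiset.count_pos, Polynomial.count_roots]
    exact h3
  exact (le_biSup (fun p => diffSpan (adjZeros H p)) h4) (sub_mem_diffSpan ha hb)

lemma mem_lowComp_of_mem_closure {H : Polynomial ℂ} {s t : ℝ} (hst : s < t) {a w z : ℂ}
    (ha : ‖H.eval a‖ < s) (h : w ∈ closure (lowComp H s a)) (hw : w ∈ lowComp H t z) :
    a ∈ lowComp H t z := by
  rw [lowComp_eq hw]
  refine (isPreconnected_lowComp H s a).closure.subset_connectedComponentIn h ?_
    (subset_closure (mem_lowComp ha))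
  intro v hv
  exact mem_sublevel.2 ((closure_lowComp_subset s a hv).trans_lt hst)

lemma lowComp_subset_of_mem {H : Polynomial ℂ} {s t : ℝ} (hst : s ≤ t) {a z : ℂ}
    (ha : a ∈ lowComp H t z) : lowComp H s a ⊆ lowComp H t z := by
  rw [lowComp_eq ha]
  exact lowComp_mono hst a

/-- Zeros in a common component of `{|H| < s}` are linked through the critical points there. -/
lemma zero_sub_mem_critSpan {H : Polynomial ℂ} (hH : 0 < H.natDegree) (n : ℕ) :
    ∀ s z₀, (zerosIn H (lowComp H s z₀)).card ≤ n → ∀ z ∈ zerosIn H (lowComp H s z₀),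
      ∀ z' ∈ zerosIn H (lowComp H s z₀),
      Finsupp.single z (1 : ℚ) - Finsupp.single z' 1 ∈ critSpan H (lowComp H s z₀) := by
  classical
  induction n with
  | zero =>
    intro s z₀ hc z hz
    rw [Nat.le_zero, Finset.card_eq_zero] at hc
    rw [hc] at hz
    simp at hz
  | succ n ih =>
    intro s z₀ hc z hz z' hz'
    set W := lowComp H s z₀ with hW
    obtain ⟨hz1, hzW⟩ := Finset.mem_filter.1 hz
    obtain ⟨hz1', hzW'⟩ := Finset.mem_filter.1 hz'
    have hz0 := (mem_zeros hH).1 hz1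
    by_cases hzz : z = z'
    · rw [hzz, sub_self]
      exact Submodule.zero_mem _
    have hWz : W = lowComp H s z := lowComp_eq hzW
    -- the merging level
    set T : Set ℝ := {t | z' ∈ lowComp H t z} with hT
    have hTs : s ∈ T := by rw [hWz] at hzW'; exact hzW'
    have hTpos : ∀ t ∈ T, 0 < t := fun t ht => (norm_nonneg _).trans_lt (lt_of_mem_lowComp ht)
    have hTbdd : BddBelow T := ⟨0, fun t ht => (hTpos t ht).le⟩
    set s' := sInf T with hs'
    have hs'0 : 0 ≤ s' := le_csInf ⟨s, hTs⟩ fun t ht => (hTpos t ht).le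
    have hs'T : s' ∉ T := by
      intro h
      obtain ⟨t, hts, ht⟩ := exists_lt_mem_lowComp h
      exact (csInf_le hTbdd ht).not_gt hts
    have hs's : s' < s := lt_of_le_of_ne (csInf_le hTbdd hTs) (fun h => hs'T (h ▸ hTs))
    have hmerge : ∀ t > s', z' ∈ lowComp H t z := by
      intro t ht
      obtain ⟨r, hr, hrt⟩ := exists_lt_of_csInf_lt ⟨s, hTs⟩ ht
      exact lowComp_mono hrt.le z hr
    have hE := mem_closed_component hH (s := s') (by rw [hz0, norm_zero]; exact hs'0) hmerge
    set E := connectedComponentIn {w | ‖H.eval w‖ ≤ s'} z with hEdef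
    have hEle : ∀ w ∈ E, ‖H.eval w‖ ≤ s' := fun w hw =>
      (connectedComponentIn_subset _ _ hw : w ∈ {w | ‖H.eval w‖ ≤ s'})
    have hEpre : IsPreconnected E := isPreconnected_connectedComponentIn
    have hzE : z ∈ E := mem_connectedComponentIn (by
      change ‖H.eval z‖ ≤ s'
      rw [hz0, norm_zero]; exact hs'0)
    have hEW : E ⊆ W := by
      rw [hWz]
      exact hEpre.subset_connectedComponentIn hzE fun w hw =>
        mem_sublevel.2 ((hEle w hw).trans_lt hs's)
    have hs'pos : 0 < s' := by
      rcases hs'0.lt_or_eq with h | h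
      · exact h
      · exfalso
        have hfin : E.Finite := by
          refine (H.roots.toFinset.finite_toSet).subset fun w hw => ?_
          have := hEle w hw
          rw [← h] at this
          exact Finset.mem_coe.2 ((mem_zeros hH).2 (norm_le_zero_iff.1 this))
        exact hEpre.infinite_of_nontrivial ⟨z, hzE, z', hE, hzz⟩ hfin
    -- the induction hypothesis for the components below the merging level
    have hih : ∀ a ∈ W, ‖H.eval a‖ < s' → ∀ b ∈ zerosIn H (lowComp H s' a),
        ∀ b' ∈ zerosIn H (lowComp H s' a),
        Finsupp.single b (1 : ℚ) - Finsupp.single b' 1 ∈ critSpan H W := by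
      intro a haW has b hb b' hb'
      have hsub : lowComp H s' a ⊆ W := lowComp_subset_of_mem hs's.le haW
      refine critSpan_mono hsub (ih s' a ?_ b hb b' hb')
      have hss : zerosIn H (lowComp H s' a) ⊂ zerosIn H W := by
        refine Finset.ssubset_iff_subset_ne.2 ⟨fun x hx => ?_, fun heq => ?_⟩
        · obtain ⟨h1, h2⟩ := Finset.mem_filter.1 hx
          exact Finset.mem_filter.2 ⟨h1, hsub h2⟩
        · have h1 := hz
          have h2 := hz'
          rw [← heq] at h1 h2
          have h3 := (Finset.mem_filter.1 h1).2
          have h4 := (Finset.mem_filter.1 h2).2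
          rw [lowComp_eq h3] at h4
          exact hs'T h4
      have := Finset.card_lt_card hss
      omega
    by_contra hcon
    set good : Finset ℂ := (zerosIn H W).filter fun a =>
      Finsupp.single z (1 : ℚ) - Finsupp.single a 1 ∈ critSpan H W with hgood
    set bad : Finset ℂ := (zerosIn H W).filter fun a =>
      Finsupp.single z (1 : ℚ) - Finsupp.single a 1 ∉ critSpan H W with hbad
    have hcover : E ⊆ (⋃ a ∈ good, closure (lowComp H s' a)) ∪
        ⋃ a ∈ bad, closure (lowComp H s' a) := by
      intro w hw
      obtain ⟨a, ha, haw⟩ := mem_closure_lowComp_of_le hH hs'pos (hEle w hw)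
      have ha0 : ‖H.eval a‖ < s' := by rw [(mem_zeros hH).1 ha, norm_zero]; exact hs'pos
      have haW : a ∈ zerosIn H W :=
        Finset.mem_filter.2 ⟨ha, mem_lowComp_of_mem_closure hs's ha0 haw (hEW hw)⟩
      by_cases hg : Finsupp.single z (1 : ℚ) - Finsupp.single a 1 ∈ critSpan H W
      · exact Or.inl (mem_iUnion₂.2 ⟨a, Finset.mem_filter.2 ⟨haW, hg⟩, haw⟩)
      · exact Or.inr (mem_iUnion₂.2 ⟨a, Finset.mem_filter.2 ⟨haW, hg⟩, haw⟩)
    have hclosed : ∀ S : Finset ℂ, IsClosed (⋃ a ∈ S, closure (lowComp H s' a)) := fun S =>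
      isClosed_biUnion_finset fun a _ => isClosed_closure
    have hz00 : ∀ a ∈ H.roots.toFinset, ‖H.eval a‖ < s' := fun a ha => by
      rw [(mem_zeros hH).1 ha, norm_zero]; exact hs'pos
    have hzgood : z ∈ good := Finset.mem_filter.2 ⟨hz, by
      rw [sub_self]; exact Submodule.zero_mem _⟩
    have hzbad : z' ∈ bad := Finset.mem_filter.2 ⟨hz', hcon⟩
    obtain ⟨p, hpE, hpg, hpb⟩ := isPreconnected_closed_iff.1 hEpre _ _ (hclosed good)
      (hclosed bad) hcover
      ⟨z, hzE, mem_iUnion₂.2 ⟨z, hzgood, subset_closure (mem_lowComp (hz00 z hz1))⟩⟩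
      ⟨z', hE, mem_iUnion₂.2 ⟨z', hzbad, subset_closure (mem_lowComp (hz00 z' hz1'))⟩⟩
    obtain ⟨a, ha, hpa⟩ := mem_iUnion₂.1 hpg
    obtain ⟨b, hb, hpb⟩ := mem_iUnion₂.1 hpb
    obtain ⟨haz, hag⟩ := Finset.mem_filter.1 ha
    obtain ⟨hbz, hbg⟩ := Finset.mem_filter.1 hb
    obtain ⟨ha1, haW⟩ := Finset.mem_filter.1 haz
    obtain ⟨hb1, hbW⟩ := Finset.mem_filter.1 hbz
    refine hbg ?_
    have hself : ∀ x ∈ H.roots.toFinset, x ∈ zerosIn H (lowComp H s' x) := fun x hx =>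
      Finset.mem_filter.2 ⟨hx, mem_lowComp (hz00 x hx)⟩
    suffices hab : Finsupp.single a (1 : ℚ) - Finsupp.single b 1 ∈ critSpan H W by
      have := Submodule.add_mem _ hag hab
      simpa using this
    rcases (hEle p hpE).lt_or_eq with hlt | heq
    · have hmeet : ∀ x, p ∈ closure (lowComp H s' x) → lowComp H s' x = lowComp H s' p := by
        intro x hx
        obtain ⟨v, hv, hvx⟩ := _root_.mem_closure_iff.1 hx _ (isOpen_lowComp H s' p)
          (mem_lowComp hlt)
        rw [lowComp_eq hv, lowComp_eq hvx]
      have hb2 := hself b hb1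
      rw [hmeet b hpb, ← hmeet a hpa] at hb2
      exact hih a haW (hz00 a ha1) a (hself a ha1) b hb2
    · have hrep : ∀ x ∈ H.roots.toFinset, x ∈ W → p ∈ closure (lowComp H s' x) →
          ∃ r ∈ adjZeros H p, r ∈ zerosIn H (lowComp H s' x) := by
        intro x hx hxW hpx
        obtain ⟨h1, h2⟩ := repZero_spec (H := H) (Ω := lowComp H s' x)
          ⟨x, hx, mem_lowComp (hz00 x hx)⟩
        refine ⟨repZero H (lowComp H s' x), Finset.mem_filter.2 ⟨h1, ?_⟩,
          Finset.mem_filter.2 ⟨h1, h2⟩⟩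
        rw [heq, ← lowComp_eq h2]
        exact ⟨hpx, rfl⟩
      obtain ⟨ra, hra, hra'⟩ := hrep a ha1 haW hpa
      obtain ⟨rb, hrb, hrb'⟩ := hrep b hb1 hbW hpb
      have hp0 : H.eval p ≠ 0 := by
        intro h
        rw [h, norm_zero] at heq
        exact hs'pos.ne heq
      have h1 := hih a haW (hz00 a ha1) a (hself a ha1) ra hra'
      have h2 := single_sub_mem_critSpan hH hp0 (hEW hpE) hra hrb
      have h3 := hih b hbW (hz00 b hb1) rb hrb' b (hself b hb1)
      have := Submodule.add_mem _ (Submodule.add_mem _ h1 h2) h3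
      simpa using this

lemma rootCount_eq_zero_iff {P : Polynomial ℂ} {O : Set ℂ} :
    rootCount P O = 0 ↔ ∀ x ∈ P.roots, x ∉ O := by
  classical
  exact Multiset.countP_eq_zero

open Classical in
lemma rootCount_eq_sum {P : Polynomial ℂ} {O : Set ℂ} {T : Finset ℂ}
    (hT : ∀ z ∈ P.roots, z ∈ O → z ∈ T) :
    rootCount P O = ∑ z ∈ T.filter (· ∈ O), P.rootMultiplicity z := by
  have h1 : (∑ z ∈ T.filter (· ∈ O), (P.roots.filter (· ∈ O)).count z) =
      (P.roots.filter (· ∈ O)).card := by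
    refine Multiset.sum_count_eq_card fun z hz => ?_
    rw [Multiset.mem_filter] at hz
    exact Finset.mem_filter.2 ⟨hT z hz.1 hz.2, hz.2⟩
  rw [rootCount, Multiset.countP_eq_card_filter, ← h1]
  refine Finset.sum_congr rfl fun z hz => ?_
  rw [Multiset.count_filter_of_pos (Finset.mem_filter.1 hz).2, Polynomial.count_roots]

lemma mem_critIn {H : Polynomial ℂ} {O : Set ℂ} {p : ℂ} :
    p ∈ critIn H O ↔ p ∈ H.derivative.roots.toFinset ∧ H.eval p ≠ 0 ∧ p ∈ O := by
  classical
  exact Finset.mem_filter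

/-- Bookkeeping of roots of `H` and `H'`. -/
lemma rootCount_add_sum_critIn {H : Polynomial ℂ} (hH : 0 < H.natDegree) (O : Set ℂ) :
    rootCount H O + ∑ p ∈ critIn H O, H.derivative.rootMultiplicity p =
      rootCount H.derivative O + (zerosIn H O).card := by
  classical
  have h1 : rootCount H O = ∑ z ∈ zerosIn H O, H.derivative.rootMultiplicity z +
      (zerosIn H O).card := by
    rw [rootCount_eq_sum (T := H.roots.toFinset) (fun z hz _ => Multiset.mem_toFinset.2 hz),
      Finset.card_eq_sum_ones, ← Finset.sum_add_distrib]
    refine Finset.sum_congr rfl fun z hz => ?_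
    have hz0 := (mem_zeros hH).1 (Finset.mem_filter.1 hz).1
    have := rootMultiplicity_sub_C hH z
    rwa [hz0, Polynomial.C_0, sub_zero] at this
  have hdisj : Disjoint (critIn H O) (zerosIn H O) := by
    rw [Finset.disjoint_left]
    intro p hp hp'
    exact (Finset.mem_filter.1 hp).2.1 ((mem_zeros hH).1 (Finset.mem_filter.1 hp').1)
  have h2 : rootCount H.derivative O =
      ∑ p ∈ critIn H O, H.derivative.rootMultiplicity p +
        ∑ p ∈ zerosIn H O, H.derivative.rootMultiplicity p := by
    rw [← Finset.sum_union hdisj, rootCount_eq_sum (T := critIn H O ∪ zerosIn H O)]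
    · congr 1
      rw [Finset.filter_true_of_mem]
      intro p hp
      rcases Finset.mem_union.1 hp with h | h
      · exact (Finset.mem_filter.1 h).2.2
      · exact (Finset.mem_filter.1 h).2
    · intro z hz hzO
      by_cases hz0 : H.eval z = 0
      · exact Finset.mem_union_right _ (Finset.mem_filter.2 ⟨(mem_zeros hH).2 hz0, hzO⟩)
      · exact Finset.mem_union_left _ (Finset.mem_filter.2 ⟨Multiset.mem_toFinset.2 hz, hz0, hzO⟩)
  omega

lemma exists_forall_zero_mem_lowComp {H : Polynomial ℂ} (z₀ : ℂ) :
    ∃ s, ∀ z ∈ H.roots.toFinset, z ∈ lowComp H s z₀ := by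
  obtain ⟨r, hr⟩ := (insert z₀ H.roots.toFinset).finite_toSet.isBounded.subset_closedBall 0
  obtain ⟨C, hC⟩ := (isCompact_closedBall (0 : ℂ) r).exists_bound_of_continuousOn
    (f := fun w => H.eval w) H.continuous.continuousOn
  refine ⟨C + 1, fun z hz => ?_⟩
  refine (convex_closedBall (0 : ℂ) r).isPreconnected.subset_connectedComponentIn
    (hr (by simp)) (fun w hw => mem_sublevel.2 ((hC w hw).trans_lt (by linarith))) (hr ?_)
  exact Finset.mem_coe.2 (Finset.mem_insert_of_mem hz)

lemma finrank_critSpan_le {H : Polynomial ℂ} (hH : 0 < H.natDegree) (T : Finset ℂ)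
    (hT : ∀ p ∈ T, H.eval p ≠ 0) :
    Module.finrank ℚ (⨆ p ∈ T, diffSpan (adjZeros H p) : Submodule ℚ (ℂ →₀ ℚ)) ≤
      ∑ p ∈ T, H.derivative.rootMultiplicity p := by
  refine (finrank_iSup_diffSpan_le T _).trans (Finset.sum_le_sum fun p hp => ?_)
  have := card_adjZeros_le hH (hT p hp)
  omega

lemma finiteDimensional_iSup_diffSpan (T : Finset ℂ) (R : ℂ → Finset ℂ) :
    FiniteDimensional ℚ (⨆ p ∈ T, diffSpan (R p) : Submodule ℚ (ℂ →₀ ℚ)) := by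
  rw [← Finset.sup_eq_iSup]
  infer_instance

lemma diffSpan_le_critSpan {H : Polynomial ℂ} (hH : 0 < H.natDegree) (s : ℝ) (z₀ : ℂ) :
    diffSpan (zerosIn H (lowComp H s z₀)) ≤ critSpan H (lowComp H s z₀) := by
  refine Submodule.span_le.2 ?_
  rintro v ⟨a, ha, b, hb, rfl⟩
  exact zero_sub_mem_critSpan hH _ s z₀ le_rfl a ha b hb

/-- The zeros in a component of `{|H| < s}` exceed its critical points by one. -/
theorem rootCount_lowComp {H : Polynomial ℂ} (hH : 0 < H.natDegree) {s : ℝ} {z : ℂ}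
    (hz : ‖H.eval z‖ < s) :
    rootCount H (lowComp H s z) = rootCount H.derivative (lowComp H s z) + 1 := by
  classical
  set W := lowComp H s z with hW
  have hbook := rootCount_add_sum_critIn hH W
  have hcrit0 : ∀ O : Set ℂ, ∀ p ∈ critIn H O, H.eval p ≠ 0 := fun O p hp =>
    (Finset.mem_filter.1 hp).2.1
  -- upper bound
  have hfd : ∀ O, FiniteDimensional ℚ (critSpan H O) := fun O =>
    finiteDimensional_iSup_diffSpan _ _
  have hup : (zerosIn H W).card ≤ ∑ p ∈ critIn H W, H.derivative.rootMultiplicity p + 1 := by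
    refine (card_le_finrank_diffSpan _).trans (Nat.add_le_add_right ?_ 1)
    have := hfd W
    exact (Submodule.finrank_mono (diffSpan_le_critSpan hH s z)).trans
      (finrank_critSpan_le hH _ (hcrit0 W))
  -- lower bound
  obtain ⟨a, ha, haW⟩ := exists_zero_mem_lowComp hH hz
  have hpos : 0 < (zerosIn H W).card := Finset.card_pos.2 ⟨a, Finset.mem_filter.2 ⟨ha, haW⟩⟩
  have hbook' := rootCount_add_sum_critIn hH univ
  have huniv : ∀ P : Polynomial ℂ, rootCount P univ = P.natDegree := fun P => by
    have h := rootCount_add_compl P univ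
    have h0 : rootCount P univᶜ = 0 := rootCount_eq_zero_iff.2 (by simp)
    omega
  rw [huniv, huniv, Polynomial.natDegree_derivative] at hbook'
  obtain ⟨t, ht⟩ := exists_forall_zero_mem_lowComp (H := H) z
  have hZ : zerosIn H (lowComp H t z) = zerosIn H univ := by
    ext x
    simp only [zerosIn, Finset.mem_filter, mem_univ, and_true]
    exact ⟨fun h => h.1, fun h => ⟨h, ht x h⟩⟩
  have hle : diffSpan (zerosIn H univ) ≤ diffSpan (zerosIn H W) ⊔
      ⨆ p ∈ critIn H univ \ critIn H W, diffSpan (adjZeros H p) := by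
    rw [← hZ]
    refine (diffSpan_le_critSpan hH t z).trans (iSup₂_le fun p hp => ?_)
    by_cases hpW : p ∈ W
    · refine le_sup_of_le_left ?_
      refine Submodule.span_mono ?_
      have hsub : ∀ x ∈ adjZeros H p, x ∈ zerosIn H W := by
        intro x hx
        obtain ⟨h1, h2, -⟩ := Finset.mem_filter.1 hx
        refine Finset.mem_filter.2 ⟨h1, ?_⟩
        refine mem_lowComp_of_mem_closure (lt_of_mem_lowComp hpW) ?_ h2 hpW
        rw [(mem_zeros hH).1 h1, norm_zero]
        exact norm_pos_iff.2 (hcrit0 _ p hp)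
      rintro v ⟨x, hx, y, hy, rfl⟩
      exact ⟨x, hsub x hx, y, hsub y hy, rfl⟩
    · refine le_sup_of_le_right (le_biSup (fun p => diffSpan (adjZeros H p)) ?_)
      obtain ⟨h1, h2, -⟩ := Finset.mem_filter.1 hp
      exact Finset.mem_sdiff.2 ⟨mem_critIn.2 ⟨h1, h2, mem_univ p⟩,
        fun h => hpW (Finset.mem_filter.1 h).2.2⟩
  have hsubset : critIn H W ⊆ critIn H univ := by
    intro p hp
    simp only [critIn, Finset.mem_filter, mem_univ, and_true] at hp ⊢
    tauto
  have hlow : (zerosIn H univ).card ≤ (zerosIn H W).card - 1 +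
      ∑ p ∈ critIn H univ \ critIn H W, H.derivative.rootMultiplicity p + 1 := by
    refine (card_le_finrank_diffSpan _).trans (Nat.add_le_add_right ?_ 1)
    have := finiteDimensional_iSup_diffSpan (critIn H univ \ critIn H W) (adjZeros H)
    refine (Submodule.finrank_mono hle).trans ?_
    refine (Submodule.finrank_add_le_finrank_add_finrank _ _).trans ?_
    refine Nat.add_le_add (finrank_diffSpan_le _) (finrank_critSpan_le hH _ fun p hp => ?_)
    exact hcrit0 _ p (Finset.mem_sdiff.1 hp).1
  have hsplit := Finset.sum_sdiff (f := fun p => H.derivative.rootMultiplicity p) hsubset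
  omega

lemma rootCount_mul {P Q : Polynomial ℂ} (hP : P ≠ 0) (hQ : Q ≠ 0) (O : Set ℂ) :
    rootCount (P * Q) O = rootCount P O + rootCount Q O := by
  classical
  simp only [rootCount]
  rw [Polynomial.roots_mul (mul_ne_zero hP hQ), Multiset.countP_add]

lemma rootCount_diff (P : Polynomial ℂ) {O O₁ : Set ℂ} (h : O₁ ⊆ O) :
    rootCount P O = rootCount P O₁ + rootCount P {z | z ∈ O ∧ z ∉ O₁} := by
  classical
  simp only [rootCount]
  generalize P.roots = s
  induction s using Multiset.induction_on with
  | empty => simp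
  | cons a s ih =>
    simp only [Multiset.countP_cons, ih]
    by_cases h1 : a ∈ O₁
    · have h2 := h h1
      simp [h1, h2]
      omega
    · by_cases h2 : a ∈ O
      · simp [h1, h2]
        omega
      · simp [h1, h2]

lemma rootCount_C_mul {a : ℂ} (ha : a ≠ 0) (P : Polynomial ℂ) (O : Set ℂ) :
    rootCount (Polynomial.C a * P) O = rootCount P O := by
  classical
  simp only [rootCount]
  rw [Polynomial.roots_C_mul _ ha]

/-- Roots of a composition in a component of a preimage. -/
lemma rootCount_comp {F : Polynomial ℂ} (hF : 0 < F.natDegree) {V U : Set ℂ}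
    (hUV : ∀ x ∈ U, F.eval x ∈ V) {k : ℕ}
    (hk : ∀ y ∈ V, rootCount (F - Polynomial.C y) U = k) {P : Polynomial ℂ} (hP : P ≠ 0) :
    rootCount (P.comp F) U = k * rootCount P V := by
  classical
  have hs : ∀ s : Multiset ℂ,
      rootCount ((s.map fun a => F - Polynomial.C a).prod) U = k * s.countP (· ∈ V) ∧
        (s.map fun a => F - Polynomial.C a).prod ≠ 0 := by
    intro s
    induction s using Multiset.induction_on with
    | empty => simp [rootCount]
    | cons a s ih =>
      rw [Multiset.map_cons, Multiset.prod_cons, Multiset.countP_cons]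
      refine ⟨?_, mul_ne_zero (sub_C_ne_zero hF a) ih.2⟩
      rw [rootCount_mul (sub_C_ne_zero hF a) ih.2, ih.1]
      by_cases ha : a ∈ V
      · rw [hk a ha, if_pos ha]
        ring
      · rw [if_neg ha, rootCount_eq_zero_iff.2]
        · ring
        · intro x hx hxU
          have := (Polynomial.mem_roots'.1 hx).2
          rw [Polynomial.IsRoot, Polynomial.eval_sub, Polynomial.eval_C, sub_eq_zero] at this
          exact ha (this ▸ hUV x hxU)
  have hP1 := (IsAlgClosed.splits P).eq_prod_roots
  have hP2 : P.comp F = Polynomial.C P.leadingCoeff *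
      (P.roots.map fun a => F - Polynomial.C a).prod := by
    conv_lhs => rw [hP1]
    rw [Polynomial.mul_comp, Polynomial.C_comp, Polynomial.multiset_prod_comp, Multiset.map_map]
    simp
  rw [hP2, rootCount_C_mul (by simpa using hP), (hs _).1]
  rfl

lemma connectedComponentIn_preimage_lowComp {F G : Polynomial ℂ} {s : ℝ} {y₀ z : ℂ}
    (hz : F.eval z ∈ lowComp G s y₀) :
    connectedComponentIn ((fun w => F.eval w) ⁻¹' lowComp G s y₀) z =
      lowComp (G.comp F) s z := by
  have hz' : ‖(G.comp F).eval z‖ < s := by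
    rw [Polynomial.eval_comp]
    exact lt_of_mem_lowComp hz
  apply Subset.antisymm
  · refine connectedComponentIn_mono _ fun w hw => mem_sublevel.2 ?_
    rw [Polynomial.eval_comp]
    exact lt_of_mem_lowComp hw
  · refine (isPreconnected_lowComp _ s z).subset_connectedComponentIn (mem_lowComp hz') ?_
    have him : (fun w => F.eval w) '' lowComp (G.comp F) s z ⊆ lowComp G s (F.eval z) := by
      refine ((isPreconnected_lowComp _ s z).image _
        F.continuous.continuousOn).subset_connectedComponentIn
        ⟨z, mem_lowComp hz', rfl⟩ ?_
      rintro _ ⟨w, hw, rfl⟩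
      have := lt_of_mem_lowComp hw
      rw [Polynomial.eval_comp] at this
      exact mem_sublevel.2 this
    rw [← lowComp_eq hz] at him
    exact image_subset_iff.1 him

/-- The Riemann–Hurwitz formula for components of preimages of polynomial sublevel sets. -/
theorem rootCount_component {F G : Polynomial ℂ} (hF : 0 < F.natDegree) (hG : 0 < G.natDegree)
    {s : ℝ} {y₀ z y : ℂ} (hz : F.eval z ∈ lowComp G s y₀) (hy : y ∈ lowComp G s y₀) :
    rootCount (F - Polynomial.C y)
        (connectedComponentIn ((fun w => F.eval w) ⁻¹' lowComp G s y₀) z) =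
      rootCount F.derivative
        (connectedComponentIn ((fun w => F.eval w) ⁻¹' lowComp G s y₀) z) + 1 := by
  have hGF : 0 < (G.comp F).natDegree := by
    rw [Polynomial.natDegree_comp]
    positivity
  have hG0 : G ≠ 0 := by rintro rfl; simp at hG
  have hd : ∀ P : Polynomial ℂ, 0 < P.natDegree → P.derivative ≠ 0 := fun P hP h => by
    have := Polynomial.derivative_eq_zero.1 h
    omega
  set V := lowComp G s y₀ with hV
  set U := connectedComponentIn ((fun w => F.eval w) ⁻¹' V) z with hU
  have hUV : ∀ x ∈ U, F.eval x ∈ V := fun x hx =>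
    (connectedComponentIn_subset _ _ hx : x ∈ (fun w => F.eval w) ⁻¹' V)
  set k := rootCount (F - Polynomial.C y) U with hk
  have hkc : ∀ y' ∈ V, rootCount (F - Polynomial.C y') U = k := fun y' hy' =>
    rootCount_const hF (isOpen_lowComp G s y₀) (isPreconnected_lowComp G s y₀) z hy' hy
  have h1 := rootCount_comp hF hUV hkc hG0
  have h2 := rootCount_comp hF hUV hkc (hd G hG)
  have hz' : ‖(G.comp F).eval z‖ < s := by
    rw [Polynomial.eval_comp]
    exact lt_of_mem_lowComp hz
  have h3 := rootCount_lowComp hGF hz'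
  rw [← connectedComponentIn_preimage_lowComp hz] at h3
  have h4 : rootCount G V = rootCount G.derivative V + 1 := by
    rw [hV, lowComp_eq hz]
    exact rootCount_lowComp hG (lt_of_mem_lowComp hz)
  have hne : (G.derivative.comp F) ≠ 0 := fun h => by
    have := hd _ hGF
    rw [Polynomial.derivative_comp, h, mul_zero] at this
    exact this rfl
  change rootCount (G.comp F) U = rootCount (G.comp F).derivative U + 1 at h3
  rw [Polynomial.derivative_comp, rootCount_mul (hd F hF) hne, h1, h2, h4] at h3
  have : k * (rootCount G.derivative V + 1) = k * rootCount G.derivative V + k := by ring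
  omega

lemma injOn_of_rootCount_le_one {F : Polynomial ℂ} (hF : 0 < F.natDegree) {U : Set ℂ}
    (h : ∀ z ∈ U, rootCount (F - Polynomial.C (F.eval z)) U ≤ 1) :
    InjOn (fun w => F.eval w) U := by
  classical
  intro a ha b hb hab
  by_contra hne
  have h1 := h a ha
  rw [rootCount, Multiset.countP_eq_card_filter] at h1
  have h2 : ({a, b} : Finset ℂ) ⊆ ((F - Polynomial.C (F.eval a)).roots.filter (· ∈ U)).toFinset := by
    intro x hx
    rw [Multiset.mem_toFinset, Multiset.mem_filter, Polynomial.mem_roots (sub_C_ne_zero hF _)]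
    rcases Finset.mem_insert.1 hx with rfl | hx
    · exact ⟨by simp, ha⟩
    · rw [Finset.mem_singleton] at hx
      subst hx
      have hab' : F.eval a = F.eval x := hab
      exact ⟨by simp [hab'], hb⟩
  have h3 := (Finset.card_le_card h2).trans (Multiset.toFinset_card_le _)
  rw [Finset.card_pair hne] at h3
  omega

lemma injOn_component {F G : Polynomial ℂ} (hF : 0 < F.natDegree) (hG : 0 < G.natDegree)
    {s : ℝ} {y₀ z : ℂ}
    (hcrit : ∀ c ∈ connectedComponentIn ((fun w => F.eval w) ⁻¹' lowComp G s y₀) z,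
      F.derivative.eval c ≠ 0) :
    InjOn (fun w => F.eval w)
      (connectedComponentIn ((fun w => F.eval w) ⁻¹' lowComp G s y₀) z) := by
  refine injOn_of_rootCount_le_one hF fun x hx => ?_
  have hxV : F.eval x ∈ lowComp G s y₀ :=
    (connectedComponentIn_subset _ _ hx : x ∈ (fun w => F.eval w) ⁻¹' lowComp G s y₀)
  rw [connectedComponentIn_eq hx, rootCount_component hF hG hxV hxV, rootCount_eq_zero_iff.2]
  intro c hc hcU
  rw [← connectedComponentIn_eq hx] at hcU
  exact hcrit c hcU (Polynomial.mem_roots'.1 hc).2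

lemma lowComp_X_sub_C (y : ℂ) {r : ℝ} (hr : 0 < r) :
    lowComp (Polynomial.X - Polynomial.C y) r y = ball y r := by
  have : (fun w => (Polynomial.X - Polynomial.C y).eval w) ⁻¹' ball (0 : ℂ) r = ball y r := by
    ext w
    simp [dist_eq_norm]
  rw [lowComp, this]
  exact (convex_ball y r).isPreconnected.connectedComponentIn (mem_ball_self hr)

lemma injOn_component_ball {F : Polynomial ℂ} (hF : 0 < F.natDegree) {y z : ℂ} {r : ℝ}
    (hr : 0 < r) (hcrit : ∀ c ∈ connectedComponentIn ((fun w => F.eval w) ⁻¹' ball y r) z,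
      F.derivative.eval c ≠ 0) :
    InjOn (fun w => F.eval w) (connectedComponentIn ((fun w => F.eval w) ⁻¹' ball y r) z) := by
  rw [← lowComp_X_sub_C y hr] at hcrit ⊢
  exact injOn_component hF (by simp) hcrit

/-- A union of components of a preimage contains more preimages than critical points. -/
lemma rootCount_derivative_lt {F G : Polynomial ℂ} (hF : 0 < F.natDegree) (hG : 0 < G.natDegree)
    {s : ℝ} {y₀ y : ℂ} (hy : y ∈ lowComp G s y₀) (n : ℕ) :
    ∀ R : Set ℂ, (∀ z ∈ R, F.eval z ∈ lowComp G s y₀) →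
      (∀ z ∈ R, connectedComponentIn ((fun w => F.eval w) ⁻¹' lowComp G s y₀) z ⊆ R) →
      rootCount (F - Polynomial.C y) R ≤ n → R.Nonempty →
      rootCount F.derivative R < rootCount (F - Polynomial.C y) R := by
  induction n with
  | zero =>
    rintro R hR hRc hn ⟨z, hz⟩
    have h1 := rootCount_component hF hG (hR z hz) hy
    have h2 := rootCount_diff (F - Polynomial.C y) (hRc z hz)
    omega
  | succ n ih =>
    rintro R hR hRc hn ⟨z, hz⟩
    have h1 := rootCount_component hF hG (hR z hz) hy
    have h2 := rootCount_diff (F - Polynomial.C y) (hRc z hz)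
    have h3 := rootCount_diff F.derivative (hRc z hz)
    set U := connectedComponentIn ((fun w => F.eval w) ⁻¹' lowComp G s y₀) z
    rcases Set.eq_empty_or_nonempty {w | w ∈ R ∧ w ∉ U} with he | hne
    · have : rootCount F.derivative {w | w ∈ R ∧ w ∉ U} = 0 := by
        rw [he, rootCount_eq_zero_iff]
        simp
      omega
    · have := ih {w | w ∈ R ∧ w ∉ U} (fun w hw => hR w hw.1) (fun w hw v hv => by
        refine ⟨hRc w hw.1 hv, fun hvU => hw.2 ?_⟩
        have h4 : U = _ := connectedComponentIn_eq hvU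
        rw [h4, ← connectedComponentIn_eq hv]
        exact mem_connectedComponentIn (hR w hw.1)) (by omega) hne
      omega

/-- If all critical points over `V` lie over a smaller piece, its preimage is connected. -/
lemma mem_component_of_crit {F G G₂ : Polynomial ℂ} (hF : 0 < F.natDegree)
    (hG : 0 < G.natDegree) (hG₂ : 0 < G₂.natDegree) {s s₂ : ℝ} {y₀ y₂ z₀ z w : ℂ}
    (hsub : lowComp G₂ s₂ y₂ ⊆ lowComp G s y₀)
    (hcrit : ∀ c ∈ connectedComponentIn ((fun w => F.eval w) ⁻¹' lowComp G s y₀) z₀,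
      F.derivative.eval c = 0 → F.eval c ∈ lowComp G₂ s₂ y₂)
    (hz : z ∈ connectedComponentIn ((fun w => F.eval w) ⁻¹' lowComp G s y₀) z₀)
    (hw : w ∈ connectedComponentIn ((fun w => F.eval w) ⁻¹' lowComp G s y₀) z₀)
    (hzV : F.eval z ∈ lowComp G₂ s₂ y₂) (hwV : F.eval w ∈ lowComp G₂ s₂ y₂) :
    w ∈ connectedComponentIn ((fun w => F.eval w) ⁻¹' lowComp G₂ s₂ y₂) z := by
  by_contra hcon
  set U := connectedComponentIn ((fun w => F.eval w) ⁻¹' lowComp G s y₀) z₀ with hU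
  set U₁ := connectedComponentIn ((fun w => F.eval w) ⁻¹' lowComp G₂ s₂ y₂) z with hU₁
  have hcompU : ∀ x ∈ U, connectedComponentIn ((fun w => F.eval w) ⁻¹' lowComp G₂ s₂ y₂) x ⊆ U := by
    intro x hx
    rw [hU, connectedComponentIn_eq hx]
    exact connectedComponentIn_mono _ (preimage_mono hsub)
  have hU₁V : ∀ x ∈ U₁, F.eval x ∈ lowComp G₂ s₂ y₂ := fun x hx =>
    (connectedComponentIn_subset _ _ hx : x ∈ (fun w => F.eval w) ⁻¹' lowComp G₂ s₂ y₂)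
  set R := {x | x ∈ U ∧ F.eval x ∈ lowComp G₂ s₂ y₂} with hR
  have hUR : U₁ ⊆ R := fun x hx => ⟨hcompU z hz hx, hU₁V x hx⟩
  have h0 := rootCount_component hF hG (z := z) (y₀ := y₀) (hsub hzV) (hsub hzV)
  rw [← connectedComponentIn_eq hz, ← hU] at h0
  have h1 := rootCount_component hF hG₂ hzV hzV
  rw [← hU₁] at h1
  have h2 := rootCount_derivative_lt hF hG₂ hzV _ {x | x ∈ R ∧ x ∉ U₁} (fun x hx => hx.1.2)
    (fun x hx v hv => by
      refine ⟨⟨hcompU x hx.1.1 hv, (connectedComponentIn_subset _ _ hv :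
        v ∈ (fun w => F.eval w) ⁻¹' lowComp G₂ s₂ y₂)⟩, fun hvU => hx.2 ?_⟩
      have h4 : U₁ = _ := connectedComponentIn_eq hvU
      rw [h4, ← connectedComponentIn_eq hv]
      exact mem_connectedComponentIn hx.1.2) le_rfl ⟨w, ⟨hw, hwV⟩, hcon⟩
  have h3 := rootCount_diff (F - Polynomial.C (F.eval z)) hUR
  have h4 := rootCount_diff F.derivative hUR
  have h5 : rootCount F.derivative U = rootCount F.derivative R := by
    refine rootCount_congr fun x hx => ⟨fun h => ⟨h, hcrit x h (Polynomial.mem_roots'.1 hx).2⟩,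
      fun h => h.1⟩
  have h6 : rootCount (F - Polynomial.C (F.eval z)) U =
      rootCount (F - Polynomial.C (F.eval z)) R := by
    refine rootCount_congr fun x hx => ⟨fun h => ⟨h, ?_⟩, fun h => h.1⟩
    have := (Polynomial.mem_roots'.1 hx).2
    rw [Polynomial.IsRoot, Polynomial.eval_sub, Polynomial.eval_C, sub_eq_zero] at this
    rw [this]
    exact hzV
  omega

/-- The orbit of `z`. -/
def orb (f : Polynomial ℂ) (n : ℕ) (z : ℂ) : ℂ := (fun w : ℂ => f.eval w)^[n] z

@[simp] lemma orb_zero (f : Polynomial ℂ) (z : ℂ) : orb f 0 z = z := rfl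

lemma orb_succ (f : Polynomial ℂ) (n : ℕ) (z : ℂ) : orb f (n + 1) z = orb f n (f.eval z) := rfl

lemma orb_one (f : Polynomial ℂ) (z : ℂ) : orb f 1 z = f.eval z := rfl

lemma orb_add (f : Polynomial ℂ) (m n : ℕ) (z : ℂ) : orb f (m + n) z = orb f m (orb f n z) :=
  Function.iterate_add_apply _ m n z

lemma orb_add' (f : Polynomial ℂ) (m n : ℕ) (z : ℂ) : orb f (m + n) z = orb f n (orb f m z) := by
  rw [add_comm, orb_add]

lemma orb_succ' (f : Polynomial ℂ) (n : ℕ) (z : ℂ) : orb f (n + 1) z = f.eval (orb f n z) :=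
  orb_add' f n 1 z

/-- The iterates as polynomials. -/
noncomputable def itp (f : Polynomial ℂ) (n : ℕ) : Polynomial ℂ := f.comp^[n] Polynomial.X

@[simp] lemma itp_eval (f : Polynomial ℂ) (n : ℕ) (z : ℂ) : (itp f n).eval z = orb f n z := by
  rw [itp, Polynomial.iterate_comp_eval, Polynomial.eval_X, orb]

lemma itp_add (f : Polynomial ℂ) (m n : ℕ) : itp f (m + n) = (itp f m).comp (itp f n) :=
  Polynomial.funext fun z => by simp [orb_add]

lemma itp_one (f : Polynomial ℂ) : itp f 1 = f :=
  Polynomial.funext fun z => by simp [orb_one]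

lemma itp_natDegree (f : Polynomial ℂ) (n : ℕ) : (itp f n).natDegree = f.natDegree ^ n := by
  rw [itp, Polynomial.natDegree_iterate_comp, Polynomial.natDegree_X, mul_one]

lemma itp_natDegree_pos {f : Polynomial ℂ} (hf : 2 ≤ f.natDegree) (n : ℕ) :
    0 < (itp f n).natDegree := by
  rw [itp_natDegree]
  positivity

lemma continuous_orb (f : Polynomial ℂ) (n : ℕ) : Continuous (orb f n) := by
  simpa using (itp f n).continuous

/-- `R` is an escape radius for `f`. -/
def EscR (f : Polynomial ℂ) (R : ℝ) : Prop :=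
  0 < R ∧ ∀ z : ℂ, R / 2 ≤ ‖z‖ → 2 * ‖z‖ < ‖f.eval z‖

lemma exists_escR {f : Polynomial ℂ} (hf : 2 ≤ f.natDegree) : ∃ R, EscR f R := by
  have hdeg : 0 < f.divX.natDegree := by
    rw [Polynomial.natDegree_divX_eq_natDegree_tsub_one]
    omega
  have h1 := tendsto_norm_cocompact_atTop.comp (tendsto_eval_cocompact hdeg)
  have h2 := h1.eventually (eventually_ge_atTop (3 + ‖f.coeff 0‖))
  rw [← Metric.cobounded_eq_cocompact, ← comap_norm_atTop, eventually_comap] at h2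
  obtain ⟨r, hr⟩ := eventually_atTop.1 h2
  refine ⟨2 * max r 1, by positivity, fun z hz => ?_⟩
  have hz1 : 1 ≤ ‖z‖ := by linarith [le_max_right r 1]
  have hzr : r ≤ ‖z‖ := by linarith [le_max_left r 1]
  have h3 : 3 + ‖f.coeff 0‖ ≤ ‖f.divX.eval z‖ := hr ‖z‖ hzr z rfl
  have h4 : f.eval z = f.divX.eval z * z + f.coeff 0 := by
    conv_lhs => rw [← Polynomial.divX_mul_X_add f]
    simp
  have h5 : ‖f.divX.eval z * z‖ ≤ ‖f.eval z‖ + ‖f.coeff 0‖ := by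
    have : f.divX.eval z * z = f.eval z - f.coeff 0 := by rw [h4]; ring
    rw [this]
    exact norm_sub_le _ _
  rw [norm_mul] at h5
  have h6 : (3 + ‖f.coeff 0‖) * ‖z‖ ≤ ‖f.divX.eval z‖ * ‖z‖ := by gcongr
  nlinarith [norm_nonneg (f.coeff 0)]

lemma EscR.orb_lt {f : Polynomial ℂ} {R : ℝ} (h : EscR f R) {n : ℕ} {z : ℂ}
    (hz : ‖orb f (n + 1) z‖ ≤ R) : ‖orb f n z‖ < R / 2 := by
  by_contra hcon
  have := h.2 _ (not_lt.1 hcon)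
  rw [orb_succ'] at hz
  linarith

lemma EscR.orb_lt_of_le {f : Polynomial ℂ} {R : ℝ} (h : EscR f R) {m n : ℕ} (hmn : m ≤ n) {z : ℂ}
    (hz : ‖orb f n z‖ < R) : ‖orb f m z‖ < R := by
  induction n, hmn using Nat.le_induction with
  | base => exact hz
  | succ n _ ih =>
    refine ih ?_
    have := h.orb_lt hz.le
    linarith [h.1]

/-- The points whose orbit stays in the disc of radius `R`. -/
def filled (f : Polynomial ℂ) (R : ℝ) : Set ℂ := {z | ∀ n, ‖orb f n z‖ < R}

lemma EscR.filled_eq {f : Polynomial ℂ} {R : ℝ} (h : EscR f R) :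
    filled f R = {z : ℂ | Bornology.IsBounded
      (Set.range fun n : ℕ => (fun w : ℂ => f.eval w)^[n] z)} := by
  ext z
  constructor
  · intro hz
    rw [mem_ofPred_eq, isBounded_iff_forall_norm_le]
    refine ⟨R, ?_⟩
    rintro _ ⟨n, rfl⟩
    exact (hz n).le
  · intro hz n
    by_contra hcon
    rw [mem_ofPred_eq, isBounded_iff_forall_norm_le] at hz
    obtain ⟨C, hC⟩ := hz
    have hg : ∀ k : ℕ, R * 2 ^ k ≤ ‖orb f (n + k) z‖ := by
      intro k
      induction k with
      | zero => simpa using not_lt.1 hcon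
      | succ k ih =>
        have h1 : (1 : ℝ) ≤ 2 ^ k := one_le_pow₀ (by norm_num)
        have h2 := h.2 (orb f (n + k) z) (by nlinarith [h.1])
        rw [← add_assoc, orb_succ', pow_succ]
        linarith
    obtain ⟨k, hk⟩ := pow_unbounded_of_one_lt (C / R) (one_lt_two)
    rw [div_lt_iff₀ h.1] at hk
    have := hC _ (mem_range_self (n + k))
    have h3 := hg k
    rw [orb] at h3
    linarith

/-- The puzzle piece of depth `n` containing `z`. -/
def piece (f : Polynomial ℂ) (R : ℝ) (n : ℕ) (z : ℂ) : Set ℂ := lowComp (itp f n) R z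

section Pieces

variable {f : Polynomial ℂ} {R : ℝ}

lemma isOpen_piece (n : ℕ) (z : ℂ) : IsOpen (piece f R n z) := isOpen_lowComp _ _ _

lemma isPreconnected_piece (n : ℕ) (z : ℂ) : IsPreconnected (piece f R n z) :=
  isPreconnected_lowComp _ _ _

lemma mem_piece_self {n : ℕ} {z : ℂ} (h : ‖orb f n z‖ < R) : z ∈ piece f R n z :=
  mem_lowComp (by simpa using h)

lemma lt_of_mem_piece {n : ℕ} {z w : ℂ} (h : w ∈ piece f R n z) : ‖orb f n w‖ < R := by
  simpa using lt_of_mem_lowComp h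

lemma piece_eq {n : ℕ} {z w : ℂ} (h : w ∈ piece f R n z) : piece f R n z = piece f R n w :=
  lowComp_eq h

lemma mem_piece_symm {n : ℕ} {z w : ℂ} (h : w ∈ piece f R n z) : z ∈ piece f R n w := by
  rw [← piece_eq h]
  have : z ∈ (fun w => (itp f n).eval w) ⁻¹' ball 0 R := by
    by_contra hcon
    rw [piece, lowComp, connectedComponentIn_eq_empty hcon] at h
    exact h
  exact mem_connectedComponentIn this

lemma closure_piece_subset (hR : EscR f R) (n : ℕ) (z : ℂ) :
    closure (piece f R (n + 1) z) ⊆ piece f R n z := by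
  intro w hw
  have hsub : ∀ v ∈ closure (piece f R (n + 1) z), ‖orb f n v‖ < R := by
    intro v hv
    have := closure_lowComp_subset R z hv
    have := hR.orb_lt (n := n) (z := v) (by simpa using this)
    linarith [hR.1]
  have hz : z ∈ piece f R (n + 1) z := by
    obtain ⟨v, hv⟩ := closure_nonempty_iff.1 ⟨w, hw⟩
    have h1 := mem_piece_symm hv
    rwa [piece_eq h1] at h1
  refine (isPreconnected_piece (n + 1) z).closure.subset_connectedComponentIn
    (subset_closure hz) (fun v hv => ?_) hw
  exact mem_sublevel.2 (by simpa using hsub v hv)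

lemma piece_succ_subset (hR : EscR f R) (n : ℕ) (z : ℂ) :
    piece f R (n + 1) z ⊆ piece f R n z :=
  subset_closure.trans (closure_piece_subset hR n z)

lemma piece_anti (hR : EscR f R) {m n : ℕ} (hmn : m ≤ n) (z : ℂ) :
    piece f R n z ⊆ piece f R m z := by
  induction n, hmn using Nat.le_induction with
  | base => exact Subset.rfl
  | succ n _ ih => exact (piece_succ_subset hR n z).trans ih

lemma piece_add_eq (k n : ℕ) {z : ℂ} (hz : ‖orb f (n + k) z‖ < R) :
    connectedComponentIn ((fun w => (itp f k).eval w) ⁻¹' piece f R n (orb f k z)) z =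
      piece f R (n + k) z := by
  rw [piece, piece, itp_add]
  refine connectedComponentIn_preimage_lowComp ?_
  rw [itp_eval]
  refine mem_lowComp ?_
  rw [itp_eval, ← orb_add]
  exact hz

lemma orb_mem_piece {k n : ℕ} {z w : ℂ} (h : w ∈ piece f R (n + k) z) :
    orb f k w ∈ piece f R n (orb f k z) := by
  have hz' := mem_piece_symm h
  rw [← piece_add_eq k n (lt_of_mem_piece h)] at hz'
  have := (connectedComponentIn_subset _ _ hz' :
    z ∈ (fun w => (itp f k).eval w) ⁻¹' piece f R n (orb f k w))
  rw [mem_preimage, itp_eval] at this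
  exact mem_piece_symm this

lemma image_piece (hf : 2 ≤ f.natDegree) (k n : ℕ) {z : ℂ} (hz : ‖orb f (n + k) z‖ < R) :
    orb f k '' piece f R (n + k) z = piece f R n (orb f k z) := by
  have h := image_connectedComponentIn (itp_natDegree_pos hf k)
    (isOpen_piece (f := f) (R := R) n (orb f k z)) (isPreconnected_piece n (orb f k z)) (z := z) (by
      rw [itp_eval]
      refine mem_piece_self ?_
      rwa [← orb_add])
  rw [piece_add_eq k n hz] at h
  simpa using h

end Pieces

variable {f : Polynomial ℂ} {R : ℝ}

lemma mem_filled_orb {z : ℂ} (hz : z ∈ filled f R) (k : ℕ) : orb f k z ∈ filled f R := by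
  intro n
  rw [← orb_add]
  exact hz _

lemma mem_piece_of_filled {z : ℂ} (hz : z ∈ filled f R) (n : ℕ) : z ∈ piece f R n z :=
  mem_piece_self (hz n)

/-- The component of the filled Julia set as a nested intersection of pieces. -/
lemma iInter_piece (hf : 2 ≤ f.natDegree) (hR : EscR f R) {x : ℂ} (hx : x ∈ filled f R) :
    ⋂ n, piece f R n x = connectedComponentIn (filled f R) x := by
  apply Subset.antisymm
  · have h1 : ⋂ n, piece f R n x = ⋂ n, closure (piece f R (n + 1) x) := by
      apply Subset.antisymm
      · exact subset_iInter fun n => (iInter_subset _ (n + 1)).trans subset_closure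
      · exact subset_iInter fun n => (iInter_subset _ n).trans (closure_piece_subset hR n x)
    have hp : IsPreconnected (⋂ n, piece f R n x) := by
      rw [h1]
      refine isPreconnected_iInter_of_antitone ?_ ?_ ?_
      · exact antitone_nat_of_succ_le fun n => closure_mono (piece_succ_subset hR (n + 1) x)
      · intro n
        refine (isCompact_sublevel (itp_natDegree_pos hf (n + 1)) R).of_isClosed_subset isClosed_closure ?_
        exact closure_lowComp_subset R x
      · intro n
        exact (isPreconnected_piece _ _).closure
    refine hp.subset_connectedComponentIn (mem_iInter.2 fun n => mem_piece_of_filled hx n) ?_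
    intro z hz n
    exact lt_of_mem_piece (mem_iInter.1 hz n)
  · refine subset_iInter fun n => ?_
    refine isPreconnected_connectedComponentIn.subset_connectedComponentIn
      (mem_connectedComponentIn hx) fun z hz => ?_
    have : z ∈ filled f R := connectedComponentIn_subset _ _ hz
    exact mem_sublevel.2 (by simpa using this n)

lemma multLE_natDegree {F : Polynomial ℂ} (hF : 0 < F.natDegree) (O : Set ℂ) :
    MultLE F O F.natDegree := by
  classical
  intro w S hS
  have h0 := sub_C_ne_zero hF w
  have h1 : S ⊆ (F - Polynomial.C w).roots.toFinset := by
    intro z hz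
    rw [Multiset.mem_toFinset, Polynomial.mem_roots h0]
    simp [(hS z hz).2]
  have h2 : S.card ≤ F.natDegree := by
    refine (Finset.card_le_card h1).trans ((Multiset.toFinset_card_le _).trans ?_)
    refine (Polynomial.card_roots' _).trans ?_
    rw [Polynomial.natDegree_sub_C]
  exact_mod_cast h2

lemma multLE_one {F : Polynomial ℂ} {O : Set ℂ} (h : InjOn (fun z => F.eval z) O) :
    MultLE F O 1 := by
  intro w S hS
  have : S.card ≤ 1 := by
    rw [Finset.card_le_one]
    intro a ha b hb
    exact h (hS a ha).1 (hS b hb).1 ((hS a ha).2.trans (hS b hb).2.symm)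
  exact_mod_cast this

lemma MultLE.comp {F G : Polynomial ℂ} {O V : Set ℂ} {M N : ℝ} (hM0 : 0 ≤ M) (hF : MultLE F O M)
    (hG : MultLE G V N) (hOV : ∀ z ∈ O, F.eval z ∈ V) : MultLE (G.comp F) O (N * M) := by
  classical
  intro w S hS
  have h1 := hG w (S.image fun z => F.eval z) (by
    intro y hy
    obtain ⟨z, hz, rfl⟩ := Finset.mem_image.1 hy
    refine ⟨hOV z (hS z hz).1, ?_⟩
    have := (hS z hz).2
    rwa [Polynomial.eval_comp] at this)
  have h2 : (S.card : ℝ) = ∑ y ∈ S.image (fun z => F.eval z),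
      ((S.filter fun z => F.eval z = y).card : ℝ) := by
    exact_mod_cast Finset.card_eq_sum_card_image (fun z => F.eval z) S
  rw [h2]
  calc _ ≤ ∑ _y ∈ S.image (fun z => F.eval z), M := by
        refine Finset.sum_le_sum fun y _ => hF y _ fun z hz => ?_
        rw [Finset.mem_filter] at hz
        exact ⟨(hS z hz.1).1, hz.2⟩
    _ = (S.image fun z => F.eval z).card * M := by simp
    _ ≤ N * M := by gcongr

lemma isOpen_diff_piece (n : ℕ) (z : ℂ) :
    IsOpen {w | (itp f n).eval w ∈ ball 0 R ∧ w ∉ piece f R n z} :=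
  isOpen_diff_connectedComponentIn (isOpen_sublevel (itp f n) R) z

lemma hasCap_piece (hf : 2 ≤ f.natDegree) (hR : EscR f R) (n : ℕ) (z : ℂ) :
    HasCap (piece f R n z) (piece f R (n + 1) z) (f.natDegree ^ n * (16 * Real.pi)) := by
  have h := hasCap_ball (0 : ℂ) (r := R / 2) (by linarith [hR.1])
  rw [mul_div_cancel₀ R two_ne_zero] at h
  have h2 := h.pullback (itp_natDegree_pos hf n) (M := (f.natDegree : ℝ) ^ n) (by positivity)
    (isOpen_piece n z) (isOpen_diff_piece n z) (by
      have := multLE_natDegree (itp_natDegree_pos hf n) (piece f R n z)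
      rw [itp_natDegree] at this
      exact_mod_cast this)
  refine h2.mono Subset.rfl (fun w hw => ⟨piece_succ_subset hR n z hw, ?_⟩) le_rfl
  rw [itp_eval, mem_ball_zero_iff]
  exact hR.orb_lt (lt_of_mem_piece hw).le

/-- The part of `F⁻¹ V` outside a component is open. -/
lemma isOpen_diff_preimage_component {F : Polynomial ℂ} {V : Set ℂ} (hV : IsOpen V) (z : ℂ) :
    IsOpen {w | F.eval w ∈ V ∧ w ∉ connectedComponentIn ((fun w => F.eval w) ⁻¹' V) z} :=
  isOpen_diff_connectedComponentIn (hV.preimage F.continuous) z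

/-- Pulling back a capacity bound along an iterate. -/
lemma HasCap.pull (hf : 2 ≤ f.natDegree) {n k : ℕ} {x : ℂ} {A B : Set ℂ} {c M : ℝ} (hM0 : 0 ≤ M)
    (hx : ‖orb f (n + k) x‖ < R) (h : HasCap (piece f R n (orb f k x)) A c)
    (hB : B ⊆ piece f R (n + k) x) (hBA : ∀ z ∈ B, orb f k z ∈ A)
    (hM : MultLE (itp f k) (piece f R (n + k) x) M) :
    HasCap (piece f R (n + k) x) B (M * c) := by
  rw [← piece_add_eq k n hx] at hM hB ⊢
  have := h.pullback (itp_natDegree_pos hf k) hM0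
    ((isOpen_piece n (orb f k x)).preimage (itp f k).continuous).connectedComponentIn
    (isOpen_diff_preimage_component (isOpen_piece n (orb f k x)) x) hM
  refine this.mono Subset.rfl (fun z hz => ⟨hB hz, ?_⟩) le_rfl
  rw [itp_eval]
  exact hBA z hz

lemma subsingleton_of_caps {K : Set ℂ} (hK : IsPreconnected K) {L : ℕ → Set ℂ} {C R : ℝ}
    (hL : ∀ i, L (i + 1) ⊆ L i) (hKL : ∀ i, K ⊆ L i) (hLR : L 0 ⊆ ball 0 R)
    (h : ∀ i, HasCap (L i) (L (i + 1)) C) : K.Subsingleton := by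
  refine subsingleton_of_hasCap (R := R) hK fun ε hε => ?_
  obtain ⟨M, hM⟩ := exists_nat_gt (C / ε)
  have hM' : C / ε < (M + 1 : ℕ) := by
    push_cast
    linarith
  refine (HasCap.chain hL h (Nat.succ_pos M)).mono hLR (hKL _) ?_
  rw [div_le_iff₀ (by positivity)]
  rw [div_lt_iff₀ hε] at hM'
  linarith

lemma piece_subset_ball (hR : EscR f R) (n : ℕ) (z : ℂ) : piece f R n z ⊆ ball 0 R := by
  intro w hw
  have := lt_of_mem_piece (piece_anti hR (Nat.zero_le n) z hw)
  simpa using this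

/-- Infinitely many annuli of bounded capacity shrink the component to a point. -/
lemma subsingleton_of_frequently_hasCap (hf : 2 ≤ f.natDegree) (hR : EscR f R) {x : ℂ}
    (hx : x ∈ filled f R) {C : ℝ}
    (h : ∀ L, ∃ l ≥ L, HasCap (piece f R l x) (piece f R (l + 1) x) C) :
    (connectedComponentIn (filled f R) x).Subsingleton := by
  choose l hl hcap using h
  set s : ℕ → ℕ := fun i => (fun n => l (n + 1))^[i] (l 0) with hs
  have hstep : ∀ i, s (i + 1) = l (s i + 1) := fun i => by
    simp only [hs, Function.iterate_succ_apply']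
  have hcs : ∀ i, HasCap (piece f R (s i) x) (piece f R (s i + 1) x) C := by
    intro i
    cases i with
    | zero => exact hcap 0
    | succ i => rw [hstep]; exact hcap _
  refine subsingleton_of_caps isPreconnected_connectedComponentIn
    (L := fun i => piece f R (s i) x) (C := C) (R := R) ?_ ?_ (piece_subset_ball hR _ _) ?_
  · intro i
    refine piece_anti hR ?_ x
    rw [hstep]
    exact (Nat.le_succ _).trans (hl _)
  · intro i
    rw [← iInter_piece hf hR hx]
    exact iInter_subset _ _
  · intro i
    refine (hcs i).mono Subset.rfl (piece_anti hR ?_ x) le_rfl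
    rw [hstep]
    exact hl _

lemma holeFree_piece (n : ℕ) (z : ℂ) : HoleFree (piece f R n z) := by
  intro p hp s hs
  by_contra hcon
  push Not at hcon
  have hsph : sphere p s ⊆ piece f R n z := fun w hw => hcon w hw
  have hbd : closedBall p s ⊆ (fun w => (itp f n).eval w) ⁻¹' ball 0 R := by
    intro w hw
    rw [mem_preimage, mem_ball_zero_iff]
    obtain ⟨v, hv, hmax⟩ := (isCompact_sphere p s).exists_isMaxOn
      (NormedSpace.sphere_nonempty.2 hs.le) (itp f n).continuous.norm.continuousOn
    have h1 := Complex.norm_le_of_forall_mem_frontier_norm_le (U := ball p s) isBounded_ball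
      (f := fun w => (itp f n).eval w) (C := ‖(itp f n).eval v‖)
      ((itp f n).differentiable.diffContOnCl) (fun u hu => by
        rw [frontier_ball p hs.ne'] at hu
        exact hmax hu) (z := w) (by rwa [closure_ball p hs.ne'])
    exact h1.trans_lt (by simpa using lt_of_mem_piece (hsph hv))
  obtain ⟨v, hv⟩ := NormedSpace.sphere_nonempty (x := p).2 hs.le
  have h2 : p ∈ piece f R n v := by
    refine (convex_closedBall p s).isPreconnected.subset_connectedComponentIn
      (sphere_subset_closedBall hv) hbd (mem_closedBall_self hs.le)
  rw [← piece_eq (hsph hv)] at h2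
  exact hp h2

/-- The finite set of critical points. -/
noncomputable def crits (f : Polynomial ℂ) : Finset ℂ := f.derivative.roots.toFinset

lemma mem_crits (hf : 2 ≤ f.natDegree) {c : ℂ} : c ∈ crits f ↔ f.derivative.eval c = 0 := by
  have h : f.derivative ≠ 0 := fun h0 => by
    have := Polynomial.derivative_eq_zero.1 h0
    omega
  rw [crits, Multiset.mem_toFinset, Polynomial.mem_roots h, Polynomial.IsRoot]

open Classical in
/-- The times `i < k` at which the piece of depth `n + k` around `z` passes over `c`. -/
noncomputable def hits (f : Polynomial ℂ) (R : ℝ) (n k : ℕ) (z c : ℂ) : Finset ℕ :=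
  (Finset.range k).filter fun i => c ∈ piece f R (n + (k - i)) (orb f i z)

lemma mem_hits {n k i : ℕ} {z c : ℂ} :
    i ∈ hits f R n k z c ↔ i < k ∧ c ∈ piece f R (n + (k - i)) (orb f i z) := by
  classical
  rw [hits, Finset.mem_filter, Finset.mem_range]

lemma injOn_piece (hf : 2 ≤ f.natDegree) {n : ℕ} {z : ℂ} (hz : ‖orb f (n + 1) z‖ < R)
    (h : ∀ c ∈ piece f R (n + 1) z, f.derivative.eval c ≠ 0) :
    InjOn (fun w => f.eval w) (piece f R (n + 1) z) := by
  rw [← piece_add_eq 1 n hz] at h ⊢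
  rw [itp_one] at h ⊢
  exact injOn_component (by omega) (itp_natDegree_pos hf n) h

lemma multLE_piece_of_subset (hf : 2 ≤ f.natDegree) (k : ℕ) : ∀ (n : ℕ) (z : ℂ) (S : Finset ℕ),
    ‖orb f (n + k) z‖ < R → (∀ c ∈ crits f, hits f R n k z c ⊆ S) →
    MultLE (itp f k) (piece f R (n + k) z) ((f.natDegree : ℝ) ^ S.card) := by
  classical
  induction k with
  | zero =>
    intro n z S hz hS
    have hd : (1 : ℝ) ≤ f.natDegree := by exact_mod_cast (by omega : 1 ≤ f.natDegree)
    refine (multLE_one fun a _ b _ hab => ?_).mono Subset.rfl (one_le_pow₀ hd)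
    simpa using hab
  | succ k ih =>
    intro n z S hz hS
    have hd : (1 : ℝ) ≤ f.natDegree := by exact_mod_cast (by omega : 1 ≤ f.natDegree)
    set S' : Finset ℕ := (S.erase 0).image (fun i => i - 1) with hS'
    have h1 := ih n (f.eval z) S' (by rwa [← orb_succ]) (by
      intro c hc i hi
      rw [mem_hits] at hi
      have : i + 1 ∈ S := hS c hc (mem_hits.2 ⟨by omega, by
        rw [orb_succ, Nat.add_sub_add_right]
        exact hi.2⟩)
      exact Finset.mem_image.2 ⟨i + 1, Finset.mem_erase.2 ⟨by omega, this⟩, by omega⟩)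
    have hmap : ∀ w ∈ piece f R (n + (k + 1)) z, f.eval w ∈ piece f R (n + k) (f.eval z) :=
      fun w hw => orb_mem_piece (k := 1) (n := n + k) hw
    rw [itp_add, itp_one]
    by_cases hcr : ∃ c ∈ crits f, c ∈ piece f R (n + (k + 1)) z
    · obtain ⟨c, hc, hcz⟩ := hcr
      have h0 : 0 ∈ S := hS c hc (mem_hits.2 ⟨by omega, by simpa using hcz⟩)
      have h2 := (multLE_natDegree (F := f) (by omega) (piece f R (n + (k + 1)) z)).comp
        (by positivity) h1 hmap
      refine h2.mono Subset.rfl ?_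
      rw [← pow_succ]
      refine pow_le_pow_right₀ hd ?_
      have h3 : S'.card ≤ (S.erase 0).card := Finset.card_image_le
      rw [Finset.card_erase_of_mem h0] at h3
      have : 0 < S.card := Finset.card_pos.2 ⟨0, h0⟩
      omega
    · push Not at hcr
      have h2 := (multLE_one (injOn_piece hf (n := n + k) hz fun c hc h0 =>
        hcr c ((mem_crits hf).2 h0) hc)).comp zero_le_one h1 hmap
      refine h2.mono Subset.rfl ?_
      rw [mul_one]
      refine pow_le_pow_right₀ hd ?_
      exact Finset.card_image_le.trans (Finset.card_le_card (Finset.erase_subset _ _))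

lemma multLE_piece (hf : 2 ≤ f.natDegree) {n k : ℕ} {z : ℂ} {m : ℕ}
    (hz : ‖orb f (n + k) z‖ < R) (hm : ∀ c ∈ crits f, (hits f R n k z c).card ≤ m) :
    MultLE (itp f k) (piece f R (n + k) z) ((f.natDegree : ℝ) ^ ((crits f).card * m)) := by
  classical
  have hd : (1 : ℝ) ≤ f.natDegree := by exact_mod_cast (by omega : 1 ≤ f.natDegree)
  refine (multLE_piece_of_subset hf k n z ((crits f).biUnion fun c => hits f R n k z c) hz
    fun c hc => Finset.subset_biUnion_of_mem (fun c => hits f R n k z c) hc).mono Subset.rfl ?_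
  exact pow_le_pow_right₀ hd (Finset.card_biUnion_le_card_mul _ _ _ hm)

lemma exists_crit_of_derivative_itp (hf : 2 ≤ f.natDegree) {q : ℕ} {x : ℂ}
    (h : (itp f q).derivative.eval x = 0) : ∃ i < q, orb f i x ∈ crits f := by
  induction q with
  | zero => simp [itp] at h
  | succ q ih =>
    rw [add_comm, itp_add, itp_one, Polynomial.derivative_comp, Polynomial.eval_mul,
      Polynomial.eval_comp, itp_eval, mul_eq_zero] at h
    rcases h with h | h
    · obtain ⟨i, hi, hc⟩ := ih h
      exact ⟨i, by omega, hc⟩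
    · exact ⟨q, by omega, (mem_crits hf).2 h⟩

/-- The covering lemma for pieces. -/
theorem covering_piece : ∃ C : ℝ, 0 < C ∧ ∀ (f : Polynomial ℂ) (R : ℝ) (q n n1 n2 m d' : ℕ) (w : ℂ)
    (Eφ Eψ : ℝ), 2 ≤ f.natDegree → EscR f R → n ≤ n1 → n1 ≤ n2 → ‖orb f (n2 + q) w‖ < R →
    0 ≤ Eφ → 0 ≤ Eψ →
    (∀ c ∈ crits f, (hits f R n q w c).card ≤ m) →
    (∀ c ∈ crits f, (hits f R n1 q w c).card ≤ d') →
    HasCap (piece f R n (orb f q w)) (piece f R n2 (orb f q w)) Eφ →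
    HasCap (piece f R n1 (orb f q w)) (piece f R n2 (orb f q w)) Eψ →
    HasCap (piece f R (n + q) w) (piece f R (n2 + q) w)
      (C * (((crits f).card * m + 1) * (f.natDegree : ℝ) ^ ((crits f).card * m) +
        (f.natDegree : ℝ) ^ ((crits f).card * d') * √(Eφ * (Eφ + Eψ)))) := by
  classical
  obtain ⟨C, hC, h⟩ := covering_lemma
  refine ⟨C, hC, ?_⟩
  intro f R q n n1 n2 m d' w Eφ Eψ hf hR hn hn1 hw hφ0 hψ0 hm hd hφ hψ
  have hw1 : ‖orb f (n1 + q) w‖ < R := hR.orb_lt_of_le (by omega) hw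
  have hw0 : ‖orb f (n + q) w‖ < R := hR.orb_lt_of_le (by omega) hw
  set CV : Finset ℂ := (crits f).biUnion fun c =>
    (hits f R n q w c).image fun i => orb f (q - i) c with hCV
  have hcard : CV.card ≤ (crits f).card * m :=
    Finset.card_biUnion_le_card_mul _ _ _ fun c hc => Finset.card_image_le.trans (hm c hc)
  have key := h (itp f q) (piece f R n (orb f q w)) (piece f R n1 (orb f q w))
    (piece f R n2 (orb f q w)) w CV ((f.natDegree : ℝ) ^ ((crits f).card * m))
    ((f.natDegree : ℝ) ^ ((crits f).card * d')) Eφ Eψ (itp_natDegree_pos hf q) (isOpen_piece _ _)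
    (isBounded_ball.subset (piece_subset_ball hR _ _)) (holeFree_piece _ _)
    (isPreconnected_piece _ _) (isOpen_piece _ _) (piece_anti hR hn1 _) (piece_anti hR hn _)
    (by rw [itp_eval]; exact mem_piece_self (by rwa [← orb_add])) (by positivity) (by positivity)
    hφ0 hψ0
  rw [piece_add_eq q n hw0, piece_add_eq q n1 hw1, piece_add_eq q n2 hw] at key
  refine (key (multLE_piece hf hw0 hm) (multLE_piece hf hw1 hd) ?_ hφ hψ).mono Subset.rfl
    Subset.rfl ?_
  · intro y r hyr hcv z hz hzy
    have hr : 0 < r := pos_of_mem_ball hzy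
    refine injOn_component_ball (itp_natDegree_pos hf q) hr fun x hx h0 => ?_
    obtain ⟨i, hi, hc⟩ := exists_crit_of_derivative_itp hf h0
    have hxy : orb f q x ∈ ball y r := by
      have := (connectedComponentIn_subset _ _ hx : x ∈ (fun w => (itp f q).eval w) ⁻¹' ball y r)
      simpa using this
    have hxU : x ∈ piece f R (n + q) w := by
      have hsub : connectedComponentIn ((fun w => (itp f q).eval w) ⁻¹' ball y r) z ⊆
          connectedComponentIn ((fun w => (itp f q).eval w) ⁻¹' piece f R n (orb f q w)) z :=
        connectedComponentIn_mono z (preimage_mono hyr)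
      rw [← piece_add_eq q n hw0] at hz ⊢
      rw [connectedComponentIn_eq hz]
      exact hsub hx
    have hit : i ∈ hits f R n q w (orb f i x) := by
      rw [mem_hits]
      refine ⟨hi, orb_mem_piece (k := i) ?_⟩
      rw [show n + (q - i) + i = n + q by omega]
      exact hxU
    refine hcv (orb f (q - i) (orb f i x)) ?_ ?_
    · exact Finset.mem_biUnion.2 ⟨_, hc, Finset.mem_image.2 ⟨i, hit, rfl⟩⟩
    · rw [← orb_add, Nat.sub_add_cancel hi.le]
      exact hxy
  · have : (CV.card : ℝ) ≤ (crits f).card * m := by exact_mod_cast hcard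
    gcongr

lemma mem_piece_trans {n : ℕ} {x y z : ℂ} (h : y ∈ piece f R n x) (h' : z ∈ piece f R n y) :
    z ∈ piece f R n x := by
  rwa [piece_eq h]

/-- Shift a membership along an iterate, with arithmetic on depths and times left to the caller. -/
lemma orb_mem_piece_of_eq {k n m : ℕ} {z w : ℂ} (h : w ∈ piece f R m z) (hm : m = n + k) :
    orb f k w ∈ piece f R n (orb f k z) := orb_mem_piece (hm ▸ h)

lemma hits_congr {n k : ℕ} {z w c : ℂ} (h : w ∈ piece f R (n + k) z) :
    hits f R n k w c = hits f R n k z c := by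
  ext i
  rw [mem_hits, mem_hits, and_congr_right_iff]
  intro hi
  rw [piece_eq (orb_mem_piece_of_eq (k := i) (n := n + (k - i)) h (by omega))]

lemma hits_add_card_le (n k l : ℕ) (z c : ℂ) : (hits f R n (k + l) z c).card ≤
    (hits f R (n + l) k z c).card + (hits f R n l (orb f k z) c).card := by
  classical
  have hsub : hits f R n (k + l) z c ⊆
      hits f R (n + l) k z c ∪ (hits f R n l (orb f k z) c).image (fun i => i + k) := by
    intro i hi
    rw [mem_hits] at hi
    rw [Finset.mem_union]
    by_cases hik : i < k
    · left
      rw [mem_hits]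
      refine ⟨hik, ?_⟩
      rw [show n + l + (k - i) = n + (k + l - i) by omega]
      exact hi.2
    · right
      refine Finset.mem_image.2 ⟨i - k, ?_, by omega⟩
      rw [mem_hits]
      refine ⟨by omega, ?_⟩
      rw [← orb_add, show i - k + k = i by omega,
        show n + (l - (i - k)) = n + (k + l - i) by omega]
      exact hi.2
  refine (Finset.card_le_card hsub).trans ((Finset.card_union_le _ _).trans ?_)
  exact Nat.add_le_add le_rfl Finset.card_image_le

/-- Before the first entry into a piece, every critical point is met at most once. -/
lemma hits_first_entry (hR : EscR f R) {n k : ℕ} {z y : ℂ} (hlt : ∀ i < k, orb f i z ∉ piece f R n y)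
    (hk : orb f k z ∈ piece f R n y) (c : ℂ) : (hits f R n k z c).card ≤ 1 := by
  have key : ∀ i j, i < j → i ∈ hits f R n k z c → j ∈ hits f R n k z c → False := by
    intro i j hij hi hj
    rw [mem_hits] at hi hj
    refine hlt (i + (k - j)) (by omega) ?_
    have h1 : orb f (k - j) c ∈ piece f R n (orb f (k - j) (orb f j z)) := orb_mem_piece hj.2
    rw [← orb_add, Nat.sub_add_cancel hj.1.le] at h1
    have h2 : orb f (k - j) c ∈ piece f R (n + (j - i)) (orb f (k - j) (orb f i z)) :=
      orb_mem_piece_of_eq hi.2 (by omega)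
    rw [← orb_add'] at h2
    have h3 := mem_piece_symm (piece_anti hR (Nat.le_add_right n (j - i)) _ h2)
    exact mem_piece_trans (mem_piece_trans hk h1) h3
  rw [Finset.card_le_one]
  intro i hi j hj
  rcases lt_trichotomy i j with h | h | h
  · exact (key i j h hi hj).elim
  · exact h
  · exact (key j i h hj hi).elim

lemma subsingleton_of_hits (hf : 2 ≤ f.natDegree) (hR : EscR f R) {x : ℂ} (hx : x ∈ filled f R)
    (n M : ℕ) (h : ∀ L, ∃ k ≥ L, ∀ c ∈ crits f, (hits f R n k x c).card ≤ M) :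
    (connectedComponentIn (filled f R) x).Subsingleton := by
  refine subsingleton_of_frequently_hasCap hf hR hx (C := (f.natDegree : ℝ) ^ ((crits f).card * M) *
    (f.natDegree ^ n * (16 * Real.pi))) fun L => ?_
  obtain ⟨k, hk, hc⟩ := h L
  refine ⟨n + k, by omega, ?_⟩
  refine HasCap.pull hf (by positivity) (hx _) (hasCap_piece hf hR n (orb f k x))
    (piece_succ_subset hR _ _) (fun z hz => ?_) (multLE_piece hf (hx _) hc)
  exact orb_mem_piece_of_eq hz (by omega)

/-- The orbit of `x` enters every piece around `c` infinitely often. -/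
def Acc (f : Polynomial ℂ) (R : ℝ) (x c : ℂ) : Prop :=
  ∀ n m, ∃ k ≥ m, orb f k x ∈ piece f R n c

lemma Acc.mem_filled {x c : ℂ} (h : Acc f R x c) : c ∈ filled f R := by
  intro n
  obtain ⟨k, -, hk⟩ := h n 0
  exact lt_of_mem_piece (mem_piece_symm hk)

lemma Acc.trans {x y c : ℂ} (h : Acc f R x y) (h' : Acc f R y c) : Acc f R x c := by
  intro n m
  obtain ⟨j, hj, hjc⟩ := h' n m
  obtain ⟨k, -, hk⟩ := h (n + j) 0
  refine ⟨j + k, by omega, ?_⟩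
  rw [orb_add]
  exact mem_piece_trans hjc (orb_mem_piece hk)

lemma Acc.orb_right {x c : ℂ} (h : Acc f R x c) (i : ℕ) : Acc f R x (orb f i c) := by
  intro n m
  obtain ⟨k, hk, hkc⟩ := h (n + i) m
  refine ⟨i + k, by omega, ?_⟩
  rw [orb_add]
  exact orb_mem_piece hkc

lemma Acc.orb_left {x c : ℂ} (h : Acc f R x c) (i : ℕ) : Acc f R (orb f i x) c := by
  intro n m
  obtain ⟨k, hk, hkc⟩ := h n (m + i)
  refine ⟨k - i, by omega, ?_⟩
  rwa [← orb_add, Nat.sub_add_cancel (by omega)]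

/-- If no critical point is accumulated, the orbit finally avoids some neighbourhood of them. -/
lemma exists_avoid (hR : EscR f R) {x : ℂ} (h : ∀ c ∈ crits f, ¬ Acc f R x c) :
    ∃ n m, ∀ k ≥ m, ∀ c ∈ crits f, orb f k x ∉ piece f R n c := by
  have h' : ∀ c, ∃ n m, c ∈ crits f → ∀ k ≥ m, orb f k x ∉ piece f R n c := by
    intro c
    by_cases hc : c ∈ crits f
    · have := h c hc
      simp only [Acc] at this
      push Not at this
      obtain ⟨n, m, h1⟩ := this
      exact ⟨n, m, fun _ => h1⟩
    · exact ⟨0, 0, fun h => absurd h hc⟩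
  choose N M hNM using h'
  refine ⟨(crits f).sup N, (crits f).sup M, fun k hk c hc hmem => ?_⟩
  exact hNM c hc k ((Finset.le_sup (f := M) hc).trans hk)
    (piece_anti hR (Finset.le_sup (f := N) hc) c hmem)

lemma subsingleton_of_no_acc (hf : 2 ≤ f.natDegree) (hR : EscR f R) {x : ℂ} (hx : x ∈ filled f R)
    (h : ∀ c ∈ crits f, ¬ Acc f R x c) : (connectedComponentIn (filled f R) x).Subsingleton := by
  obtain ⟨n, m, hnm⟩ := exists_avoid hR h
  refine subsingleton_of_hits hf hR hx n m fun L => ⟨L, le_rfl, fun c hc => ?_⟩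
  have : hits f R n L x c ⊆ Finset.range m := by
    intro i hi
    rw [mem_hits] at hi
    rw [Finset.mem_range]
    by_contra hcon
    exact hnm i (not_lt.1 hcon) c hc (mem_piece_symm (piece_anti hR (Nat.le_add_right _ _) _ hi.2))
  simpa using Finset.card_le_card this

lemma exists_first_entry {x c : ℂ} (h : Acc f R x c) (n : ℕ) :
    ∃ k, orb f k x ∈ piece f R n c ∧ ∀ i < k, orb f i x ∉ piece f R n c := by
  classical
  have h1 : ∃ k, orb f k x ∈ piece f R n c := by
    obtain ⟨k, -, hk⟩ := h n 0
    exact ⟨k, hk⟩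
  exact ⟨Nat.find h1, Nat.find_spec h1, fun i hi => Nat.find_min h1 hi⟩

lemma subsingleton_of_acc_no_acc (hf : 2 ≤ f.natDegree) (hR : EscR f R) {x c : ℂ}
    (hx : x ∈ filled f R) (hxc : Acc f R x c) (h : ∀ c' ∈ crits f, ¬ Acc f R c c') :
    (connectedComponentIn (filled f R) x).Subsingleton := by
  obtain ⟨n, m, hnm⟩ := exists_avoid hR h
  refine subsingleton_of_hits hf hR hx n (1 + m) fun L => ?_
  obtain ⟨k, hk, hlt⟩ := exists_first_entry hxc (n + L)
  refine ⟨k + L, by omega, fun c' hc' => ?_⟩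
  refine (hits_add_card_le n k L x c').trans (add_le_add (hits_first_entry hR hlt hk c') ?_)
  rw [hits_congr hk]
  have : hits f R n L c c' ⊆ Finset.range m := by
    intro i hi
    rw [mem_hits] at hi
    rw [Finset.mem_range]
    by_contra hcon
    exact hnm i (not_lt.1 hcon) c' hc'
      (mem_piece_symm (piece_anti hR (Nat.le_add_right _ _) _ hi.2))
  simpa using Finset.card_le_card this

lemma mem_piece_succ_of_crits (hf : 2 ≤ f.natDegree) (hR : EscR f R) {a b : ℕ} (hab : a ≤ b)
    {z w : ℂ} (hz : ‖orb f (b + 1) z‖ < R)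
    (hcrit : ∀ c ∈ crits f, c ∈ piece f R (a + 1) z → f.eval c ∈ piece f R b (f.eval z))
    (hw : w ∈ piece f R (a + 1) z) (hfw : f.eval w ∈ piece f R b (f.eval z)) :
    w ∈ piece f R (b + 1) z := by
  have hza : ‖orb f (a + 1) z‖ < R := hR.orb_lt_of_le (by omega) hz
  have e1 := piece_add_eq 1 a hza
  have e2 := piece_add_eq 1 b hz
  rw [itp_one, orb_one] at e1 e2
  rw [← e1] at hw
  rw [← e2]
  refine mem_component_of_crit (F := f) (G := itp f a) (G₂ := itp f b) (z₀ := z) (by omega)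
    (itp_natDegree_pos hf a) (itp_natDegree_pos hf b)
    (piece_anti hR hab (f.eval z)) (fun c hc h0 => ?_) ?_ hw ?_ hfw
  · refine hcrit c ((mem_crits hf).2 h0) ?_
    rw [← e1]
    exact hc
  · rw [show connectedComponentIn ((fun w => f.eval w) ⁻¹' lowComp (itp f a) R (f.eval z)) z =
      piece f R (a + 1) z from e1]
    exact mem_piece_self hza
  · exact mem_piece_self (by rwa [orb_succ] at hz)

lemma exists_separating_depth (hR : EscR f R) {c : ℂ} {τ : ℕ} (hτ : 1 ≤ τ)
    (hper : ∀ l, orb f τ c ∈ piece f R l c) :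
    ∃ n, ∀ j, ∀ c' ∈ crits f, c' ∈ piece f R n (orb f j c) → ∀ l, c' ∈ piece f R l (orb f j c) := by
  have hp : ∀ l, Function.Periodic (fun j => piece f R l (orb f j c)) τ := by
    intro l j
    have h := orb_mem_piece_of_eq (k := j) (n := l) (hper (l + j)) rfl
    rw [← orb_add] at h
    exact (piece_eq h).symm
  have h' : ∀ j c', ∃ n, c' ∈ piece f R n (orb f j c) → ∀ l, c' ∈ piece f R l (orb f j c) := by
    intro j c'
    by_cases h : ∀ l, c' ∈ piece f R l (orb f j c)
    · exact ⟨0, fun _ => h⟩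
    · push Not at h
      obtain ⟨n, hn⟩ := h
      exact ⟨n, fun h => absurd h hn⟩
  choose N hN using h'
  set n := (Finset.range τ).sup fun j => (crits f).sup (N j) with hn
  refine ⟨n, fun j c' hc' hmem l => ?_⟩
  have e1 : ∀ l, piece f R l (orb f (j % τ) c) = piece f R l (orb f j c) :=
    fun l => (hp l).map_mod_nat j
  rw [← e1] at hmem ⊢
  refine hN (j % τ) c' (piece_anti hR ?_ _ hmem) l
  have h1 : N (j % τ) c' ≤ (crits f).sup (N (j % τ)) := Finset.le_sup hc'
  have h2 : (crits f).sup (N (j % τ)) ≤ n :=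
    Finset.le_sup (f := fun j => (crits f).sup (N j)) (Finset.mem_range.2 (Nat.mod_lt j hτ))
  omega

lemma subsingleton_of_acc_periodic (hf : 2 ≤ f.natDegree) (hR : EscR f R) {x c : ℂ}
    (hx : x ∈ filled f R) (hxc : Acc f R x c) {τ : ℕ} (hτ : 1 ≤ τ)
    (hper : ∀ l, orb f τ c ∈ piece f R l c) (hnot : ∀ n, ∃ l, orb f n x ∉ piece f R l c) :
    (connectedComponentIn (filled f R) x).Subsingleton := by
  classical
  have hc : c ∈ filled f R := hxc.mem_filled
  obtain ⟨n0, hn0⟩ := exists_separating_depth hR hτ hper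
  set s := n0 + 1 with hs
  have hsep : ∀ j, ∀ c' ∈ crits f, c' ∈ piece f R s (orb f j c) →
      ∀ l, c' ∈ piece f R l (orb f j c) :=
    fun j c' hc' h => hn0 j c' hc' (piece_succ_subset hR _ _ h)
  refine subsingleton_of_hits hf hR hx s 1 fun L => ?_
  obtain ⟨k, hk, hlt⟩ := exists_first_entry hxc (s + L)
  set y := orb f k x with hy
  have hyf : y ∈ filled f R := mem_filled_orb hx k
  have hex : ∃ i, orb f i y ∉ piece f R s (orb f i c) := by
    by_contra hcon
    push Not at hcon
    have key : ∀ t, ∀ i, orb f i y ∈ piece f R (s + t) (orb f i c) := by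
      intro t
      induction t with
      | zero => exact hcon
      | succ t ih =>
        intro i
        refine mem_piece_succ_of_crits hf hR (a := n0 + t) (b := s + t) (by omega)
          (mem_filled_orb hc i _) ?_ ?_ ?_
        · intro c' hc' hmem
          have h1 := hsep i c' hc' (piece_anti hR (by omega) _ hmem) (s + t + 1)
          exact orb_mem_piece (k := 1) h1
        · have := ih i
          rwa [show s + t = n0 + t + 1 by omega] at this
        · have := ih (i + 1)
          rwa [orb_succ', orb_succ'] at this
    obtain ⟨l, hl⟩ := hnot k
    exact hl (piece_anti hR (by omega) _ (key l 0))
  set j := Nat.find hex with hj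
  have hjspec : orb f j y ∉ piece f R s (orb f j c) := Nat.find_spec hex
  have hjmin : ∀ i < j, orb f i y ∈ piece f R s (orb f i c) := fun i hi =>
    not_not.1 (Nat.find_min hex hi)
  have hLj : L < j := by
    by_contra hcon
    refine hjspec (piece_anti hR (show s ≤ s + (L - j) by omega) _ ?_)
    exact orb_mem_piece_of_eq hk (by omega)
  refine ⟨k + j, by omega, fun c' hc' => ?_⟩
  refine (hits_add_card_le s k j x c').trans (?_ : _ ≤ 1 + 0)
  refine add_le_add ?_ ?_
  · refine (Finset.card_le_card fun i hi => ?_).trans (hits_first_entry hR hlt hk c')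
    rw [mem_hits] at hi ⊢
    exact ⟨hi.1, piece_anti hR (by omega) _ hi.2⟩
  · rw [Nat.le_zero, Finset.card_eq_zero, Finset.eq_empty_iff_forall_notMem]
    intro i hi
    rw [mem_hits] at hi
    have h1 : c' ∈ piece f R s (orb f i c) :=
      mem_piece_trans (hjmin i hi.1) (piece_anti hR (Nat.le_add_right _ _) _ hi.2)
    have h2 := hsep i c' hc' h1 (s + (j - i))
    have h3 : orb f (j - i) c' ∈ piece f R s (orb f (j - i) (orb f i c)) := orb_mem_piece h2
    have h4 : orb f (j - i) c' ∈ piece f R s (orb f (j - i) (orb f i y)) := orb_mem_piece hi.2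
    rw [← orb_add, Nat.sub_add_cancel hi.1.le] at h3 h4
    exact hjspec (mem_piece_trans h3 (mem_piece_symm h4))

/-- `Ω` is a minimal set of mutually recurrent critical points, `c₀ ∈ Ω` is not periodic, and
pieces of depth `N₀` along the orbit of `c₀` contain no further critical points. -/
structure MinimalSet (f : Polynomial ℂ) (R : ℝ) (Ω : Finset ℂ) (c₀ : ℂ) (N₀ : ℕ) : Prop where
  mem : c₀ ∈ Ω
  sub : Ω ⊆ crits f
  acc : ∀ c ∈ Ω, ∀ c' ∈ Ω, Acc f R c c'
  nonper : ∀ τ ≥ 1, ∃ l, orb f τ c₀ ∉ piece f R l c₀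
  sep : ∀ c ∈ crits f, c ∉ Ω → ∀ i, c ∉ piece f R N₀ (orb f i c₀)

/-- A post-critical point lying in a piece around `c₀` but outside the return domain. -/
lemma MinimalSet.exists_outside {Ω : Finset ℂ} {c₀ : ℂ} {N₀ : ℕ} (H : MinimalSet f R Ω c₀ N₀)
    (hf : 2 ≤ f.natDegree) (hR : EscR f R) {N r : ℕ} (hN : N₀ ≤ N) (hr : 1 ≤ r)
    (hret : orb f r c₀ ∈ piece f R N c₀) :
    ∃ c ∈ Ω, ∃ i, orb f i c ∈ piece f R N c₀ ∧ orb f i c ∉ piece f R (N + r) c₀ := by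
  by_contra hcon
  push Not at hcon
  have hc₀ : c₀ ∈ filled f R := (H.acc _ H.mem _ H.mem).mem_filled
  have key : ∀ k, ∀ c ∈ Ω, ∀ i, orb f i c ∈ piece f R N c₀ →
      orb f i c ∈ piece f R (N + k * r) c₀ := by
    intro k
    induction k with
    | zero => intro c hc i hi; simpa using hi
    | succ k ih =>
      intro c hc i hi
      have hrV : orb f r c₀ ∈ piece f R (N + k * r) c₀ := ih c₀ H.mem r hret
      have down : ∀ e, e ≤ r → ∀ z ∈ piece f R (N + e) (orb f (r - e) c₀),
          orb f e z ∈ piece f R (N + k * r) c₀ →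
          z ∈ piece f R (N + k * r + e) (orb f (r - e) c₀) := by
        intro e
        induction e with
        | zero =>
          intro _ z _ hz
          exact mem_piece_trans (mem_piece_symm hrV) hz
        | succ e ihe =>
          intro he z hz hzV
          have hstep : orb f (r - e) c₀ = f.eval (orb f (r - (e + 1)) c₀) := by
            rw [← orb_succ', show r - (e + 1) + 1 = r - e by omega]
          have hmap : ∀ w ∈ piece f R (N + (e + 1)) (orb f (r - (e + 1)) c₀),
              f.eval w ∈ piece f R (N + e) (orb f (r - e) c₀) := by
            intro w hw
            rw [hstep]
            exact orb_mem_piece (k := 1) (n := N + e) hw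
          refine mem_piece_succ_of_crits hf hR (a := N + e) (b := N + k * r + e) (by omega)
            (mem_filled_orb hc₀ _ _) ?_ hz ?_
          · intro c' hc' hmem
            rw [← hstep]
            refine ihe (by omega) _ (hmap c' hmem) ?_
            rw [← orb_succ]
            have hc'Ω : c' ∈ Ω := by
              by_contra h
              exact H.sep c' hc' h _ (piece_anti hR (by omega) _ hmem)
            refine ih c' hc'Ω (e + 1) ?_
            have h1 : orb f (e + 1) c' ∈ piece f R N (orb f (e + 1) (orb f (r - (e + 1)) c₀)) :=
              orb_mem_piece_of_eq hmem (by omega)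
            rw [← orb_add, show e + 1 + (r - (e + 1)) = r by omega] at h1
            exact mem_piece_trans hret h1
          · rw [← hstep]
            exact ihe (by omega) _ (hmap z hz) (by rwa [← orb_succ])
      have h1 := hcon c hc i hi
      have h2 : orb f r (orb f i c) ∈ piece f R (N + k * r) c₀ := by
        rw [← orb_add]
        refine ih c hc (r + i) ?_
        rw [orb_add]
        exact mem_piece_trans hret (orb_mem_piece h1)
      have h3 := down r le_rfl (orb f i c) (by simpa using h1) h2
      rw [Nat.sub_self, orb_zero] at h3
      rwa [show N + (k + 1) * r = N + k * r + r by ring]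
  obtain ⟨l, hl⟩ := H.nonper r hr
  refine hl (piece_anti hR ?_ _ (key l c₀ H.mem r hret))
  nlinarith

lemma exists_first_return {x c : ℂ} (h : Acc f R x c) (n : ℕ) :
    ∃ k, 1 ≤ k ∧ orb f k x ∈ piece f R n c ∧ ∀ i, 1 ≤ i → i < k → orb f i x ∉ piece f R n c := by
  classical
  have h1 : ∃ k, 1 ≤ k ∧ orb f k x ∈ piece f R n c := h n 1
  refine ⟨Nat.find h1, (Nat.find_spec h1).1, (Nat.find_spec h1).2, fun i hi hlt hmem => ?_⟩
  exact Nat.find_min h1 hlt ⟨hi, hmem⟩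

lemma hits_card_le (n k : ℕ) (z c : ℂ) : (hits f R n k z c).card ≤ k := by
  classical
  rw [hits]
  refine (Finset.card_filter_le _ _).trans ?_
  simp

lemma hits_first_return (hR : EscR f R) {n k : ℕ} {z y : ℂ} (hk1 : 1 ≤ k)
    (hlt : ∀ i, 1 ≤ i → i < k → orb f i z ∉ piece f R n y)
    (hk : orb f k z ∈ piece f R n y) (c : ℂ) : (hits f R n k z c).card ≤ 2 := by
  obtain ⟨k, rfl⟩ : ∃ k', k = 1 + k' := ⟨k - 1, by omega⟩
  refine (hits_add_card_le n 1 k z c).trans (?_ : _ ≤ 1 + 1)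
  refine add_le_add ?_ (hits_first_entry hR (y := y) (fun i hi => ?_) ?_ c)
  · exact hits_card_le _ _ _ _
  · rw [← orb_add]
    exact hlt _ (by omega) (by omega)
  · rwa [← orb_add, add_comm]

/-- One step of the nest around `c₀`. -/
lemma MinimalSet.nest_step {Ω : Finset ℂ} {c₀ : ℂ} {N₀ : ℕ} (H : MinimalSet f R Ω c₀ N₀)
    (hf : 2 ≤ f.natDegree) (hR : EscR f R) {N : ℕ} (hN : N₀ ≤ N) :
    ∃ p, 1 ≤ p ∧ orb f p c₀ ∈ piece f R N c₀ ∧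
      (∀ c ∈ crits f, (hits f R N p c₀ c).card ≤ 4) ∧
      (∀ i, 1 ≤ i → i < p → c₀ ∉ piece f R (N + (p - i)) (orb f i c₀)) ∧
      ∃ t e : ℕ, 1 ≤ t ∧ 1 ≤ e ∧ p = t + e ∧ (∃ z ∈ piece f R N c₀, orb f t z ∈ piece f R N c₀) ∧
        ∃ z ∈ piece f R N c₀, orb f e z ∈ piece f R N c₀ := by
  have hacc := H.acc _ H.mem _ H.mem
  have hc₀ : c₀ ∈ filled f R := hacc.mem_filled
  obtain ⟨r, hr1, hr, hrmin⟩ := exists_first_return hacc N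
  obtain ⟨c, hc, i, hiI, hiJ⟩ := H.exists_outside hf hR hN hr1 hr
  set u := orb f i c with hu
  have huc : Acc f R u c₀ := (H.acc c hc _ H.mem).orb_left i
  have hcu : Acc f R c₀ u := (H.acc _ H.mem c hc).orb_right i
  obtain ⟨e, he1, he, hemin⟩ := exists_first_return huc N
  obtain ⟨t, ht1, ht, htmin⟩ := exists_first_return hcu (N + e)
  have hWc : c₀ ∉ piece f R (N + e) u := by
    intro hmem
    have h1 : orb f e c₀ ∈ piece f R N c₀ := mem_piece_trans he (orb_mem_piece hmem)
    have h2 : r ≤ e := by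
      by_contra hlt
      exact hrmin e he1 (by omega) h1
    exact hiJ (piece_anti hR (by omega) _ (mem_piece_symm hmem))
  have htI : orb f t c₀ ∈ piece f R N c₀ :=
    mem_piece_trans hiI (piece_anti hR (Nat.le_add_right N e) u ht)
  have hpe : orb f (t + e) c₀ ∈ piece f R N c₀ := by
    rw [orb_add']
    exact mem_piece_trans he (orb_mem_piece ht)
  refine ⟨t + e, by omega, hpe, ?_, ?_, t, e, ht1, he1, rfl,
    ⟨c₀, mem_piece_of_filled hc₀ N, htI⟩, u, hiI, he⟩
  · intro c' _
    refine (hits_add_card_le N t e c₀ c').trans (?_ : _ ≤ 2 + 2)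
    refine add_le_add (hits_first_return hR ht1 htmin ht c') ?_
    rw [hits_congr ht]
    exact hits_first_return hR he1 hemin he c'
  · intro j hj1 hjp hmem
    rcases lt_trichotomy j t with h | h | h
    · refine htmin (t - j) (by omega) (by omega) ?_
      have h1 : orb f (t - j) c₀ ∈ piece f R (N + e) (orb f (t - j) (orb f j c₀)) :=
        orb_mem_piece_of_eq hmem (by omega)
      rw [← orb_add, Nat.sub_add_cancel h.le] at h1
      exact mem_piece_trans ht h1
    · subst h
      rw [show N + (j + e - j) = N + e by omega] at hmem
      exact hWc (mem_piece_trans ht hmem)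
    · have h1 : orb f j c₀ ∈ piece f R (N + (t + e - j)) (orb f (j - t) u) := by
        have := orb_mem_piece_of_eq (k := j - t) (n := N + (t + e - j)) ht (by omega)
        rwa [← orb_add f (j - t) t c₀, Nat.sub_add_cancel h.le] at this
      have h2 := mem_piece_trans h1 hmem
      exact hemin (j - t) (by omega) (by omega)
        (mem_piece_symm (piece_anti hR (Nat.le_add_right _ _) _ h2))

/-- The nest of pieces around `c₀`: depths `N n` and return times `p n`. -/
structure Nest (f : Polynomial ℂ) (R : ℝ) (c₀ : ℂ) (N p : ℕ → ℕ) : Prop where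
  filled : c₀ ∈ filled f R
  succ : ∀ n, N (n + 1) = N n + p n
  pos : ∀ n, 1 ≤ p n
  ret : ∀ n, orb f (p n) c₀ ∈ piece f R (N n) c₀
  hits : ∀ n, ∀ c ∈ crits f, (hits f R (N n) (p n) c₀ c).card ≤ 4
  ret_le : ∀ n z t, z ∈ piece f R (N (n + 1)) c₀ → orb f t z ∈ piece f R (N (n + 1)) c₀ → 1 ≤ t →
    p n ≤ t
  two_mul : ∀ n, 2 * p n ≤ p (n + 1)

lemma MinimalSet.exists_nest {Ω : Finset ℂ} {c₀ : ℂ} {N₀ : ℕ} (H : MinimalSet f R Ω c₀ N₀)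
    (hf : 2 ≤ f.natDegree) (hR : EscR f R) : ∃ N p, Nest f R c₀ N p := by
  have hc₀ : c₀ ∈ BrannerHubbard.filled f R := (H.acc _ H.mem _ H.mem).mem_filled
  have h' : ∀ N : ℕ, ∃ p, N₀ ≤ N → 1 ≤ p ∧ orb f p c₀ ∈ piece f R N c₀ ∧
      (∀ c ∈ crits f, (BrannerHubbard.hits f R N p c₀ c).card ≤ 4) ∧
      (∀ i, 1 ≤ i → i < p → c₀ ∉ piece f R (N + (p - i)) (orb f i c₀)) ∧
      ∃ t e : ℕ, 1 ≤ t ∧ 1 ≤ e ∧ p = t + e ∧ (∃ z ∈ piece f R N c₀, orb f t z ∈ piece f R N c₀) ∧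
        ∃ z ∈ piece f R N c₀, orb f e z ∈ piece f R N c₀ := by
    intro N
    by_cases hN : N₀ ≤ N
    · obtain ⟨p, hp⟩ := H.nest_step hf hR hN
      exact ⟨p, fun _ => hp⟩
    · exact ⟨0, fun h => absurd h hN⟩
  choose q hq using h'
  set N : ℕ → ℕ := fun n => (fun m => m + q m)^[n] N₀ with hNdef
  have hsucc : ∀ n, N (n + 1) = N n + q (N n) := fun n => by
    simp only [hNdef, Function.iterate_succ_apply']
  have hN0 : ∀ n, N₀ ≤ N n := by
    intro n
    induction n with
    | zero => exact le_rfl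
    | succ n ih => rw [hsucc]; omega
  have hret : ∀ n z t, z ∈ piece f R (N (n + 1)) c₀ → orb f t z ∈ piece f R (N (n + 1)) c₀ →
      1 ≤ t → q (N n) ≤ t := by
    intro n z t hz htz ht
    by_contra hlt
    push Not at hlt
    refine (hq (N n) (hN0 n)).2.2.2.1 t ht hlt ?_
    rw [hsucc] at hz htz
    have h1 : orb f t z ∈ piece f R (N n + (q (N n) - t)) (orb f t c₀) :=
      orb_mem_piece_of_eq hz (by omega)
    exact mem_piece_trans h1 (mem_piece_symm (piece_anti hR (by omega) _ htz))
  refine ⟨N, fun n => q (N n), hc₀, hsucc, fun n => (hq _ (hN0 n)).1, fun n => (hq _ (hN0 n)).2.1,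
    fun n => (hq _ (hN0 n)).2.2.1, hret, fun n => ?_⟩
  obtain ⟨t, e, ht, he, hp, ⟨z, hz, hz'⟩, w, hw, hw'⟩ := (hq _ (hN0 (n + 1))).2.2.2.2
  have h1 := hret n z t hz hz' ht
  have h2 := hret n w e hw hw' he
  show 2 * q (N n) ≤ q (N (n + 1))
  omega

/-- The first entry time of `w` into the piece of depth `n` around `c`. -/
noncomputable def entryTime (f : Polynomial ℂ) (R : ℝ) (c : ℂ) (n : ℕ) (w : ℂ) : ℕ :=
  sInf {k | orb f k w ∈ piece f R n c}

lemma entryTime_le {c w : ℂ} {n k : ℕ} (h : orb f k w ∈ piece f R n c) :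
    entryTime f R c n w ≤ k := Nat.sInf_le h

lemma entryTime_mem {c w : ℂ} (h : Acc f R w c) (n : ℕ) :
    orb f (entryTime f R c n w) w ∈ piece f R n c := by
  obtain ⟨k, -, hk⟩ := h n 0
  exact Nat.sInf_mem (s := {k | orb f k w ∈ piece f R n c}) ⟨k, hk⟩

lemma notMem_of_lt_entryTime {c w : ℂ} {n k : ℕ} (h : k < entryTime f R c n w) :
    orb f k w ∉ piece f R n c := fun hk => (entryTime_le hk).not_gt h

lemma entryTime_mono (hR : EscR f R) {c w : ℂ} (h : Acc f R w c) {m n : ℕ} (hmn : m ≤ n) :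
    entryTime f R c m w ≤ entryTime f R c n w :=
  entryTime_le (piece_anti hR hmn c (entryTime_mem h n))

lemma entryTime_eq_zero {c w : ℂ} {n : ℕ} (h : w ∈ piece f R n c) : entryTime f R c n w = 0 :=
  Nat.le_zero.1 (entryTime_le h)

namespace Nest

variable {c₀ : ℂ} {N p : ℕ → ℕ}

lemma mono (H : Nest f R c₀ N p) : Monotone N :=
  monotone_nat_of_le_succ fun n => by rw [H.succ]; omega

lemma orb_mem (H : Nest f R c₀ N p) {n : ℕ} {z : ℂ} (hz : z ∈ piece f R (N (n + 1)) c₀) :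
    orb f (p n) z ∈ piece f R (N n) c₀ :=
  mem_piece_trans (H.ret n) (orb_mem_piece_of_eq hz (H.succ n))

lemma orb_mem_sub (H : Nest f R c₀ N p) (s M : ℕ) : ∀ z ∈ piece f R (N (s + M)) c₀,
    orb f (N (s + M) - N s) z ∈ piece f R (N s) c₀ := by
  induction M with
  | zero => intro z hz; simpa using hz
  | succ M ih =>
    intro z hz
    have h1 := ih _ (H.orb_mem (n := s + M) hz)
    rw [← orb_add] at h1
    have h2 := H.mono (Nat.le_add_right s M)
    have h3 := H.succ (s + M)
    rwa [show N (s + M) - N s + p (s + M) = N (s + (M + 1)) - N s by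
      rw [← add_assoc, h3]; omega] at h1

lemma hits_sub (H : Nest f R c₀ N p) (s M : ℕ) : ∀ z ∈ piece f R (N (s + M)) c₀, ∀ c ∈ crits f,
    (BrannerHubbard.hits f R (N s) (N (s + M) - N s) z c).card ≤ 4 * M := by
  induction M with
  | zero =>
    intro z hz c _
    refine (hits_card_le _ _ _ _).trans ?_
    simp
  | succ M ih =>
    intro z hz c hc
    have h2 := H.mono (Nat.le_add_right s M)
    have h3 := H.succ (s + M)
    have h4 : N (s + (M + 1)) - N s = p (s + M) + (N (s + M) - N s) := by
      rw [← add_assoc, h3]; omega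
    rw [h4]
    refine (hits_add_card_le _ _ _ _ _).trans ?_
    have h5 := ih _ (H.orb_mem (n := s + M) hz) c hc
    have h6 := H.hits (s + M) c hc
    rw [show N s + (N (s + M) - N s) = N (s + M) by omega]
    have h7 : z ∈ piece f R (N (s + M) + p (s + M)) c₀ := by
      rw [← h3]; exact hz
    rw [hits_congr h7]
    omega

lemma le_two_mul (H : Nest f R c₀ N p) (s M : ℕ) : N (s + M + 1) ≤ N s + 2 * p (s + M) := by
  induction M with
  | zero =>
    have := H.succ s
    simp only [add_zero]
    omega
  | succ M ih =>
    have h1 := H.succ (s + M + 1)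
    have h2 := H.two_mul (s + M)
    rw [← add_assoc]
    omega

/-- The piece of `w` pulled back along the first entry. -/
noncomputable def L (f : Polynomial ℂ) (R : ℝ) (c₀ : ℂ) (N : ℕ → ℕ) (n : ℕ) (w : ℂ) : Set ℂ :=
  piece f R (N n + entryTime f R c₀ (N n) w) w

lemma L_succ_subset (hR : EscR f R) (H : Nest f R c₀ N p) {w : ℂ} (hw : Acc f R w c₀) (n : ℕ) :
    L f R c₀ N (n + 1) w ⊆ L f R c₀ N n w := by
  refine piece_anti hR ?_ w
  have h1 := H.mono (Nat.le_succ n)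
  exact add_le_add h1 (entryTime_mono hR hw h1)

lemma L_eq {w : ℂ} {n : ℕ} (hw : w ∈ piece f R (N n) c₀) :
    L f R c₀ N n w = piece f R (N n) w := by
  rw [L, entryTime_eq_zero hw, add_zero]

/-- The uniform capacity bound at level `n`. -/
def CapBound (f : Polynomial ℂ) (R : ℝ) (c₀ : ℂ) (N : ℕ → ℕ) (n : ℕ) (X : ℝ) : Prop :=
  ∀ w ∈ BrannerHubbard.filled f R, Acc f R w c₀ →
    HasCap (L f R c₀ N n w) (L f R c₀ N (n + 1) w) X

lemma CapBound.mono {n : ℕ} {X Y : ℝ} (h : CapBound f R c₀ N n X) (hXY : X ≤ Y) :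
    CapBound f R c₀ N n Y := fun w hw hc => (h w hw hc).mono Subset.rfl Subset.rfl hXY

lemma exists_capBound (H : Nest f R c₀ N p) (hf : 2 ≤ f.natDegree) (hR : EscR f R) (n : ℕ) :
    ∃ X, CapBound f R c₀ N n X := by
  refine ⟨(f.natDegree : ℝ) ^ ((crits f).card * 1) * (f.natDegree ^ N n * (16 * Real.pi)),
    fun w hw hc => ?_⟩
  have hk := entryTime_mem hc (N n)
  refine HasCap.pull hf (by positivity) (hw _) (hasCap_piece hf hR (N n) _)
    (L_succ_subset hR H hc n) (fun z hz => ?_) (multLE_piece hf (hw _) fun c _ =>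
      hits_first_entry hR (fun i hi => notMem_of_lt_entryTime hi) hk c)
  have h1 := H.succ n
  have h2 := H.pos n
  have h3 := entryTime_mono hR hc (H.mono (Nat.le_succ n))
  refine orb_mem_piece (piece_anti hR ?_ w hz)
  simp only [Nat.succ_eq_add_one] at h3
  omega

end Nest

lemma HasCap.chain_fin {L : ℕ → Set ℂ} {c : ℝ} (hc : 0 ≤ c) {M : ℕ}
    (hM : 0 < M) (hL : ∀ i < M, L (i + 1) ⊆ L i) (h : ∀ i < M, HasCap (L i) (L (i + 1)) c) :
    HasCap (L 0) (L M) (c / M) := by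
  classical
  set L' : ℕ → Set ℂ := fun i => if i ≤ M then L i else ∅ with hL'
  have e1 : ∀ i, i ≤ M → L' i = L i := fun i hi => if_pos hi
  have e2 : ∀ i, ¬ i ≤ M → L' i = ∅ := fun i hi => if_neg hi
  have key := HasCap.chain (L := L') (c := c) (fun i => ?_) (fun i => ?_) hM
  · rwa [e1 0 (Nat.zero_le _), e1 M le_rfl] at key
  · by_cases hi : i < M
    · rw [e1 i hi.le, e1 (i + 1) hi]
      exact hL i hi
    · rw [e2 (i + 1) (by omega)]
      exact empty_subset _
  · by_cases hi : i < M
    · rw [e1 i hi.le, e1 (i + 1) hi]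
      exact h i hi
    · rw [e2 (i + 1) (by omega)]
      exact (hasCap_empty _).mono Subset.rfl Subset.rfl hc

/-- The constant of the covering lemma. -/
noncomputable def covConst : ℝ := covering_piece.choose

lemma covConst_pos : 0 < covConst := covering_piece.choose_spec.1

lemma card_le_two_of_spaced {S : Finset ℕ} {g q : ℕ} (hS : ∀ i ∈ S, i < q) (hq : q ≤ 2 * g)
    (hg : ∀ i ∈ S, ∀ j ∈ S, i < j → g ≤ j - i) : S.card ≤ 2 := by
  by_contra hcon
  obtain ⟨a, ha, b, hb, c, hc, hab, hac, hbc⟩ := Finset.two_lt_card.1 (not_le.1 hcon)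
  have a1 := hS a ha
  have b1 := hS b hb
  have c1 := hS c hc
  have h1 := hg a ha b hb
  have h2 := hg b hb a ha
  have h3 := hg a ha c hc
  have h4 := hg c hc a ha
  have h5 := hg b hb c hc
  have h6 := hg c hc b hb
  omega

namespace Nest

variable {c₀ : ℂ} {N p : ℕ → ℕ}

/-- The capacity bound inside the nest. -/
noncomputable def nestBound (f : Polynomial ℂ) (M : ℕ) (X : ℝ) : ℝ :=
  covConst * (((crits f).card * (4 * M : ℕ) + 1) * (f.natDegree : ℝ) ^ ((crits f).card * (4 * M)) +
    (f.natDegree : ℝ) ^ ((crits f).card * 2) * √(X / M * (X / M + X)))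

lemma hasCap_nest (H : Nest f R c₀ N p) (hf : 2 ≤ f.natDegree) (hR : EscR f R) {s M : ℕ}
    (hM : 1 ≤ M) {X : ℝ} (hX0 : 0 ≤ X)
    (hX : ∀ n, s ≤ n → n ≤ s + M → CapBound f R c₀ N n X) {w : ℂ}
    (hw : w ∈ BrannerHubbard.filled f R) (hc : Acc f R w c₀)
    (hwI : w ∈ piece f R (N (s + M)) c₀) :
    HasCap (piece f R (N (s + M)) w) (L f R c₀ N (s + M + 2) w) (nestBound f M X) := by
  set q := N (s + M) - N s with hq
  set v := orb f q w with hv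
  have hsM : N s ≤ N (s + M) := H.mono (Nat.le_add_right s M)
  have hvI : v ∈ piece f R (N s) c₀ := H.orb_mem_sub s M w hwI
  have hvf : v ∈ BrannerHubbard.filled f R := mem_filled_orb hw q
  have hvc : Acc f R v c₀ := hc.orb_left q
  set E := entryTime f R c₀ (N (s + M)) v with hE
  set E' := entryTime f R c₀ (N (s + M + 1)) v with hE'
  have hEE' : E ≤ E' := entryTime_mono hR hvc (H.mono (Nat.le_succ _))
  have s1 := H.succ (s + M)
  have s2 := H.succ (s + M + 1)
  have s3 := H.two_mul (s + M)
  obtain ⟨M', rfl⟩ : ∃ M', M = M' + 1 := ⟨M - 1, by omega⟩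
  have s4 := H.le_two_mul s M'
  have s5 := H.two_mul (s + M')
  have hchain : HasCap (piece f R (N s) v) (piece f R (N (s + (M' + 1) + 1) + E') v)
      (X / (M' + 1 : ℕ)) := by
    have h1 := HasCap.chain_fin hX0 hM (L := fun i => L f R c₀ N (s + i) v)
      (fun i _ => L_succ_subset hR H hvc (s + i))
      (fun i hi => hX (s + i) (by omega) (by omega) v hvf hvc)
    simp only [add_zero] at h1
    rw [L_eq hvI] at h1
    exact h1.mono Subset.rfl (L_succ_subset hR H hvc (s + (M' + 1))) le_rfl
  have hcap2 : HasCap (piece f R (N (s + (M' + 1)) + E) v)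
      (piece f R (N (s + (M' + 1) + 1) + E') v) X :=
    hX (s + (M' + 1)) (by omega) le_rfl v hvf hvc
  have hEmem := entryTime_mem hvc (N (s + (M' + 1)))
  have hhits2 : ∀ c ∈ crits f,
      (BrannerHubbard.hits f R (N (s + (M' + 1)) + E) q w c).card ≤ 2 := by
    intro c _
    refine card_le_two_of_spaced (q := q) (g := p (s + M')) (fun i hi => (mem_hits.1 hi).1)
      (by rw [hq, ← add_assoc]; omega) ?_
    intro i hi j hj hij
    rw [mem_hits] at hi hj
    have in_nest : ∀ i, i < q → c ∈ piece f R (N (s + (M' + 1)) + E + (q - i)) (orb f i w) →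
        orb f (E + (q - i)) c ∈ piece f R (N (s + (M' + 1))) c₀ := by
      intro i hi h
      have h1 : orb f (E + (q - i)) c ∈
          piece f R (N (s + (M' + 1))) (orb f (E + (q - i)) (orb f i w)) :=
        orb_mem_piece_of_eq h (by omega)
      rw [← orb_add f (E + (q - i)) i w, show E + (q - i) + i = E + q by omega, orb_add] at h1
      exact mem_piece_trans hEmem h1
    have hi2 := in_nest i hi.1 hi.2
    have hj2 := in_nest j hj.1 hj.2
    refine H.ret_le (s + M') (orb f (E + (q - j)) c) (j - i) hj2 ?_ (by omega)
    rw [← orb_add, show j - i + (E + (q - j)) = E + (q - i) by omega]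
    exact hi2
  have key := covering_piece.choose_spec.2 f R q (N s) (N (s + (M' + 1)) + E)
    (N (s + (M' + 1) + 1) + E') (4 * (M' + 1)) 2 w (X / (M' + 1 : ℕ)) X hf hR (by omega) (by omega)
    (hw _) (by positivity) hX0 (H.hits_sub s (M' + 1) w hwI) hhits2 hchain hcap2
  rw [show N s + q = N (s + (M' + 1)) by omega] at key
  refine key.mono Subset.rfl (piece_anti hR ?_ w) le_rfl
  set T := entryTime f R c₀ (N (s + (M' + 1) + 2)) w with hT
  have hTmem : orb f T w ∈ piece f R (N (s + (M' + 1) + 2)) c₀ := entryTime_mem hc _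
  have e0 : N (s + (M' + 1) + 2) = N (s + (M' + 1) + 1) + p (s + (M' + 1) + 1) := s2
  by_cases hTq : q ≤ T
  · have h1 : E' ≤ T - q := by
      refine entryTime_le ?_
      rw [hv, ← orb_add, Nat.sub_add_cancel hTq]
      exact piece_anti hR (by omega) _ hTmem
    omega
  · have h0 : q ≤ T + p (s + (M' + 1) + 1) := by
      rw [← add_assoc] at s3 s1 s2 hq ⊢
      omega
    have h1 : E' ≤ T + p (s + (M' + 1) + 1) - q := by
      refine entryTime_le ?_
      rw [hv, ← orb_add, Nat.sub_add_cancel h0, orb_add']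
      exact H.orb_mem hTmem
    omega

/-- The capacity recursion. -/
lemma capBound_step (H : Nest f R c₀ N p) (hf : 2 ≤ f.natDegree) (hR : EscR f R) {s M : ℕ}
    (hM : 1 ≤ M) {X : ℝ} (hX0 : 0 ≤ X)
    (hX : ∀ n, s ≤ n → n ≤ s + M → CapBound f R c₀ N n X) :
    CapBound f R c₀ N (s + M + 2)
      ((f.natDegree : ℝ) ^ ((crits f).card * 9) * nestBound f M X) := by
  intro w hw hc
  set n := s + M with hn
  set E := entryTime f R c₀ (N (n + 2)) w with hE
  set Q := p n + p (n + 1) with hQ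
  have s1 := H.succ n
  have s2 := H.succ (n + 1)
  have s3 := H.succ (n + 2)
  have t1 := H.two_mul n
  have t2 := H.two_mul (n + 1)
  have hEmem : orb f E w ∈ piece f R (N (n + 2)) c₀ := entryTime_mem hc _
  set w' := orb f E w with hw'
  set w'' := orb f (E + Q) w with hw''
  have hww : w'' = orb f Q w' := by rw [hw'', orb_add']
  have hQN : Q = N (n + 2) - N n := by
    show Q = N (n + 1 + 1) - N n
    omega
  have hwI : w'' ∈ piece f R (N n) c₀ := by
    rw [hww, hQN]
    exact H.orb_mem_sub n 2 w' hEmem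
  have hwc : Acc f R w'' c₀ := hc.orb_left _
  have hwf : w'' ∈ BrannerHubbard.filled f R := mem_filled_orb hw _
  have hcap := H.hasCap_nest hf hR hM hX0 hX hwf hwc hwI
  have e1 : N n + (E + Q) = N (n + 2) + E := by
    show N n + (E + Q) = N (n + 1 + 1) + E
    omega
  have hmult : MultLE (itp f (E + Q)) (piece f R (N n + (E + Q)) w)
      ((f.natDegree : ℝ) ^ ((crits f).card * 9)) := by
    refine multLE_piece hf (hw _) fun c hcc => ?_
    refine (hits_add_card_le _ _ _ _ _).trans (?_ : _ ≤ 1 + 8)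
    refine add_le_add ?_ ?_
    · rw [show N n + Q = N (n + 2) by omega]
      exact hits_first_entry hR (fun i hi => notMem_of_lt_entryTime hi) hEmem c
    · have := H.hits_sub n 2 w' hEmem c hcc
      rwa [← hQN] at this
  have hL : L f R c₀ N (n + 2) w = piece f R (N n + (E + Q)) w := by rw [e1]; rfl
  have hsub := L_succ_subset hR H hc (n + 2)
  rw [hL] at hsub ⊢
  refine HasCap.pull hf (by positivity) (hw _) hcap hsub (fun z hz => ?_) hmult
  set J := entryTime f R c₀ (N (n + 2 + 1)) w with hJ
  have hJmem : orb f J w ∈ piece f R (N (n + 2 + 1)) c₀ := entryTime_mem hc _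
  have hEJ : E ≤ J := entryTime_mono hR hc (H.mono (Nat.le_succ _))
  have hdepth : N (n + 2) + entryTime f R c₀ (N (n + 2)) w'' + (E + Q) ≤ N (n + 2 + 1) + J := by
    have u2 : p (n + 1 + 1) = p (n + 2) := rfl
    by_cases hJk : E + Q ≤ J
    · have h1 : entryTime f R c₀ (N (n + 2)) w'' ≤ J - (E + Q) := by
        refine entryTime_le ?_
        rw [hw'', ← orb_add, Nat.sub_add_cancel hJk]
        exact piece_anti hR (by omega) _ hJmem
      omega
    · have h0 : E + Q ≤ J + p (n + 2) := by omega
      have h1 : entryTime f R c₀ (N (n + 2)) w'' ≤ J + p (n + 2) - (E + Q) := by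
        refine entryTime_le ?_
        rw [hw'', ← orb_add, Nat.sub_add_cancel h0, orb_add']
        exact H.orb_mem hJmem
      omega
  exact orb_mem_piece (piece_anti hR hdepth w hz)

end Nest

lemma exists_nestBound_contraction {f : Polynomial ℂ} (hf : 2 ≤ f.natDegree) :
    ∃ M : ℕ, 1 ≤ M ∧ ∃ A : ℝ, 0 ≤ A ∧ ∀ X : ℝ, 0 ≤ X →
      (f.natDegree : ℝ) ^ ((crits f).card * 9) * Nest.nestBound f M X ≤ A + X / 2 := by
  set a : ℝ := (f.natDegree : ℝ) ^ ((crits f).card * 9) with ha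
  set b : ℝ := (f.natDegree : ℝ) ^ ((crits f).card * 2) with hb
  have hd : (0 : ℝ) < f.natDegree := by
    have : 0 < f.natDegree := by omega
    exact_mod_cast this
  have ha0 : 0 < a := by positivity
  have hb0 : 0 < b := by positivity
  have hc := covConst_pos
  set k : ℝ := a * covConst * b with hk
  have hk0 : 0 < k := by positivity
  obtain ⟨M, hM⟩ := exists_nat_gt (8 * k ^ 2 + 1)
  have hM1 : (1 : ℝ) < M := by nlinarith [sq_nonneg k]
  have hM0 : (0 : ℝ) < M := by linarith
  refine ⟨M, by exact_mod_cast hM1.le, a * (covConst * (((crits f).card * (4 * M : ℕ) + 1) *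
    (f.natDegree : ℝ) ^ ((crits f).card * (4 * M)))), by positivity, fun X hX => ?_⟩
  have h1 : √(X / M * (X / M + X)) ≤ X / (2 * k) := by
    refine Real.sqrt_le_iff.2 ⟨by positivity, ?_⟩
    have h2 : X / M ≤ X := div_le_self hX hM1.le
    have h3 : X / M * (X / M + X) ≤ X / M * (2 * X) := by
      refine mul_le_mul_of_nonneg_left (by linarith) (by positivity)
    refine h3.trans ?_
    rw [div_pow, div_mul_eq_mul_div, div_le_div_iff₀ hM0 (by positivity)]
    nlinarith [mul_nonneg (sq_nonneg X) (by linarith : (0 : ℝ) ≤ M - 8 * k ^ 2)]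
  have h4 : k * √(X / M * (X / M + X)) ≤ X / 2 := by
    calc k * √(X / M * (X / M + X)) ≤ k * (X / (2 * k)) := mul_le_mul_of_nonneg_left h1 hk0.le
      _ = X / 2 := by field_simp
  have h5 : a * Nest.nestBound f M X = a * (covConst * (((crits f).card * (4 * M : ℕ) + 1) *
      (f.natDegree : ℝ) ^ ((crits f).card * (4 * M)))) + k * √(X / M * (X / M + X)) := by
    rw [Nest.nestBound, hk]
    ring
  rw [h5]
  linarith

namespace Nest

variable {c₀ : ℂ} {N p : ℕ → ℕ}

lemma exists_uniform_capBound (H : Nest f R c₀ N p) (hf : 2 ≤ f.natDegree) (hR : EscR f R) :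
    ∃ X, ∀ n, CapBound f R c₀ N n X := by
  obtain ⟨M, hM, A, hA, hstep⟩ := exists_nestBound_contraction hf
  choose Y hY using H.exists_capBound hf hR
  set B : ℝ := 2 * A + ∑ n ∈ Finset.range (M + 2), |Y n| with hB
  have hs : 0 ≤ ∑ n ∈ Finset.range (M + 2), |Y n| := Finset.sum_nonneg fun _ _ => abs_nonneg _
  refine ⟨B, fun n => ?_⟩
  induction n using Nat.strong_induction_on with
  | _ n ih =>
    by_cases hn : n < M + 2
    · refine (hY n).mono ((le_abs_self _).trans ?_)
      have := Finset.single_le_sum (f := fun n => |Y n|) (fun _ _ => abs_nonneg _)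
        (Finset.mem_range.2 hn)
      linarith
    · obtain ⟨s, rfl⟩ : ∃ s, n = s + M + 2 := ⟨n - (M + 2), by omega⟩
      have hB0 : 0 ≤ B := by linarith
      refine (H.capBound_step hf hR hM hB0 fun k hk hk' => ih k (by omega)).mono ?_
      refine (hstep B hB0).trans ?_
      linarith

lemma subsingleton (H : Nest f R c₀ N p) (hf : 2 ≤ f.natDegree) (hR : EscR f R) {x : ℂ}
    (hx : x ∈ BrannerHubbard.filled f R) (hxc : Acc f R x c₀) :
    (connectedComponentIn (BrannerHubbard.filled f R) x).Subsingleton := by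
  obtain ⟨X, hX⟩ := H.exists_uniform_capBound hf hR
  refine subsingleton_of_caps (L := fun n => L f R c₀ N n x) isPreconnected_connectedComponentIn
    (fun n => L_succ_subset hR H hxc n) (fun n => ?_) (piece_subset_ball hR _ _)
    (fun n => hX n x hx hxc)
  rw [← iInter_piece hf hR hx]
  exact iInter_subset _ _

end Nest

/-- Every critical point accumulated by the orbit of `x` accumulates a minimal set. -/
lemma exists_minimalSet (hR : EscR f R) {x : ℂ}
    (h1 : ∃ c ∈ crits f, Acc f R x c)
    (h2 : ∀ c ∈ crits f, Acc f R x c → ∃ c' ∈ crits f, Acc f R c c')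
    (h3 : ∀ c ∈ crits f, Acc f R x c → ∀ τ ≥ 1, ∃ l, orb f τ c ∉ piece f R l c) :
    ∃ Ω c₀ N₀, MinimalSet f R Ω c₀ N₀ ∧ Acc f R x c₀ := by
  classical
  set A : ℂ → Finset ℂ := fun c => (crits f).filter (Acc f R c) with hA
  have mA : ∀ c c', c' ∈ A c ↔ c' ∈ crits f ∧ Acc f R c c' := fun c c' => Finset.mem_filter
  obtain ⟨c₁, hc₁, hmin⟩ := (A x).exists_min_image (fun c => (A c).card)
    (h1.imp fun c hc => (mA _ _).2 hc)
  rw [mA] at hc₁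
  obtain ⟨c₀, hc₀⟩ := h2 c₁ hc₁.1 hc₁.2
  have hx : ∀ c ∈ A c₁, c ∈ A x := fun c hc =>
    (mA _ _).2 ⟨((mA _ _).1 hc).1, hc₁.2.trans ((mA _ _).1 hc).2⟩
  have hEq : ∀ c ∈ A c₁, A c = A c₁ := fun c hc =>
    Finset.eq_of_subset_of_card_le
      (fun c' hc' => (mA _ _).2 ⟨((mA _ _).1 hc').1, ((mA _ _).1 hc).2.trans ((mA _ _).1 hc').2⟩)
      (hmin c (hx c hc))
  have hc₀A : c₀ ∈ A c₁ := (mA _ _).2 hc₀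
  have hxc₀ := (mA _ _).1 (hx c₀ hc₀A)
  have hself : Acc f R c₀ c₀ := ((mA _ _).1 ((hEq c₀ hc₀A).symm ▸ hc₀A)).2
  have hsep : ∀ c, ∃ n, c ∈ crits f → c ∉ A c₁ → ∀ i, c ∉ piece f R n (orb f i c₀) := by
    intro c
    by_cases hc : c ∈ crits f ∧ c ∉ A c₁
    · have hnot : ¬ Acc f R c₀ c := fun h => hc.2 (hEq c₀ hc₀A ▸ (mA _ _).2 ⟨hc.1, h⟩)
      simp only [Acc] at hnot
      push Not at hnot
      obtain ⟨n, m, hnm⟩ := hnot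
      refine ⟨n, fun _ _ i hi => ?_⟩
      obtain ⟨k, hk, hk'⟩ := hself.orb_right i n m
      exact hnm k hk (by rwa [← piece_eq hi])
    · exact ⟨0, fun h h' => absurd ⟨h, h'⟩ hc⟩
  choose n hn using hsep
  refine ⟨A c₁, c₀, (crits f).sup n, ⟨hc₀A, Finset.filter_subset _ _, fun c hc c' hc' => ?_,
    h3 c₀ hxc₀.1 hxc₀.2, fun c hc hc' i hi => ?_⟩, hxc₀.2⟩
  · rw [← hEq c hc] at hc'
    exact ((mA _ _).1 hc').2
  · exact hn c hc hc' i (piece_anti hR (Finset.le_sup (f := n) hc) _ hi)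

/-- A component of the filled Julia set that never meets a periodic critical component is a
point. -/
theorem subsingleton_component (hf : 2 ≤ f.natDegree) (hR : EscR f R) {x : ℂ}
    (hx : x ∈ filled f R)
    (h : ∀ c ∈ crits f, ∀ τ ≥ 1, (∀ l, orb f τ c ∈ piece f R l c) →
      ∀ n, ∃ l, orb f n x ∉ piece f R l c) :
    (connectedComponentIn (filled f R) x).Subsingleton := by
  by_cases h1 : ∃ c ∈ crits f, Acc f R x c
  swap
  · push Not at h1
    exact subsingleton_of_no_acc hf hR hx h1
  by_cases h2 : ∀ c ∈ crits f, Acc f R x c → ∃ c' ∈ crits f, Acc f R c c'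
  swap
  · push Not at h2
    obtain ⟨c, -, hxc, hc⟩ := h2
    exact subsingleton_of_acc_no_acc hf hR hx hxc hc
  by_cases h3 : ∀ c ∈ crits f, Acc f R x c → ∀ τ ≥ 1, ∃ l, orb f τ c ∉ piece f R l c
  swap
  · push Not at h3
    obtain ⟨c, hc, hxc, τ, hτ, hper⟩ := h3
    exact subsingleton_of_acc_periodic hf hR hx hxc hτ hper (h c hc τ hτ hper)
  obtain ⟨Ω, c₀, N₀, hΩ, hxc₀⟩ := exists_minimalSet hR h1 h2 h3
  obtain ⟨N, p, H⟩ := hΩ.exists_nest hf hR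
  exact H.subsingleton hf hR hx hxc₀

lemma mem_component_iff (hf : 2 ≤ f.natDegree) (hR : EscR f R) {x y : ℂ} (hx : x ∈ filled f R) :
    y ∈ connectedComponentIn (filled f R) x ↔ ∀ n, y ∈ piece f R n x := by
  rw [← iInter_piece hf hR hx, mem_iInter]

/-- Iterates map components of the filled Julia set onto components. -/
lemma image_component (hf : 2 ≤ f.natDegree) (hR : EscR f R) {x : ℂ} (hx : x ∈ filled f R)
    (k : ℕ) : orb f k '' connectedComponentIn (filled f R) x =
      connectedComponentIn (filled f R) (orb f k x) := by
  have hkx := mem_filled_orb hx k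
  apply Subset.antisymm
  · rintro _ ⟨y, hy, rfl⟩
    rw [mem_component_iff hf hR hx] at hy
    rw [mem_component_iff hf hR hkx]
    exact fun n => orb_mem_piece (hy (n + k))
  · intro w hw
    rw [mem_component_iff hf hR hkx] at hw
    have hclosed : IsClosed (orb f k ⁻¹' {w}) :=
      isClosed_singleton.preimage (continuous_orb f k)
    obtain ⟨v, hv⟩ := IsCompact.nonempty_iInter_of_sequence_nonempty_isCompact_isClosed
      (fun n => closure (piece f R (n + k) x) ∩ orb f k ⁻¹' {w})
      (fun n => inter_subset_inter_left _ (closure_mono (piece_anti hR (by omega) x)))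
      (fun n => by
        have h1 := hw n
        rw [← image_piece hf k n (hx _)] at h1
        obtain ⟨v, hv, hvw⟩ := h1
        exact ⟨v, subset_closure hv, hvw⟩)
      (((isCompact_sublevel (itp_natDegree_pos hf (0 + k)) R).of_isClosed_subset isClosed_closure
        (closure_lowComp_subset R x)).inter_right hclosed)
      (fun n => isClosed_closure.inter hclosed)
    rw [mem_iInter] at hv
    refine ⟨v, (mem_component_iff hf hR hx).2 fun n => ?_, (hv 0).2⟩
    exact closure_piece_subset hR n x (closure_mono (piece_anti hR (by omega) x) (hv (n + 1)).1)

/-- A super-attracting periodic point is interior to the filled Julia set. -/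
lemma filled_mem_nhds_of_superattracting (hR : EscR f R) {c : ℂ} (hc : c ∈ filled f R)
    (hcrit : f.derivative.eval c = 0) {m : ℕ} (hm : 1 ≤ m) (hper : orb f m c = c) :
    filled f R ∈ 𝓝 c := by
  have hder : HasDerivAt (orb f m) 0 c := by
    obtain ⟨k, rfl⟩ : ∃ k, m = k + 1 := ⟨m - 1, by omega⟩
    have h1 := (itp f (k + 1)).hasDerivAt c
    rw [itp_add, itp_one, Polynomial.derivative_comp, Polynomial.eval_mul, hcrit, zero_mul] at h1
    refine h1.congr_of_eventuallyEq (Eventually.of_forall fun z => ?_)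
    simp [orb_add, orb_one]
  have h2 := (hasDerivAt_iff_isLittleO.1 hder).bound one_pos
  have hcR : ball (0 : ℂ) R ∈ 𝓝 c := isOpen_ball.mem_nhds (by simpa using hc 0)
  obtain ⟨r, hr, hball⟩ := Metric.mem_nhds_iff.1 (inter_mem h2 hcR)
  refine Filter.mem_of_superset (ball_mem_nhds c hr) fun w hw => ?_
  have key : ∀ k, orb f (k * m) w ∈ ball c r := by
    intro k
    induction k with
    | zero => simpa using hw
    | succ k ih =>
      have h3 := (hball ih).1
      simp only [mem_ofPred_eq, hper, smul_zero, sub_zero, one_mul] at h3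
      rw [add_mul, one_mul, orb_add']
      rw [mem_ball, dist_eq_norm] at ih ⊢
      exact h3.trans_lt ih
  intro n
  refine hR.orb_lt_of_le (Nat.le_mul_of_pos_right n hm) ?_
  simpa using (hball (key n)).2

lemma component_ne_singleton {z : ℂ} (hz : filled f R ∈ 𝓝 z) :
    connectedComponentIn (filled f R) z ≠ {z} := by
  intro h
  obtain ⟨r, hr, hball⟩ := Metric.mem_nhds_iff.1 hz
  have h1 : ball z r ⊆ {z} := by
    rw [← h]
    exact (convex_ball z r).isPreconnected.subset_connectedComponentIn (mem_ball_self hr) hball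
  have h2 : z + (r / 2 : ℝ) ∈ ball z r := by
    rw [mem_ball, dist_eq_norm, add_sub_cancel_left, Complex.norm_real, Real.norm_eq_abs,
      abs_of_pos (by linarith)]
    linarith
  have h3 := h1 h2
  rw [mem_singleton_iff, add_eq_left, Complex.ofReal_eq_zero] at h3
  linarith

end BrannerHubbard

end

/-- For a polynomial of degree `≥ 2` with disconnected Julia set: a connected component
`K` of the filled-in Julia set is a single point if and only if `K` does not eventually
land on a periodic cycle of components containing a critical point. -/
theorem component_is_point_iff_no_critical_periodic_cycle
    (f : Polynomial ℂ) (d : ℕ) (hd : 2 ≤ d) (hdeg : f.natDegree = d)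
    (Kf : Set ℂ)
    (hKf : Kf = {z : ℂ | Bornology.IsBounded
      (Set.range fun n : ℕ => (fun w : ℂ => f.eval w)^[n] z)})
    (Jf : Set ℂ) (hJf : Jf = frontier Kf)
    (hdis : ¬ IsConnected Jf)
    (K : Set ℂ) (hKcomp : ∃ x ∈ Kf, K = connectedComponentIn Kf x) :
    (∃ z : ℂ, K = {z}) ↔
      ¬ ∃ n m : ℕ, 1 ≤ m ∧
        (fun w : ℂ => f.eval w)^[n + m] '' K = (fun w : ℂ => f.eval w)^[n] '' K ∧
        ∃ j < m, ∃ c : ℂ, f.derivative.eval c = 0 ∧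
          c ∈ (fun w : ℂ => f.eval w)^[n + j] '' K := by
  have hf : 2 ≤ f.natDegree := hdeg ▸ hd
  obtain ⟨R, hR⟩ := BrannerHubbard.exists_escR hf
  obtain ⟨x, hx, rfl⟩ := hKcomp
  rw [← hR.filled_eq] at hKf
  subst hKf
  change _ ↔ ¬ ∃ n m : ℕ, 1 ≤ m ∧
    BrannerHubbard.orb f (n + m) '' _ = BrannerHubbard.orb f n '' _ ∧
    ∃ j < m, ∃ c : ℂ, f.derivative.eval c = 0 ∧ c ∈ BrannerHubbard.orb f (n + j) '' _
  constructor
  · rintro ⟨z, hz⟩ ⟨n, m, hm, hcycle, j, -, c, hcrit, hc⟩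
    have hzK : z ∈ connectedComponentIn (BrannerHubbard.filled f R) x := by
      rw [hz]
      exact Set.mem_singleton z
    have hzf := connectedComponentIn_subset _ _ hzK
    rw [connectedComponentIn_eq hzK] at hz
    rw [connectedComponentIn_eq hzK, hz, Set.image_singleton, Set.image_singleton,
      Set.singleton_eq_singleton_iff] at hcycle
    rw [connectedComponentIn_eq hzK, hz, Set.image_singleton, Set.mem_singleton_iff] at hc
    have hper : BrannerHubbard.orb f m c = c := by
      rw [hc, ← BrannerHubbard.orb_add, show m + (n + j) = j + (n + m) by omega,
        BrannerHubbard.orb_add f j, hcycle, ← BrannerHubbard.orb_add, add_comm]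
    have hnhds := BrannerHubbard.filled_mem_nhds_of_superattracting hR
      (hc ▸ BrannerHubbard.mem_filled_orb hzf (n + j)) hcrit hm hper
    rw [hc] at hnhds
    refine BrannerHubbard.component_ne_singleton (Filter.mem_of_superset
      ((BrannerHubbard.continuous_orb f (n + j)).continuousAt.preimage_mem_nhds hnhds)
      fun w hw i => hR.orb_lt_of_le (Nat.le_add_right i (n + j)) ?_) hz
    rw [BrannerHubbard.orb_add]
    exact hw i
  · intro h
    have hsub := BrannerHubbard.subsingleton_component hf hR hx fun c hc τ hτ hper n => by
      by_contra! hn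
      have hcf : c ∈ BrannerHubbard.filled f R := fun l =>
        BrannerHubbard.lt_of_mem_piece (BrannerHubbard.mem_piece_symm (hn l))
      have h1 := connectedComponentIn_eq ((BrannerHubbard.mem_component_iff hf hR hcf).2 hper)
      have h2 := connectedComponentIn_eq ((BrannerHubbard.mem_component_iff hf hR hcf).2 hn)
      refine h ⟨n, τ, hτ, ?_, 0, hτ, c, (BrannerHubbard.mem_crits hf).1 hc, ?_⟩
      · rw [BrannerHubbard.image_component hf hR hx, BrannerHubbard.image_component hf hR hx,
          BrannerHubbard.orb_add', ← BrannerHubbard.image_component hf hR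
          (BrannerHubbard.mem_filled_orb hx n), ← h2, BrannerHubbard.image_component hf hR hcf,
          ← h1]
      · rw [add_zero, BrannerHubbard.image_component hf hR hx, ← h2]
        exact mem_connectedComponentIn hcf
    exact Set.exists_eq_singleton_iff_nonempty_subsingleton.2
      ⟨⟨x, mem_connectedComponentIn hx⟩, hsub⟩
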